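/- For every n ≥ 2, the Haglund–Loehr zeta map of type D_n, sending (π,v) to (ζ_D(π), d_D(π,v)), is a bijection from Vert(D_n) onto Diag(D_n). -/

import Mathlib

inductive Step
  | N : Step
  | E : Step
  deriving DecidableEq

/-- The number of East steps strictly preceding the `k`-th North step. -/
def ebn : List Step → ℕ → ℕ
  | _, 0 => 0
  | [], _ + 1 => 0
  | Step.E :: rest, k + 1 => ebn rest (k + 1) + 1
  | Step.N :: rest, k + 1 => ebn rest k

/-- A lattice path with `a` East steps and `b` North steps. -/
def IsLatticePath (a b : ℕ) (π : List Step) : Prop :=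
  π.count Step.E = a ∧ π.count Step.N = b

/-- A ballot path of length `m`: every prefix has at least as many `N`s as `E`s. -/
def IsBallotPath (m : ℕ) (β : List Step) : Prop :=
  β.length = m ∧ ∀ k : ℕ, (β.take k).count Step.E ≤ (β.take k).count Step.N

/-- `i` is a rise: the `i`-th North step is immediately followed by a North step. -/
def IsRise (π : List Step) (i : ℕ) : Prop :=
  ∃ p : ℕ, π[p]? = some Step.N ∧ π[p + 1]? = some Step.N ∧ (π.take p).count Step.N + 1 = i

/-- `(i,j)` is a valley: the `i`-th East step is immediately followed by the `j`-th North
step; in addition if the path ends with an East step and consists of `i` East steps and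
`j - 1` North steps, then `(i, j)` counts as a valley. -/
def IsValley (β : List Step) (i j : ℕ) : Prop :=
  (∃ p : ℕ, β[p]? = some Step.E ∧ β[p + 1]? = some Step.N ∧
      (β.take p).count Step.E + 1 = i ∧ (β.take (p + 1)).count Step.N + 1 = j) ∨
  (β.getLast? = some Step.E ∧ i = β.count Step.E ∧ j = β.count Step.N + 1)

/-- Read `a` from left to right, writing `N` for each entry `j` and `E` for each entry `j+1`. -/
def sPlusL (j : ℤ) (a : List ℤ) : List Step :=
  a.filterMap fun x => if x = j then some Step.N else if x = j + 1 then some Step.E else none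

/-- Read `a` from right to left, writing `N` for each entry `j` and `E` for each entry `j+1`. -/
def sPlusR (j : ℤ) (a : List ℤ) : List Step := sPlusL j a.reverse

/-- Read `a` from left to right, writing `N` for each entry `-j` and `E` for each entry `-j-1`. -/
def sMinusL (j : ℤ) (a : List ℤ) : List Step :=
  a.filterMap fun x => if x = -j then some Step.N else if x = -j - 1 then some Step.E else none

/-- Read `a` from right to left, writing `N` for each entry `-j` and `E` for each entry `-j-1`. -/
def sMinusR (j : ℤ) (a : List ℤ) : List Step := sMinusL j a.reverse

/-- `w` is the window `[w(1),…,w(n)]` of a signed permutation of rank `n`. -/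
def IsSignedPerm (n : ℕ) (w : Fin n → ℤ) : Prop :=
  (∀ i, 1 ≤ |w i| ∧ |w i| ≤ (n : ℤ)) ∧ Function.Injective fun i => |w i|

/-- Evaluation of (the window of) a signed permutation at any integer, via `w(-j) = -w(j)`
and `w(0) = 0`. -/
def evalSP {n : ℕ} (w : Fin n → ℤ) (j : ℤ) : ℤ :=
  if h : 1 ≤ j ∧ j ≤ (n : ℤ) then w ⟨(j - 1).toNat, by omega⟩
  else if h' : 1 ≤ -j ∧ -j ≤ (n : ℤ) then -w ⟨(-j - 1).toNat, by omega⟩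
  else 0

/-- A possibly signed path: a path together with a sign `ε ∈ {1, -1}` carried by the
distinguished signed East step (the sign is `1` whenever there is no signed step). -/
structure SPath where
  path : List Step
  sgn : ℤ

/-- The `k`-th North step is immediately followed by an East step. -/
def NthNFollowedByE (β : List Step) (k : ℕ) : Prop :=
  ∃ p : ℕ, β[p]? = some Step.N ∧ (β.take p).count Step.N + 1 = k ∧ β[p + 1]? = some Step.E

/-- Signed lattice paths `L•_{n-1,n}`: the first step may carry a sign if it is an East step. -/
def IsSignedLatticePath (n : ℕ) (π : SPath) : Prop :=
  IsLatticePath (n - 1) n π.path ∧ (π.sgn = 1 ∨ π.sgn = -1) ∧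
    (π.path.head? = some Step.N → π.sgn = 1)

/-- Signed ballot paths `B•_{2n-1}`: the East step following the `n`-th North step (if any)
may carry a sign. -/
def IsSignedBallotPath (n : ℕ) (β : SPath) : Prop :=
  IsBallotPath (2 * n - 1) β.path ∧ (β.sgn = 1 ∨ β.sgn = -1) ∧
    (¬ NthNFollowedByE β.path n → β.sgn = 1)

/-- The vector `λ(π)` of a signed lattice path (1-based index). -/
def lamD (n : ℕ) (π : SPath) (i : ℕ) : ℤ :=
  if i = 1 then π.sgn * (ebn π.path 1 : ℤ)
  else if i = n then
    (if (∑ k ∈ Finset.Icc 1 (n - 2), ebn π.path k) % 2 = 0 then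
        2 * (ebn π.path n : ℤ) - (ebn π.path (n - 1) : ℤ)
      else 2 * (n : ℤ) - 1 - 2 * (ebn π.path n : ℤ) + (ebn π.path (n - 1) : ℤ))
  else (ebn π.path i : ℤ)

/-- The type `Dₙ` area vector (1-based index). -/
def areaD (n : ℕ) (π : SPath) (i : ℕ) : ℤ :=
  if i = 1 then
    (if (n - 1) % 4 = 0 ∨ (n - 1) % 4 = 3 then lamD n π 1 else -lamD n π 1)
  else if i = n then
    (if (n - 1) % 4 = 0 ∨ (n - 1) % 4 = 3 then lamD n π n - ((n : ℤ) - 1)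
      else (n : ℤ) - lamD n π n)
  else lamD n π i - ((i : ℤ) - 1)

def areaDList (n : ℕ) (π : SPath) : List ℤ :=
  (List.range n).map fun k => areaD n π (k + 1)

/-- The underlying (unsigned) path of the image of the type `Dₙ` zeta map. -/
def zetaDraw (n : ℕ) (π : SPath) : List Step :=
  (((List.range (2 * n)).reverse.map (fun j =>
    sMinusR (j : ℤ) (areaDList n π) ++ sPlusL (j : ℤ) (areaDList n π))).flatten).dropLast

-- The type `Dₙ` zeta map on signed lattice paths.
open scoped Classical in
noncomputable def zetaD (n : ℕ) (π : SPath) : SPath where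
  path := zetaDraw n π
  sgn :=
    if NthNFollowedByE (zetaDraw n π) n then
      (if ((Finset.Icc 1 n).filter (fun r => 0 < areaD n π r)).card % 2 = 0 then 1 else -1)
    else 1

/-- The type `Dₙ` diagonal reading word, as the list of its window entries. -/
def dDList (n : ℕ) (π : SPath) (v : Fin n → ℤ) : List ℤ :=
  let mult : ℕ → ℤ := fun j =>
    (if j = n then (if (1 + areaD n π (n - 1) + areaD n π n) % 2 = 0 then 1 else -1) else 1) *
    (if j = 1 then
        π.sgn * (if (1 + ((n : ℤ) - 2) +
            (if (n - 1) % 4 = 0 ∨ (n - 1) % 4 = 3 then (n : ℤ) - 1 else (n : ℤ))) % 2 = 0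
          then 1 else -1)
      else 1)
  let base : List ℤ :=
    ((List.range (4 * n + 4)).map (fun i =>
      ((List.finRange n).filterMap (fun j =>
        if areaD n π (j.val + 1) = -(i : ℤ) then some (mult (j.val + 1) * v j) else none)) ++
      ((List.finRange n).reverse.filterMap (fun j =>
        if areaD n π (j.val + 1) = (i : ℤ) + 1 then some (-(mult (j.val + 1) * v j))
        else none)))).flatten
  if ((Finset.Icc 1 n).filter (fun r => 0 < areaD n π r)).card % 2 = 1 then
    (match base with
      | [] => ([] : List ℤ)
      | x :: rest => -x :: rest)
  else base

/-- The type `Dₙ` diagonal reading word. -/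
def dD (n : ℕ) (π : SPath) (v : Fin n → ℤ) : Fin n → ℤ :=
  fun i => (dDList n π v).getD i.val 0

/-- Vertically labelled signed lattice paths of type `Dₙ`. -/
def VertD (n : ℕ) : Set (SPath × (Fin n → ℤ)) :=
  {p : SPath × (Fin n → ℤ) | IsSignedLatticePath n p.1 ∧ IsSignedPerm n p.2 ∧
    (∀ i : ℕ, IsRise p.1.path i → evalSP p.2 (i : ℤ) < evalSP p.2 ((i : ℤ) + 1)) ∧
    (p.1.path.take 2 = [Step.N, Step.N] → |evalSP p.2 1| < evalSP p.2 2) ∧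
    (∏ i : Fin n, (p.2 i).sign) =
      p.1.sgn * (if (lamD n p.1 (n - 1) + lamD n p.1 n) % 2 = 0 then 1 else -1)}

/-- Signed permutations with an even number of sign changes. -/
def IsSignedPermD (n : ℕ) (w : Fin n → ℤ) : Prop :=
  IsSignedPerm n w ∧ (Finset.univ.filter (fun i => w i < 0)).card % 2 = 0

/-- Diagonally labelled signed ballot paths of type `Dₙ`. -/
def DiagD (n : ℕ) : Set (SPath × (Fin n → ℤ)) :=
  {p : SPath × (Fin n → ℤ) | IsSignedBallotPath n p.1 ∧ IsSignedPermD n p.2 ∧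
    (∀ i j : ℕ, IsValley p.1.path i j →
      (j < n → evalSP p.2 ((n : ℤ) + 1 - j) < evalSP p.2 ((n : ℤ) + 1 - i)) ∧
      (j = n → p.1.sgn * evalSP p.2 1 < evalSP p.2 ((n : ℤ) + 1 - i)) ∧
      (j = n + 1 → -(p.1.sgn * evalSP p.2 1) < evalSP p.2 ((n : ℤ) + 1 - i)) ∧
      (n + 2 ≤ j → evalSP p.2 ((n : ℤ) - j) < evalSP p.2 ((n : ℤ) + 1 - i))) ∧
    (∀ i : ℕ, IsValley p.1.path i n → ¬ NthNFollowedByE p.1.path n →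
      |evalSP p.2 1| < evalSP p.2 ((n : ℤ) + 1 - i))}

/-! ### Words in North and East steps -/

namespace HLZeta

open Step

@[simp] theorem ebn_zero (u : List Step) : ebn u 0 = 0 := by cases u <;> simp [ebn]

@[simp] theorem ebn_nil (k : ℕ) : ebn [] k = 0 := by cases k <;> simp [ebn]

@[simp] theorem ebn_E_cons (u : List Step) (k : ℕ) : ebn (E :: u) (k + 1) = ebn u (k + 1) + 1 := by
  simp [ebn]

@[simp] theorem ebn_N_cons (u : List Step) (k : ℕ) : ebn (N :: u) (k + 1) = ebn u k := by
  simp [ebn]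

theorem ebn_mono (u : List Step) : Monotone (ebn u) := by
  refine monotone_nat_of_le_succ fun k => ?_
  induction u generalizing k with
  | nil => simp
  | cons s u ih =>
    cases s <;> cases k <;> simp [ih]

theorem ebn_le_count (u : List Step) (k : ℕ) : ebn u k ≤ u.count E := by
  induction u generalizing k with
  | nil => simp
  | cons s u ih =>
    cases s <;> cases k <;> simp [ih]

theorem ebn_eq_count (u : List Step) {k : ℕ} (hk : u.count N < k) : ebn u k = u.count E := by
  induction u generalizing k with
  | nil => simp
  | cons s u ih =>
    obtain ⟨k, rfl⟩ : ∃ m, k = m + 1 := ⟨k - 1, by omega⟩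
    cases s
    · have := @ih k (by simpa using hk)
      simpa using this
    · have := @ih (k + 1) (by simpa using hk)
      simpa using this

theorem count_le_ebn_append (x y : List Step) {k : ℕ} (hk : x.count N < k) :
    x.count E ≤ ebn (x ++ y) k := by
  induction x generalizing k with
  | nil => simp
  | cons s u ih =>
    obtain ⟨k, rfl⟩ : ∃ m, k = m + 1 := ⟨k - 1, by omega⟩
    cases s
    · have := @ih k (by simpa using hk)
      simpa using this
    · have := @ih (k + 1) (by simpa using hk)
      simpa using this

theorem ebn_append_le_count (x y : List Step) {k : ℕ} (hk : k ≤ x.count N) :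
    ebn (x ++ y) k ≤ x.count E := by
  induction x generalizing k with
  | nil =>
    obtain rfl : k = 0 := by simpa using hk
    simp
  | cons s u ih =>
    cases k with
    | zero => simp
    | succ k =>
      cases s
      · have := @ih k (by simpa using hk)
        simpa using this
      · have := @ih (k + 1) (by simpa using hk)
        simpa using this

theorem count_add_count (u : List Step) : u.count E + u.count N = u.length := by
  induction u with
  | nil => simp
  | cons s u ih => cases s <;> simp <;> omega

theorem le_ebn_dropLast_iff (u : List Step) {i j : ℕ} (hij : i + j ≤ u.length) :
    i ≤ ebn u.dropLast j ↔ i ≤ ebn u j := by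
  induction u generalizing i j with
  | nil => simp
  | cons s u ih =>
    cases j with
    | zero => simp
    | succ j =>
      cases u with
      | nil =>
        obtain rfl : i = 0 := by simp at hij; omega
        simp
      | cons t u =>
        rw [List.dropLast_cons_cons]
        cases s
        · simpa using @ih i j (by simp at hij ⊢; omega)
        · cases i with
          | zero => simp
          | succ i => simpa using @ih i (j + 1) (by simp at hij ⊢; omega)

theorem word_ext {u u' : List Step} (hl : u.length = u'.length)
    (h : ∀ i j, 1 ≤ i → 1 ≤ j → i + j ≤ u.length + 1 → (i ≤ ebn u j ↔ i ≤ ebn u' j)) : u = u' := by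
  induction u generalizing u' with
  | nil => exact (List.length_eq_zero_iff.mp hl.symm).symm
  | cons s u ih =>
    cases u' with
    | nil => simp at hl
    | cons t u' =>
      have hst : s = t := by
        have := h 1 1 le_rfl le_rfl (by simp)
        cases s <;> cases t <;> simp at this <;> rfl
      subst hst
      congr 1
      refine ih (by simpa using hl) fun i j hi hj hij => ?_
      obtain ⟨j, rfl⟩ : ∃ m, j = m + 1 := ⟨j - 1, by omega⟩
      cases s
      · simpa using h i (j + 1 + 1) hi (by omega) (by simp; omega)
      · simpa using h (i + 1) (j + 1) (by omega) hj (by simp; omega)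

theorem nthNFollowedByE_iff (u : List Step) {k : ℕ} (hk : 1 ≤ k) :
    NthNFollowedByE u k ↔ k ≤ u.count N ∧ ebn u k < ebn u (k + 1) := by
  unfold NthNFollowedByE
  induction u generalizing k with
  | nil => simp
  | cons s u ih =>
    obtain ⟨k, rfl⟩ : ∃ m, k = m + 1 := ⟨k - 1, by omega⟩
    cases s
    · cases k with
      | zero =>
        constructor
        · rintro ⟨p, hp, hc, he⟩
          cases p with
          | zero =>
            cases u with
            | nil => simp at he
            | cons t u =>
              simp at he
              subst he
              simp
          | succ p => simp at hc
        · rintro ⟨-, h⟩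
          cases u with
          | nil => simp at h
          | cons t u =>
            cases t
            · simp at h
            · exact ⟨0, by simp⟩
      | succ k =>
        have := @ih (k + 1) (by omega)
        simp only [ebn_N_cons, List.count_cons_self, Nat.add_le_add_iff_right]
        rw [← this]
        constructor
        · rintro ⟨p, hp, hc, he⟩
          cases p with
          | zero => simp at hc
          | succ p => exact ⟨p, by simpa using hp, by simpa using hc, by simpa using he⟩
        · rintro ⟨p, hp, hc, he⟩
          exact ⟨p + 1, by simpa using hp, by simpa using hc, by simpa using he⟩
    · have := @ih (k + 1) (by omega)
      simp only [ebn_E_cons, Nat.add_lt_add_iff_right]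
      rw [show List.count N (E :: u) = List.count N u by simp, ← this]
      constructor
      · rintro ⟨p, hp, hc, he⟩
        cases p with
        | zero => simp at hp
        | succ p => exact ⟨p, by simpa using hp, by simpa using hc, by simpa using he⟩
      · rintro ⟨p, hp, hc, he⟩
        exact ⟨p + 1, by simpa using hp, by simpa using hc, by simpa using he⟩

theorem isRise_iff (u : List Step) {k : ℕ} :
    IsRise u k ↔ 1 ≤ k ∧ k + 1 ≤ u.count N ∧ ebn u k = ebn u (k + 1) := by
  unfold IsRise
  cases k with
  | zero => simp
  | succ k =>
  simp only [show 1 ≤ k + 1 by omega, true_and]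
  induction u generalizing k with
  | nil => simp
  | cons s u ih =>
    cases s
    · cases k with
      | zero =>
        constructor
        · rintro ⟨p, hp, hc, he⟩
          cases p with
          | zero =>
            cases u with
            | nil => simp at hc
            | cons t u =>
              simp at hc
              subst hc
              simp
          | succ p => simp at he
        · rintro ⟨h0, h⟩
          cases u with
          | nil => simp at h0
          | cons t u =>
            cases t
            · exact ⟨0, by simp⟩
            · simp at h
      | succ k =>
        have := @ih k
        simp only [ebn_N_cons, List.count_cons_self, Nat.add_le_add_iff_right]
        rw [← this]
        constructor
        · rintro ⟨p, hp, hc, he⟩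
          cases p with
          | zero => simp at he
          | succ p => exact ⟨p, by simpa using hp, by simpa using hc, by simpa using he⟩
        · rintro ⟨p, hp, hc, he⟩
          exact ⟨p + 1, by simpa using hp, by simpa using hc, by simpa using he⟩
    · have := @ih k
      simp only [ebn_E_cons, Nat.add_right_cancel_iff]
      rw [show List.count N (E :: u) = List.count N u by simp, ← this]
      constructor
      · rintro ⟨p, hp, hc, he⟩
        cases p with
        | zero => simp at hp
        | succ p => exact ⟨p, by simpa using hp, by simpa using hc, by simpa using he⟩
      · rintro ⟨p, hp, hc, he⟩
        exact ⟨p + 1, by simpa using hp, by simpa using hc, by simpa using he⟩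

theorem isValley_iff (u : List Step) {i j : ℕ} :
    IsValley u i j ↔ 1 ≤ j ∧ ebn u j = i ∧ ebn u (j - 1) < i := by
  cases j with
  | zero => simp [IsValley]
  | succ j =>
  simp only [show 1 ≤ j + 1 by omega, true_and, Nat.add_sub_cancel]
  unfold IsValley
  induction u generalizing i j with
  | nil => simp; omega
  | cons s u ih =>
    cases s
    · cases j with
      | zero =>
        simp only [zero_add, ebn_zero]
        rw [show ebn (N :: u) 1 = 0 by simp]
        constructor
        · rintro (⟨p, hp, hc, he, hx⟩ | ⟨hp, hc, he⟩)
          · simp at hx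
          · simp at he
        · omega
      | succ j =>
        have := @ih i j
        simp only [ebn_N_cons]
        rw [← this]
        refine or_congr ⟨?_, ?_⟩ ?_
        · rintro ⟨p, hp, hc, he, hx⟩
          cases p with
          | zero => simp at hp
          | succ p => exact ⟨p, by simpa using hp, by simpa using hc, by simpa using he, by simpa using hx⟩
        · rintro ⟨p, hp, hc, he, hx⟩
          exact ⟨p + 1, by simpa using hp, by simpa using hc, by simpa using he, by simpa using hx⟩
        · cases u with
          | nil => simp
          | cons t u => simp
    · cases i with
      | zero =>
        simp
      | succ i =>
      have := @ih i j
      rw [ebn_E_cons]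
      by_cases hi : i = 0
      · subst hi
        cases j with
        | zero =>
          simp only [zero_add, ebn_zero, Nat.add_eq_right, Nat.one_pos, and_true]
          constructor
          · rintro (⟨p, hp, hc, he, hx⟩ | ⟨hp, hc, he⟩)
            · cases p with
              | zero =>
                cases u with
                | nil => simp
                | cons t u =>
                  simp at hc
                  subst hc
                  simp
              | succ p => simp at he
            · have h1 : u.count E = 0 := by simpa using hc.symm
              have := ebn_le_count u 1
              omega
          · intro h
            cases u with
            | nil => right; simp
            | cons t u =>
              cases t
              · left; exact ⟨0, by simp⟩
              · simp at h
        | succ j =>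
          simp only [ebn_E_cons]
          constructor
          · rintro (⟨p, hp, hc, he, hx⟩ | ⟨hp, hc, he⟩)
            · cases p with
              | zero => simp at hx
              | succ p => simp at he
            · have h1 : u.count E = 0 := by simpa using hc.symm
              cases u with
              | nil => simp at he
              | cons t u =>
                rw [List.getLast?_cons_cons] at hp
                have := congrArg (List.count E) (List.dropLast_append_getLast? _ hp)
                simp only [List.count_append] at this
                simp at this
                omega
          · omega
      · have h2 : (ebn (E :: u) j < i + 1) ↔ ebn u j < i := by
          cases j with
          | zero => simp; omega
          | succ j => simp
        have h3 : ebn u (j + 1) + 1 = i + 1 ↔ ebn u (j + 1) = i := by omega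
        rw [h2, h3, ← this]
        refine or_congr ⟨?_, ?_⟩ ?_
        · rintro ⟨p, hp, hc, he, hx⟩
          cases p with
          | zero => simp at he; omega
          | succ p => exact ⟨p, by simpa using hp, by simpa using hc, by simpa using he, by simpa using hx⟩
        · rintro ⟨p, hp, hc, he, hx⟩
          exact ⟨p + 1, by simpa using hp, by simpa using hc, by simpa using he, by simpa using hx⟩
        · cases u with
          | nil => simp; omega
          | cons t u => simp

theorem ebn_take_append (u : List Step) (k : ℕ) (j : ℕ) (hj : (u.take k).count N < j) :
    (u.take k).count E ≤ ebn u j := by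
  conv_rhs => rw [← List.take_append_drop k u]
  exact count_le_ebn_append _ _ hj

theorem ebn_lt_of_isBallotPath {m : ℕ} {u : List Step} (hu : IsBallotPath m u) {j : ℕ}
    (hj : 1 ≤ j) : ebn u j < j := by
  obtain ⟨-, hu⟩ := hu
  by_cases hc : u.count N < j
  · rw [ebn_eq_count u hc]
    have := hu u.length
    rw [List.take_length] at this
    omega
  · have key : ∀ (u : List Step) (j : ℕ), j ≤ u.count N →
        ∃ k, (u.take k).count N = j - 1 ∧ (u.take k).count E = ebn u j := by
      intro u
      induction u with
      | nil =>
        intro j hj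
        exact ⟨0, by simp at hj; simp [hj]⟩
      | cons s u ih =>
        intro j hj
        cases j with
        | zero => exact ⟨0, by simp⟩
        | succ j =>
          cases s
          · cases j with
            | zero => exact ⟨0, by simp⟩
            | succ j =>
              obtain ⟨k, h1, h2⟩ := ih (j + 1) (by simpa using hj)
              exact ⟨k + 1, by simpa using h1, by simpa using h2⟩
          · obtain ⟨k, h1, h2⟩ := ih (j + 1) (by simpa using hj)
            exact ⟨k + 1, by simpa using h1, by simpa using h2⟩
    obtain ⟨k, h1, h2⟩ := key u j (by omega)
    have := hu k
    omega

theorem isBallotPath_of_ebn_lt {u : List Step}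
    (hu : ∀ i, 1 ≤ i → 2 * i ≤ u.length + 1 → ebn u i < i) : IsBallotPath u.length u := by
  refine ⟨rfl, fun k => ?_⟩
  induction k with
  | zero => simp
  | succ k ih =>
    by_cases hk : k < u.length
    · rw [List.take_add_one, List.getElem?_eq_getElem hk, List.count_append, List.count_append]
      have h1 := count_add_count (u.take k)
      rw [List.length_take, min_eq_left hk.le] at h1
      cases hs : u[k]
      · simp; omega
      · simp only [Option.toList_some, List.count_cons_self, List.count_nil]
        by_contra! hlt
        simp at hlt
        have h2 := hu ((u.take k).count N + 1) (by omega) (by omega)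
        have h3 := ebn_take_append u (k + 1) ((u.take k).count N + 1) (by
          rw [List.take_add_one, List.getElem?_eq_getElem hk, List.count_append]
          simp [hs])
        rw [List.take_add_one, List.getElem?_eq_getElem hk, List.count_append] at h3
        simp [hs] at h3
        omega
    · rw [List.take_of_length_le (by omega)] at ih ⊢
      exact ih

theorem le_count_of_isBallotPath {n : ℕ} {u : List Step}
    (hu : IsBallotPath (2 * n - 1) u) : n ≤ u.count N := by
  obtain ⟨h1, h2⟩ := hu
  have := h2 u.length
  rw [List.take_length] at this
  have := count_add_count u
  omega

/-- A lattice path is determined by the numbers of East steps before its North steps. -/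
theorem latticePath_ext {a b : ℕ} {u u' : List Step} (hu : IsLatticePath a b u)
    (hu' : IsLatticePath a b u') (h : ∀ k, 1 ≤ k → k ≤ b → ebn u k = ebn u' k) : u = u' := by
  refine word_ext ?_ fun i j _ hj _ => ?_
  · rw [← count_add_count, ← count_add_count, hu.1, hu.2, hu'.1, hu'.2]
  · by_cases hjb : j ≤ b
    · rw [h j hj hjb]
    · rw [ebn_eq_count u (by rw [hu.2]; omega), ebn_eq_count u' (by rw [hu'.2]; omega), hu.1, hu'.1]

theorem exists_latticePath (b : ℕ) : ∀ (a : ℕ) (q : ℕ → ℕ),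
    (∀ i j, 1 ≤ i → i ≤ j → j ≤ b → q i ≤ q j) → (∀ i, 1 ≤ i → i ≤ b → q i ≤ a) →
    ∃ u, IsLatticePath a b u ∧ ∀ k, 1 ≤ k → k ≤ b → ebn u k = q k := by
  induction b with
  | zero =>
    intro a q _ _
    exact ⟨List.replicate a E, by simp [IsLatticePath, List.count_replicate], by omega⟩
  | succ b ih =>
    intro a q hq ha
    obtain ⟨u, ⟨hE, hN⟩, hu⟩ := ih (a - q 1) (fun k => q (k + 1) - q 1)
      (fun i j hi hij hj => Nat.sub_le_sub_right (hq _ _ (by omega) (by omega) (by omega)) _)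
      (fun i hi hib => Nat.sub_le_sub_right (ha _ (by omega) (by omega)) _)
    have h1 := ha 1 le_rfl (by omega)
    have key : ∀ m k, ebn (List.replicate m E ++ N :: u) (k + 1) = m + ebn u k := by
      intro m k
      induction m with
      | zero => simp
      | succ m ihm => rw [List.replicate_succ, List.cons_append, ebn_E_cons, ihm]; omega
    refine ⟨List.replicate (q 1) E ++ N :: u, ?_, fun k hk hkb => ?_⟩
    · simp [IsLatticePath, List.count_replicate, hE, hN]
      omega
    · obtain ⟨k, rfl⟩ : ∃ m, k = m + 1 := ⟨k - 1, by omega⟩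
      rw [key]
      by_cases hk0 : k = 0
      · subst hk0; simp
      · rw [hu k (by omega) (by omega)]
        have := hq 1 (k + 1) le_rfl (by omega) (by omega)
        omega

theorem head?_eq_N_iff {u : List Step} (hu : 1 ≤ u.count N) : u.head? = some N ↔ ebn u 1 = 0 := by
  cases u with
  | nil => simp at hu
  | cons s u => cases s <;> simp

theorem take_two_eq_iff {u : List Step} (hu : 2 ≤ u.count N) :
    u.take 2 = [N, N] ↔ ebn u 2 = 0 := by
  match u with
  | [] => simp at hu
  | [s] => cases s <;> simp at hu
  | s :: t :: u => cases s <;> cases t <;> simp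

end HLZeta

/-! ### Odd functions on letters and their stability -/

namespace HLZeta

/-- The letters `±1, …, ±n`. -/
def IsLetter (n : ℕ) (A : ℤ) : Prop := A ≠ 0 ∧ -(n : ℤ) ≤ A ∧ A ≤ n

theorem IsLetter.neg {n : ℕ} {A : ℤ} (hA : IsLetter n A) : IsLetter n (-A) := by
  obtain ⟨h1, h2, h3⟩ := hA
  exact ⟨by omega, by omega, by omega⟩

/-- `H` describes an alcove of the affine Weyl group of type `Dₙ`, scaled by the Coxeter number. -/
structure IsAdmissible (n : ℕ) (H : ℤ → ℤ) : Prop where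
  odd : ∀ A, H (-A) = -H A
  res : ∀ A B, IsLetter n A → IsLetter n B → A ≠ B → A ≠ -B →
    ¬ (2 * (n : ℤ) - 2 ∣ H A - H B)

/-- The walls of the alcove `H` at which `H` lies on the far side from the origin
are walls of the Shi arrangement. -/
def IsStable (n : ℕ) (H : ℤ → ℤ) : Prop :=
  ∀ A B c, IsLetter n A → IsLetter n B → A ≠ B → A ≠ -B →
    H A - H B = 1 + (2 * (n : ℤ) - 2) * c → c ≤ 1 ∧ (c = 1 → B < A)

/-- The alcoves `H` and `H'` lie in the same region of the Shi arrangement, up to the choice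
of positive roots. -/
structure SameRegion (n : ℕ) (H H' : ℤ → ℤ) : Prop where
  lt_iff : ∀ A B, IsLetter n A → IsLetter n B → A ≠ B → A ≠ -B → (H B < H A ↔ H' B < H' A)
  add_lt_iff : ∀ A B, IsLetter n A → IsLetter n B → A ≠ B → A ≠ -B →
    (H B + (2 * (n : ℤ) - 2) < H A ↔ H' B + (2 * (n : ℤ) - 2) < H' A)

theorem SameRegion.symm {n : ℕ} {H H' : ℤ → ℤ} (h : SameRegion n H H') : SameRegion n H' H :=
  ⟨fun A B hA hB h1 h2 => (h.lt_iff A B hA hB h1 h2).symm,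
    fun A B hA hB h1 h2 => (h.add_lt_iff A B hA hB h1 h2).symm⟩

theorem exists_dist {n : ℕ} (hn : 2 ≤ n) (x : ℤ) : ∃ (q : ℤ) (d : ℕ), d < n ∧
    (x = (2 * (n : ℤ) - 2) * q + d ∨ x = (2 * (n : ℤ) - 2) * q - d) := by
  obtain ⟨h, hh⟩ : ∃ h : ℤ, h = 2 * (n : ℤ) - 2 := ⟨_, rfl⟩
  rw [← hh]
  have h1 := Int.emod_add_mul_ediv x h
  have h2 := Int.emod_nonneg x (show h ≠ 0 by omega)
  have h3 := Int.emod_lt_of_pos x (show 0 < h by omega)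
  by_cases hc : x % h ≤ n - 1
  · exact ⟨x / h, (x % h).toNat, by omega, Or.inl (by rw [Int.toNat_of_nonneg h2]; linarith)⟩
  · refine ⟨x / h + 1, (h - x % h).toNat, by omega, Or.inr ?_⟩
    rw [Int.toNat_of_nonneg (by omega)]
    linarith

namespace IsAdmissible

variable {n : ℕ} {H H' : ℤ → ℤ}

theorem exists_eq_add (ad : IsAdmissible n H) (hn : 2 ≤ n) (d : ℕ) (hd : d < n) :
    ∃ A q, IsLetter n A ∧ H A = (2 * (n : ℤ) - 2) * q + d := by
  choose q e he hx using exists_dist hn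
  have inj : Function.Injective fun a : Fin n => (⟨e (H (a + 1)), he _⟩ : Fin n) := by
    intro a b hab
    have hab : e (H (a + 1)) = e (H (b + 1)) := by simpa using hab
    by_contra hne
    have hne : (a : ℕ) ≠ b := fun h => hne (Fin.ext h)
    have la : IsLetter n ((a : ℤ) + 1) := ⟨by omega, by omega, by omega⟩
    have lb : IsLetter n ((b : ℤ) + 1) := ⟨by omega, by omega, by omega⟩
    have r1 := ad.res _ _ la lb (by omega) (by omega)
    have r2 := ad.res _ _ la lb.neg (by omega) (by omega)
    rw [ad.odd] at r2
    have ha := hx (H (a + 1))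
    have hb := hx (H (b + 1))
    rw [hab] at ha
    rcases ha with ha | ha <;> rcases hb with hb | hb
    · exact r1 ⟨q (H (a + 1)) - q (H (b + 1)), by linarith⟩
    · exact r2 ⟨q (H (a + 1)) + q (H (b + 1)), by linarith⟩
    · exact r2 ⟨q (H (a + 1)) + q (H (b + 1)), by linarith⟩
    · exact r1 ⟨q (H (a + 1)) - q (H (b + 1)), by linarith⟩
  obtain ⟨a, ha⟩ := Finite.injective_iff_surjective.mp inj ⟨d, hd⟩
  have ha : e (H (a + 1)) = d := by simpa using ha
  have la : IsLetter n ((a : ℤ) + 1) := ⟨by omega, by omega, by omega⟩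
  have hxa := hx (H (a + 1))
  rw [ha] at hxa
  rcases hxa with hxa | hxa
  · exact ⟨_, _, la, hxa⟩
  · exact ⟨_, -q (H (a + 1)), la.neg, by rw [ad.odd]; linarith⟩

theorem exists_hit (ad : IsAdmissible n H) (hn : 2 ≤ n) (m : ℤ) :
    ∃ A c, IsLetter n A ∧ m = H A + (2 * (n : ℤ) - 2) * c := by
  obtain ⟨q, d, hd, hm⟩ := exists_dist hn m
  obtain ⟨A, q', hA, hAd⟩ := ad.exists_eq_add hn d hd
  rcases hm with hm | hm
  · exact ⟨A, q - q', hA, by linarith⟩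
  · exact ⟨-A, q + q', hA.neg, by rw [ad.odd]; linarith⟩

theorem ne_of_sub_eq (ad : IsAdmissible n H) {P Q e : ℤ}
    (h : H P - H Q = 1 + (2 * (n : ℤ) - 2) * e) : P ≠ Q ∧ P ≠ -Q := by
  have he : (2 * (n : ℤ) - 2) * e = 2 * ((n - 1) * e) := by ring
  rw [he] at h
  constructor
  · rintro rfl
    omega
  · rintro rfl
    rw [ad.odd] at h
    omega

/-- If `H A - H B` exceeds `h * c` then some wall of the alcove is crossed in between. -/
theorem exists_wall (ad : IsAdmissible n H) (st : IsStable n H) (hn : 2 ≤ n) {A B c : ℤ}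
    (hA : IsLetter n A) (hB : IsLetter n B) (hc : 1 ≤ c)
    (hAB : H B + (2 * (n : ℤ) - 2) * c < H A) :
    ∃ P Q, IsLetter n P ∧ IsLetter n Q ∧ H P = H Q + (2 * (n : ℤ) - 2) + 1 ∧ H B ≤ H Q ∧
      H P + (2 * (n : ℤ) - 2) * (c - 1) ≤ H A ∧ P ≠ Q ∧ P ≠ -Q ∧ Q < P := by
  obtain ⟨h, hh⟩ : ∃ h : ℤ, h = 2 * (n : ℤ) - 2 := ⟨_, rfl⟩
  rw [← hh] at hAB ⊢
  have h0 : 0 < h := by omega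
  have step : ∀ m Q c' P c'', IsLetter n Q → IsLetter n P → c ≤ c' → c'' < c → m = H Q + h * c' →
      m + 1 = H P + h * c'' → H B + h * c ≤ m → m < H A →
      ∃ P Q, IsLetter n P ∧ IsLetter n Q ∧ H P = H Q + h + 1 ∧ H B ≤ H Q ∧
        H P + h * (c - 1) ≤ H A ∧ P ≠ Q ∧ P ≠ -Q ∧ Q < P := by
    intro m Q c' P c'' hQ hP hc' hc'' hm hm' hBm hmA
    have hPQ : H P - H Q = 1 + (2 * (n : ℤ) - 2) * (c' - c'') := by rw [← hh]; linarith
    obtain ⟨n1, n2⟩ := ad.ne_of_sub_eq hPQ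
    obtain ⟨s1, s2⟩ := st P Q _ hP hQ n1 n2 hPQ
    obtain rfl : c' = c := by omega
    obtain rfl : c'' = c' - 1 := by omega
    exact ⟨P, Q, hP, hQ, by linarith, by linarith, by linarith, n1, n2, s2 (by omega)⟩
  by_contra hno
  have all : ∀ m, H B + h * c ≤ m → m < H A → ∃ Q c', IsLetter n Q ∧ c ≤ c' ∧ m = H Q + h * c' := by
    intro m hm
    induction m, hm using Int.leInduction with
    | base => exact fun _ => ⟨B, c, hB, le_rfl, rfl⟩
    | succ m hm ih =>
      intro hmA
      obtain ⟨Q, c', hQ, hc', hmQ⟩ := ih (by omega)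
      obtain ⟨P, c'', hP, hmP⟩ := ad.exists_hit hn (m + 1)
      rw [← hh] at hmP
      by_cases hcc : c ≤ c''
      · exact ⟨P, c'', hP, hcc, hmP⟩
      · exact (hno (step m Q c' P c'' hQ hP hc' (by omega) hmQ hmP hm (by omega))).elim
  obtain ⟨Q, c', hQ, hc', hmQ⟩ := all (H A - 1) (by omega) (by omega)
  exact hno (step (H A - 1) Q c' A 0 hQ hA hc' (by omega) hmQ (by ring) (by omega) (by omega))

theorem lt_of_sameRegion (ad : IsAdmissible n H) (st : IsStable n H) (hn : 2 ≤ n)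
    (sr : SameRegion n H H') {c : ℤ} (hc : 1 ≤ c) :
    ∀ {A B : ℤ}, IsLetter n A → IsLetter n B → H B + (2 * (n : ℤ) - 2) * c < H A →
      H' B + (2 * (n : ℤ) - 2) * c < H' A := by
  obtain ⟨h, hh⟩ : ∃ h : ℤ, h = 2 * (n : ℤ) - 2 := ⟨_, rfl⟩
  have h0 : 0 < h := by omega
  have one : ∀ {A B : ℤ}, IsLetter n A → IsLetter n B → H B + h < H A → H' B + h < H' A := by
    intro A B hA hB hAB
    by_cases h1 : A = B
    · subst h1; omega
    by_cases h2 : A = -B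
    · obtain ⟨P, Q, hP, hQ, hPQ, hBQ, hPA, n1, n2, -⟩ :=
        ad.exists_wall st hn hA hB le_rfl (by rw [← hh]; linarith)
      rw [← hh] at hPQ hPA
      simp only [sub_self, mul_zero, add_zero] at hPA
      have e1 : H' Q + h < H' P := by
        rw [hh]
        exact (sr.add_lt_iff P Q hP hQ n1 n2).mp (by rw [← hh]; omega)
      have e2 : H' B ≤ H' Q := by
        by_cases hQB : Q = B
        · rw [hQB]
        · by_cases hQA : Q = -B
          · rw [← h2] at hQA
            subst hQA
            omega
          · by_contra! hlt
            have := (sr.lt_iff B Q hB hQ (Ne.symm hQB) (by omega)).mpr hlt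
            omega
      have e3 : H' P ≤ H' A := by
        by_cases hPA' : P = A
        · rw [hPA']
        · by_cases hPB : P = B
          · subst hPB; omega
          · by_contra! hlt
            have := (sr.lt_iff P A hP hA hPA' (by omega)).mpr hlt
            omega
      omega
    · rw [hh]
      exact (sr.add_lt_iff A B hA hB h1 h2).mp (by rw [← hh]; exact hAB)
  rw [← hh]
  induction c, hc using Int.leInduction with
  | base => intro A B hA hB; simpa using one hA hB
  | succ c hc ih =>
    intro A B hA hB hAB
    have e0 : h * (c + 1) = h * c + h := by ring
    have hpos : 0 < h * c := by positivity
    suffices ∃ P, IsLetter n P ∧ H B + h < H P ∧ H P + h * c < H A by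
      obtain ⟨P, hP, h1, h2⟩ := this
      have := one hP hB h1
      have := ih hA hP h2
      linarith
    obtain ⟨P, Q, hP, hQ, hPQ, hBQ, hPA, n1, n2, -⟩ :=
      ad.exists_wall st hn hA hB (show 1 ≤ c + 1 by omega) (by rw [← hh]; exact hAB)
    rw [← hh] at hPQ hPA
    rw [show c + 1 - 1 = c by ring] at hPA
    refine ⟨P, hP, by omega, lt_of_le_of_ne hPA fun heq => ?_⟩
    have hAQ : H A - H Q = 1 + (2 * (n : ℤ) - 2) * (c + 1) := by rw [← hh]; linarith
    obtain ⟨m1, m2⟩ := ad.ne_of_sub_eq hAQ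
    have := (st A Q _ hA hQ m1 m2 hAQ).1
    omega

/-- Every region of the Shi arrangement contains at most one stable alcove. -/
theorem eq_of_sameRegion (ad : IsAdmissible n H) (st : IsStable n H) (hn : 2 ≤ n)
    (ad' : IsAdmissible n H') (st' : IsStable n H') (sr : SameRegion n H H') {A : ℤ}
    (hA : IsLetter n A) : H' A = H A := by
  obtain ⟨h, hh⟩ : ∃ h : ℤ, h = 2 * (n : ℤ) - 2 := ⟨_, rfl⟩
  have h0 : 0 < h := by omega
  have succ : ∀ P Q d, IsLetter n P → IsLetter n Q → H P - H Q = 1 + h * d →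
      H' Q + h * d < H' P := by
    intro P Q d hP hQ hPQ
    rw [hh] at hPQ
    obtain ⟨n1, n2⟩ := ad.ne_of_sub_eq hPQ
    rw [← hh] at hPQ
    rcases lt_trichotomy d 0 with hd | rfl | hd
    · by_contra! hle
      have hne : H' P ≠ H' Q + h * d := fun heq =>
        ad'.res P Q hP hQ n1 n2 ⟨d, by rw [← hh]; linarith⟩
      have := ad'.lt_of_sameRegion st' hn sr.symm (show 1 ≤ -d by omega) hQ hP
        (by rw [← hh]; have := lt_of_le_of_ne hle hne; linarith)
      rw [← hh] at this
      linarith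
    · have := (sr.lt_iff P Q hP hQ n1 n2).mp (by simp at hPQ; omega)
      simpa using this
    · have := ad.lt_of_sameRegion st hn sr (show 1 ≤ d by omega) hP hQ
        (by rw [← hh]; linarith)
      rwa [← hh] at this
  have gap : ∀ (k : ℕ) P Q d, IsLetter n P → IsLetter n Q → H P - H Q = (k + 1) + h * d →
      H' Q + h * d + (k + 1) ≤ H' P := by
    intro k
    induction k with
    | zero =>
      intro P Q d hP hQ hPQ
      have := succ P Q d hP hQ (by simpa using hPQ)
      simp; linarith
    | succ k ih =>
      intro P Q d hP hQ hPQ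
      obtain ⟨R, c, hR, hRc⟩ := ad.exists_hit hn (H P - 1)
      rw [← hh] at hRc
      have e1 := succ P R c hP hR (by linarith)
      have e2 := ih R Q (d - c) hR hQ (by push_cast at hPQ ⊢; linarith)
      push_cast
      linarith
  have key : ∀ P Q, IsLetter n P → IsLetter n Q → H' P - H' Q ≥ H P - H Q := by
    intro P Q hP hQ
    obtain ⟨k, d, hkd⟩ : ∃ (k : ℕ) (d : ℤ), H P - H Q = (k + 1) + h * d := by
      have h1 := Int.emod_add_mul_ediv (H P - H Q - 1) h
      have h2 := Int.emod_nonneg (H P - H Q - 1) (show h ≠ 0 by omega)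
      refine ⟨((H P - H Q - 1) % h).toNat, (H P - H Q - 1) / h, ?_⟩
      rw [Int.toNat_of_nonneg h2]
      linarith
    have := gap k P Q d hP hQ hkd
    linarith
  have e1 := key A (-A) hA hA.neg
  have e2 := key (-A) A hA.neg hA
  rw [ad.odd, ad'.odd] at e1 e2
  omega

end IsAdmissible

end HLZeta

/-! ### Alcoves realizing a ballot path together with a sequence of letters -/

open Step

namespace HLZeta

/-- `b 1, …, b (2 * n)` lists all letters and satisfies `b (2 * n + 1 - i) = -b i`. -/
structure IsLetterSeq (n : ℕ) (b : ℕ → ℤ) : Prop where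
  letter : ∀ i, 1 ≤ i → i ≤ 2 * n → IsLetter n (b i)
  mirror : ∀ i, 1 ≤ i → i ≤ 2 * n → b (2 * n + 1 - i) = -b i
  inj : ∀ i j, 1 ≤ i → i ≤ 2 * n → 1 ≤ j → j ≤ 2 * n → b i = b j → i = j

/-- The letter sequence lists the letters in decreasing order of their values under `H`
(up to exchanging the two middle letters), and the path `β` records
which pairs of values differ by more than the Coxeter number. -/
structure Realizes (n : ℕ) (H : ℤ → ℤ) (β : List Step) (b : ℕ → ℤ) : Prop where
  anti : ∀ i j, 1 ≤ i → i < j → j ≤ 2 * n → ¬(i = n ∧ j = n + 1) → H (b j) < H (b i)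
  table : ∀ i j, 1 ≤ i → 1 ≤ j → i + j ≤ 2 * n →
    (i ≤ ebn β j ↔ H (b j) + (2 * (n : ℤ) - 2) < H (b i))

/-- Exchange the two middle letters. -/
def swapMid (n : ℕ) (b : ℕ → ℤ) (i : ℕ) : ℤ := if i = n ∨ i = n + 1 then -b i else b i

namespace IsLetterSeq

variable {n : ℕ} {b : ℕ → ℤ}

theorem surj (hb : IsLetterSeq n b) {A : ℤ} (hA : IsLetter n A) :
    ∃ i, 1 ≤ i ∧ i ≤ 2 * n ∧ b i = A := by
  have hsub : (Finset.Icc 1 (2 * n)).image b ⊆ (Finset.Icc (-(n : ℤ)) n).erase 0 := by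
    intro x hx
    obtain ⟨i, hi, rfl⟩ := Finset.mem_image.mp hx
    rw [Finset.mem_Icc] at hi
    obtain ⟨h1, h2, h3⟩ := hb.letter i hi.1 hi.2
    simp [h1, h2, h3]
  have hcard : ((Finset.Icc 1 (2 * n)).image b).card = 2 * n := by
    rw [Finset.card_image_of_injOn]
    · simp
    · intro i hi j hj hij
      simp only [Finset.coe_Icc, Set.mem_Icc] at hi hj
      exact hb.inj i j hi.1 hi.2 hj.1 hj.2 hij
  have heq := Finset.eq_of_subset_of_card_le hsub (by
    rw [hcard, Finset.card_erase_of_mem (by simp), Int.card_Icc]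
    omega)
  have : A ∈ (Finset.Icc 1 (2 * n)).image b := by
    rw [heq]
    obtain ⟨h1, h2, h3⟩ := hA
    simp [h1, h2, h3]
  obtain ⟨i, hi, hiA⟩ := Finset.mem_image.mp this
  rw [Finset.mem_Icc] at hi
  exact ⟨i, hi.1, hi.2, hiA⟩

theorem mirror_of_add_eq (hb : IsLetterSeq n b) {i j : ℕ} (hi : 1 ≤ i) (hj : 1 ≤ j)
    (hij : i + j = 2 * n + 1) : b j = -b i := by
  have := hb.mirror i hi (by omega)
  rwa [show 2 * n + 1 - i = j by omega] at this

theorem add_eq_of_eq_neg (hb : IsLetterSeq n b) {i j : ℕ} (hi : 1 ≤ i) (hi' : i ≤ 2 * n)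
    (hj : 1 ≤ j) (hj' : j ≤ 2 * n) (hij : b i = -b j) : i + j = 2 * n + 1 := by
  rw [← hb.mirror j hj hj'] at hij
  have := hb.inj i (2 * n + 1 - j) hi hi' (by omega) (by omega) hij
  omega

theorem swapMid_mirror (hb : IsLetterSeq n b) (i : ℕ) (hi : 1 ≤ i) (hi' : i ≤ 2 * n) :
    swapMid n b i = b (if i = n then n + 1 else if i = n + 1 then n else i) := by
  unfold swapMid
  by_cases h1 : i = n
  · subst h1
    rw [if_pos (Or.inl rfl), if_pos rfl]
    exact (hb.mirror_of_add_eq hi (by omega) (by omega)).symm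
  · by_cases h2 : i = n + 1
    · subst h2
      rw [if_pos (Or.inr rfl), if_neg h1, if_pos rfl]
      exact (hb.mirror_of_add_eq hi (by omega) (by omega)).symm
    · rw [if_neg (by tauto), if_neg h1, if_neg h2]

theorem swapMid (hb : IsLetterSeq n b) : IsLetterSeq n (swapMid n b) where
  letter i hi hi' := by
    unfold HLZeta.swapMid
    split_ifs
    · exact (hb.letter i hi hi').neg
    · exact hb.letter i hi hi'
  mirror i hi hi' := by
    unfold HLZeta.swapMid
    have := hb.mirror i hi hi'
    split_ifs <;> omega
  inj i j hi hi' hj hj' hij := by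
    rw [hb.swapMid_mirror i hi hi', hb.swapMid_mirror j hj hj'] at hij
    have := hb.inj _ _ (by split_ifs <;> omega) (by split_ifs <;> omega)
      (by split_ifs <;> omega) (by split_ifs <;> omega) hij
    split_ifs at this <;> omega

end IsLetterSeq

namespace Realizes

variable {n : ℕ} {H H' : ℤ → ℤ} {β : List Step} {b : ℕ → ℤ}

theorem le_iff_mirror (hR : Realizes n H β b) (hb : IsLetterSeq n b)
    (odd : ∀ A, H (-A) = -H A) {i j : ℕ} (hi : i ≤ 2 * n) (hj : j ≤ 2 * n)
    (hij : 2 * n + 2 ≤ i + j) :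
    2 * n + 1 - j ≤ ebn β (2 * n + 1 - i) ↔ H (b j) + (2 * (n : ℤ) - 2) < H (b i) := by
  rw [hR.table _ _ (by omega) (by omega) (by omega), hb.mirror i (by omega) hi,
    hb.mirror j (by omega) hj, odd, odd]
  constructor <;> intro <;> linarith

theorem sameRegion (hR : Realizes n H β b) (hR' : Realizes n H' β b) (hb : IsLetterSeq n b)
    (odd : ∀ A, H (-A) = -H A) (odd' : ∀ A, H' (-A) = -H' A) : SameRegion n H H' := by
  constructor
  · intro A B hA hB h1 h2
    obtain ⟨i, hi, hi', rfl⟩ := hb.surj hA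
    obtain ⟨j, hj, hj', rfl⟩ := hb.surj hB
    have hne : i ≠ j := fun h => h1 (by rw [h])
    have hne' : i + j ≠ 2 * n + 1 := fun h => h2 (hb.mirror_of_add_eq hj hi (by omega))
    rcases lt_or_gt_of_ne hne with h | h
    · have e1 := hR.anti i j hi h hj' (by omega)
      have e2 := hR'.anti i j hi h hj' (by omega)
      exact iff_of_true e1 e2
    · have e1 := hR.anti j i hj h hi' (by omega)
      have e2 := hR'.anti j i hj h hi' (by omega)
      exact iff_of_false (by omega) (by omega)
  · intro A B hA hB h1 h2
    obtain ⟨i, hi, hi', rfl⟩ := hb.surj hA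
    obtain ⟨j, hj, hj', rfl⟩ := hb.surj hB
    have hne' : i + j ≠ 2 * n + 1 := fun h => h2 (hb.mirror_of_add_eq hj hi (by omega))
    by_cases h : i + j ≤ 2 * n
    · rw [← hR.table i j hi hj h, ← hR'.table i j hi hj h]
    · rw [← hR.le_iff_mirror hb odd hi' hj' (by omega),
        ← hR'.le_iff_mirror hb odd' hi' hj' (by omega)]

theorem of_sameRegion (hR : Realizes n H β b) (hb : IsLetterSeq n b)
    (odd' : ∀ A, H' (-A) = -H' A) (sr : SameRegion n H H') (hn : 2 ≤ n) :
    Realizes n H' β b := by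
  have anti : ∀ i j, 1 ≤ i → i < j → j ≤ 2 * n → i + j ≠ 2 * n + 1 → H' (b j) < H' (b i) := by
    intro i j hi hij hj hne
    refine (sr.lt_iff _ _ (hb.letter i hi (by omega)) (hb.letter j (by omega) hj) ?_ ?_).mp
      (hR.anti i j hi hij hj (by omega))
    · intro h
      have := hb.inj i j hi (by omega) (by omega) hj h
      omega
    · intro h
      exact hne (hb.add_eq_of_eq_neg hi (by omega) (by omega) hj h)
  constructor
  · intro i j hi hij hj hne
    by_cases h : i + j = 2 * n + 1
    · have e1 := anti i n hi (by omega) (by omega) (by omega)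
      have e2 := anti i (n + 1) hi (by omega) (by omega) (by omega)
      rw [hb.mirror_of_add_eq (i := n) (by omega) (by omega) (by omega), odd'] at e2
      rw [hb.mirror_of_add_eq hi (by omega) h, odd']
      omega
    · exact anti i j hi hij hj h
  · intro i j hi hj hij
    rw [hR.table i j hi hj hij]
    by_cases h : i = j
    · subst h
      constructor <;> intro <;> omega
    · refine sr.add_lt_iff _ _ (hb.letter i hi (by omega)) (hb.letter j (by omega) (by omega))
        ?_ ?_
      · intro h'
        exact h (hb.inj i j hi (by omega) (by omega) (by omega) h')
      · intro h'
        have := hb.add_eq_of_eq_neg hi (by omega) hj (by omega) h'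
        omega

/-- The two middle letters can be exchanged if the `n`-th North step is not followed by an
East step. -/
theorem swapMid (hR : Realizes n H β b) (hb : IsLetterSeq n b) (hn : 2 ≤ n)
    (hβ : IsBallotPath (2 * n - 1) β) (hmid : ebn β n = ebn β (n + 1)) :
    Realizes n H β (swapMid n b) := by
  have hs := hb.swapMid_mirror
  constructor
  · intro i j hi hij hj hne
    rw [hs i hi (by omega), hs j (by omega) hj]
    apply hR.anti <;> split_ifs <;> omega
  · intro i j hi hj hij
    rw [hs i hi (by omega), hs j (by omega) (by omega)]
    by_cases hin : i = n ∨ i = n + 1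
    · have e1 := ebn_lt_of_isBallotPath hβ hj
      refine iff_of_false (by omega) (not_lt.mpr ?_)
      by_cases hjn : j = n
      · have : i = n := by omega
        subst this
        simp only [hjn, if_true]
        omega
      · have e2 := hR.anti j (if i = n then n + 1 else if i = n + 1 then n else i) hj
          (by split_ifs <;> omega) (by split_ifs <;> omega) (by split_ifs <;> omega)
        rw [if_neg hjn, if_neg (show j ≠ n + 1 by omega)]
        omega
    · rw [if_neg (show i ≠ n by omega), if_neg (show i ≠ n + 1 by omega),
        ← hR.table _ _ hi (by split_ifs <;> omega) (by split_ifs <;> omega)]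
      split_ifs with h1 h2
      · subst h1
        rw [hmid]
      · subst h2
        rw [hmid]
      · rfl

theorem mid_lt (hR : Realizes n H β b) (hβ : IsBallotPath (2 * n - 1) β) (hn : 2 ≤ n)
    (hmid : ebn β n < ebn β (n + 1)) : H (b (n + 1)) < H (b n) := by
  have e1 := ebn_lt_of_isBallotPath hβ (show 1 ≤ n + 1 by omega)
  have e2 := ebn_lt_of_isBallotPath hβ (show 1 ≤ n by omega)
  have e0 := ebn_le_count β (n + 1)
  have e7 := le_count_of_isBallotPath hβ
  have e8 := count_add_count β
  rw [hβ.1] at e8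
  have e3 := hR.table (ebn β n + 1) (n + 1) (by omega) (by omega) (by omega)
  have e4 := hR.table (ebn β n + 1) n (by omega) (by omega) (by omega)
  have e5 := e3.mp (by omega)
  have e6 := mt e4.mpr (by omega)
  omega

theorem abs_mid_lt (hR : Realizes n H β b) (hb : IsLetterSeq n b) (hn : 2 ≤ n)
    (odd : ∀ A, H (-A) = -H A) {i : ℕ} (hi : 1 ≤ i) (hi' : i < n) :
    |H (b n)| < H (b i) := by
  have e1 := hR.anti i n hi (by omega) (by omega) (by omega)
  have e2 := hR.anti i (n + 1) hi (by omega) (by omega) (by omega)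
  rw [hb.mirror_of_add_eq (i := n) (by omega) (by omega) (by omega), odd] at e2
  rw [abs_lt]
  omega

theorem mid_eq_zero (hR : Realizes n H β b) (hb : IsLetterSeq n b) (hn : 2 ≤ n)
    (ad : IsAdmissible n H) (st : IsStable n H) (hβ : IsBallotPath (2 * n - 1) β)
    (hmid : ebn β n = ebn β (n + 1)) : H (b n) = 0 := by
  obtain ⟨h, hh⟩ : ∃ h : ℤ, h = 2 * (n : ℤ) - 2 := ⟨_, rfl⟩
  have h0 : 0 < h := by omega
  obtain ⟨r, hr⟩ : ∃ r, r = |H (b n)| := ⟨_, rfl⟩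
  by_contra hne
  have hr0 : 0 < r := by rw [hr]; exact abs_pos.mpr hne
  have far : ∀ k, 1 ≤ k → k ≤ 2 * n → k = n ∨ k = n + 1 ∨ (k < n ∧ r < H (b k)) ∨
      H (b k) < -r := by
    intro k hk hk'
    by_cases h1 : k < n
    · exact Or.inr (Or.inr (Or.inl ⟨h1, by rw [hr]; exact hR.abs_mid_lt hb hn ad.odd hk h1⟩))
    · by_cases h2 : k = n ∨ k = n + 1
      · tauto
      · right; right; right
        have := hR.abs_mid_lt hb hn ad.odd (i := 2 * n + 1 - k) (by omega) (by omega)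
        rw [hb.mirror k hk hk', ad.odd] at this
        omega
  have midn : ∀ k, k = n ∨ k = n + 1 → H (b k) = r ∨ H (b k) = -r := by
    have e := hb.mirror_of_add_eq (i := n) (j := n + 1) (by omega) (by omega) (by omega)
    rintro k (rfl | rfl)
    · rw [hr]
      rcases abs_cases (H (b k)) with h | h <;> omega
    · rw [hr, e, ad.odd]
      rcases abs_cases (H (b n)) with h | h <;> omega
  obtain ⟨A, q, hA, hAq, hq⟩ : ∃ A q, IsLetter n A ∧ H A = h * q ∧ 0 ≤ q := by
    obtain ⟨A, q, hA, hAq⟩ := ad.exists_eq_add hn 0 (by omega)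
    rw [← hh] at hAq
    rcases le_total 0 q with hq | hq
    · exact ⟨A, q, hA, by simpa using hAq, hq⟩
    · exact ⟨-A, -q, hA.neg, by rw [ad.odd, hAq]; simp, by omega⟩
  have hq1 : 1 ≤ q := by
    by_contra hlt
    obtain rfl : q = 0 := by omega
    obtain ⟨k, hk, hk', rfl⟩ := hb.surj hA
    rw [mul_zero] at hAq
    have := far k hk hk'
    have := midn k
    omega
  obtain ⟨X, hX, hXr⟩ : ∃ X, IsLetter n X ∧ H X = -r := by
    have e := hb.mirror_of_add_eq (i := n) (j := n + 1) (by omega) (by omega) (by omega)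
    rcases midn n (Or.inl rfl) with h1 | h1
    · exact ⟨b (n + 1), hb.letter _ (by omega) (by omega), by rw [e, ad.odd, h1]⟩
    · exact ⟨b n, hb.letter _ (by omega) (by omega), h1⟩
  obtain ⟨P, Q, hP, hQ, hPQ, hBQ, hPA, n1, n2, -⟩ := ad.exists_wall st hn hA hX hq1
    (by rw [← hh]; linarith)
  rw [← hh] at hPQ hPA
  have hPh : H P ≤ h := by linarith
  obtain ⟨k, hk, hk', rfl⟩ := hb.surj hP
  obtain ⟨l, hl, hl', rfl⟩ := hb.surj hQ
  have hkl : k ≠ l := fun h => n1 (by rw [h])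
  have hkl' : k + l ≠ 2 * n + 1 := fun h => n2 (hb.mirror_of_add_eq hl hk (by omega))
  have fk := far k hk hk'
  have fl := far l hl hl'
  have mk := midn k
  have ml := midn l
  have hkn : k < n := by omega
  have t1 := hR.table k n hk (by omega) (by omega)
  have t2 := hR.table k (n + 1) hk (by omega) (by omega)
  rw [← hmid, t1, ← hh, hb.mirror_of_add_eq (i := n) (j := n + 1) (by omega) (by omega) (by omega),
    ad.odd] at t2
  have mn := midn n (Or.inl rfl)
  omega

end Realizes

end HLZeta

/-! ### Valleys and walls -/

open Step

namespace HLZeta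

theorem isValley_bounds {n i j : ℕ} {β : List Step} (hn : 2 ≤ n)
    (hβ : IsBallotPath (2 * n - 1) β) (hv : IsValley β i j) :
    1 ≤ i ∧ i < j ∧ i + j ≤ 2 * n := by
  rw [isValley_iff] at hv
  obtain ⟨hj, hi, hlt⟩ := hv
  have h1 := ebn_lt_of_isBallotPath hβ hj
  have h2 := ebn_le_count β j
  have h3 := count_add_count β
  rw [hβ.1] at h3
  have h4 : j - 1 ≤ β.count N := by
    by_contra hc
    have e1 := ebn_eq_count β (k := j - 1) (by omega)
    have e2 := ebn_eq_count β (k := j) (by omega)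
    omega
  omega

namespace Realizes

variable {n : ℕ} {H : ℤ → ℤ} {β : List Step} {b : ℕ → ℤ}

theorem isValley_sub_eq (hR : Realizes n H β b) (hb : IsLetterSeq n b) (hn : 2 ≤ n)
    (ad : IsAdmissible n H) (st : IsStable n H) (hβ : IsBallotPath (2 * n - 1) β)
    {i j : ℕ} (hv : IsValley β i j) : H (b i) - H (b j) = 1 + (2 * (n : ℤ) - 2) * 1 := by
  obtain ⟨hi, hij, hs⟩ := isValley_bounds hn hβ hv
  rw [isValley_iff] at hv
  obtain ⟨hj, hvi, hvj⟩ := hv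
  have hT := (hR.table i j hi hj hs).mp hvi.ge
  obtain ⟨P, Q, hP, hQ, hPQ, hBQ, hPA, n1, n2, -⟩ :=
    ad.exists_wall st hn (hb.letter i hi (by omega)) (hb.letter j hj (by omega)) le_rfl
      (by linarith)
  rw [sub_self, mul_zero, add_zero] at hPA
  obtain ⟨i', hi1, hi2, rfl⟩ := hb.surj hP
  obtain ⟨j', hj1, hj2, rfl⟩ := hb.surj hQ
  have hadd : i' + j' ≠ 2 * n + 1 := fun h => n2 (hb.mirror_of_add_eq hj1 hi1 (by omega))
  have hne : i' ≠ j' := fun h => n1 (by rw [h])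
  have hii : i ≤ i' := by
    by_contra hlt
    have := hR.anti i' i hi1 (by omega) (by omega) (by omega)
    omega
  have hjj : j ≤ j' := by
    by_contra hlt
    have := (hR.table i j' hi hj1 (by omega)).mpr (by omega)
    have := ebn_mono β (show j' ≤ j - 1 by omega)
    omega
  have hjj' : j' = j ∨ j = n ∧ j' = n + 1 := by
    by_contra hc
    have := hR.anti j j' hj (by omega) hj2 (by omega)
    omega
  have hii' : i' = i := by
    by_contra hc
    by_cases h1 : i + 1 + j ≤ 2 * n
    · have h2 := hR.table (i + 1) j (by omega) hj h1
      by_cases h3 : i' = i + 1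
      · subst h3
        omega
      · have := hR.anti (i + 1) i' (by omega) (by omega) hi2 (by omega)
        omega
    · have h3 := hR.le_iff_mirror hb ad.odd hi2 hj2 (by omega)
      have h4 := h3.mpr (by omega)
      have := ebn_mono β (show 2 * n + 1 - i' ≤ j - 1 by omega)
      omega
  subst hii'
  rcases hjj' with rfl | ⟨rfl, rfl⟩
  · linarith
  · rcases lt_or_eq_of_le (ebn_mono β (show j ≤ j + 1 by omega)) with hm | hm
    · have := hR.mid_lt hβ hn hm
      omega
    · have e1 := hR.mid_eq_zero hb hn ad st hβ hm
      have e2 := hb.mirror_of_add_eq (i := j) (j := j + 1) (by omega) (by omega) (by omega)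
      rw [e2, ad.odd, e1] at hPQ
      rw [e1]
      linarith

theorem lt_of_isValley (hR : Realizes n H β b) (hb : IsLetterSeq n b) (hn : 2 ≤ n)
    (ad : IsAdmissible n H) (st : IsStable n H) (hβ : IsBallotPath (2 * n - 1) β)
    {i j : ℕ} (hv : IsValley β i j) : b j < b i := by
  have h := hR.isValley_sub_eq hb hn ad st hβ hv
  obtain ⟨hi, hij, hs⟩ := isValley_bounds hn hβ hv
  obtain ⟨n1, n2⟩ := ad.ne_of_sub_eq h
  exact (st _ _ _ (hb.letter i hi (by omega)) (hb.letter j (by omega) (by omega)) n1 n2 h).2 rfl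

theorem abs_lt_of_isValley (hR : Realizes n H β b) (hb : IsLetterSeq n b) (hn : 2 ≤ n)
    (ad : IsAdmissible n H) (st : IsStable n H) (hβ : IsBallotPath (2 * n - 1) β)
    {i : ℕ} (hv : IsValley β i n) (hm : ebn β n = ebn β (n + 1)) : |b n| < b i := by
  have h1 := hR.lt_of_isValley hb hn ad st hβ hv
  have h2 := (hR.swapMid hb hn hβ hm).lt_of_isValley hb.swapMid hn ad st hβ hv
  obtain ⟨hi, hij, hs⟩ := isValley_bounds hn hβ hv
  have e1 : HLZeta.swapMid n b n = -b n := by simp [HLZeta.swapMid]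
  have e2 : HLZeta.swapMid n b i = b i := by
    rw [HLZeta.swapMid, if_neg (by omega)]
  rw [e1, e2] at h2
  exact abs_lt.mpr ⟨by omega, h1⟩

theorem isValley_of_sub_eq (hR : Realizes n H β b) (hβ : IsBallotPath (2 * n - 1) β)
    (hn : 2 ≤ n) {i j : ℕ} (hi : 1 ≤ i) (hj : 1 ≤ j) (hij : i + j ≤ 2 * n)
    (h : H (b i) = H (b j) + (2 * (n : ℤ) - 2) + 1)
    (hjn : j = n + 1 → ebn β n < ebn β (n + 1)) : IsValley β i j := by
  have hT := (hR.table i j hi hj hij).mpr (by omega)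
  have hlt := ebn_lt_of_isBallotPath hβ hj
  have hprev : ebn β (j - 1) < i := by
    by_contra! hle
    have hj1 : 1 ≤ j - 1 := by
      by_contra hc
      rw [show j - 1 = 0 by omega, ebn_zero] at hle
      omega
    have e1 := (hR.table i (j - 1) hi hj1 (by omega)).mp hle
    by_cases hc : j = n + 1
    · have := hR.mid_lt hβ hn (hjn hc)
      subst hc
      rw [Nat.add_sub_cancel] at e1
      omega
    · have := hR.anti (j - 1) j hj1 (by omega) (by omega) (by omega)
      omega
  rw [isValley_iff]
  refine ⟨hj, ?_, hprev⟩
  by_contra hne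
  by_cases hs : i + 1 + j ≤ 2 * n
  · have e1 := (hR.table (i + 1) j (by omega) hj hs).mp (by omega)
    have := hR.anti i (i + 1) hi (by omega) (by omega) (by omega)
    omega
  · have h2 := ebn_le_count β j
    have h3 := count_add_count β
    rw [hβ.1] at h3
    have h4 : j - 1 ≤ β.count N := by
      by_contra hc
      have e1 := ebn_eq_count β (k := j - 1) (by omega)
      have e2 := ebn_eq_count β (k := j) (by omega)
      omega
    omega

theorem lt_of_sub_eq (hR : Realizes n H β b) (hb : IsLetterSeq n b)
    (hβ : IsBallotPath (2 * n - 1) β) (hn : 2 ≤ n) (odd : ∀ A, H (-A) = -H A)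
    (hv : ∀ i j, IsValley β i j → b j < b i)
    (hv' : ∀ i, IsValley β i n → ebn β n = ebn β (n + 1) → |b n| < b i)
    {A B : ℤ} (hA : IsLetter n A) (hB : IsLetter n B) (hAB : A ≠ -B)
    (h : H A = H B + (2 * (n : ℤ) - 2) + 1) : B < A := by
  have key : ∀ i j, 1 ≤ i → 1 ≤ j → i + j ≤ 2 * n →
      H (b i) = H (b j) + (2 * (n : ℤ) - 2) + 1 → b j < b i := by
    intro i j hi hj hij h
    by_cases hc : j = n + 1 → ebn β n < ebn β (n + 1)
    · exact hv i j (hR.isValley_of_sub_eq hβ hn hi hj hij h hc)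
    · rw [Classical.not_imp] at hc
      obtain ⟨rfl, hc⟩ := hc
      have hm := le_antisymm (ebn_mono β (show n ≤ n + 1 by omega)) (not_lt.mp hc)
      have e1 : HLZeta.swapMid n b n = -b n := by simp [HLZeta.swapMid]
      have e2 : HLZeta.swapMid n b i = b i := by
        rw [HLZeta.swapMid, if_neg (by omega)]
      have e3 := hb.mirror_of_add_eq (i := n) (j := n + 1) (by omega) (by omega) (by omega)
      have hval := (hR.swapMid hb hn hβ hm).isValley_of_sub_eq hβ hn (i := i) (j := n) hi
        (by omega) (by omega) (by rw [e1, e2, ← e3]; exact h) (by omega)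
      have := hv' i hval hm
      rw [abs_lt] at this
      rw [e3]
      omega
  obtain ⟨i, hi, hi', rfl⟩ := hb.surj hA
  obtain ⟨j, hj, hj', rfl⟩ := hb.surj hB
  have hadd : i + j ≠ 2 * n + 1 := fun h => hAB (hb.mirror_of_add_eq hj hi (by omega))
  by_cases hij : i + j ≤ 2 * n
  · exact key i j hi hj hij h
  · have := key (2 * n + 1 - j) (2 * n + 1 - i) (by omega) (by omega) (by omega)
      (by rw [hb.mirror i hi hi', hb.mirror j hj hj', odd, odd]; linarith)
    rw [hb.mirror i hi hi', hb.mirror j hj hj'] at this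
    omega

end Realizes

/-- Move the alcove `H` across the wall belonging to the letters `A` and `B`. -/
def crossWall (H : ℤ → ℤ) (A B X : ℤ) : ℤ :=
  if X = A ∨ X = -B then H X - 1 else if X = B ∨ X = -A then H X + 1 else H X

/-- The signed transposition of the letters `A` and `B`. -/
def swapLetters (A B X : ℤ) : ℤ :=
  if X = A then B else if X = B then A else if X = -A then -B else if X = -B then -A else X

section crossWall

variable {n : ℕ} {H : ℤ → ℤ} {A B c : ℤ}

theorem crossWall_odd (odd : ∀ A, H (-A) = -H A) (hA : A ≠ 0) (hB : B ≠ 0) (h1 : A ≠ B)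
    (X : ℤ) : crossWall H A B (-X) = -crossWall H A B X := by
  unfold crossWall
  rw [odd]
  split_ifs <;> omega

theorem crossWall_eq (odd : ∀ A, H (-A) = -H A) (h1 : A ≠ B) (h2 : A ≠ -B)
    (hAB : H A - H B = 1 + (2 * (n : ℤ) - 2) * c) (hA : A ≠ 0) (hB : B ≠ 0) (X : ℤ) :
    ∃ e, crossWall H A B X = H (swapLetters A B X) + (2 * (n : ℤ) - 2) * e := by
  unfold swapLetters
  unfold crossWall
  by_cases e1 : X = A
  · subst e1
    exact ⟨c, by simp; linarith⟩
  by_cases e2 : X = B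
  · subst e2
    refine ⟨-c, ?_⟩
    rw [if_neg (by omega), if_pos (by tauto), if_neg e1, if_pos rfl]
    linarith
  by_cases e3 : X = -A
  · subst e3
    refine ⟨-c, ?_⟩
    rw [if_neg (by omega), if_pos (by tauto), if_neg e1, if_neg e2, if_pos rfl, odd, odd]
    linarith
  by_cases e4 : X = -B
  · subst e4
    refine ⟨c, ?_⟩
    rw [if_pos (by tauto), if_neg e1, if_neg e2, if_neg e3, if_pos rfl, odd, odd]
    linarith
  · refine ⟨0, ?_⟩
    rw [if_neg (by omega), if_neg (by omega), if_neg e1, if_neg e2, if_neg e3, if_neg e4]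
    simp

theorem IsAdmissible.crossWall (ad : IsAdmissible n H) (hA : IsLetter n A) (hB : IsLetter n B)
    (hAB : H A - H B = 1 + (2 * (n : ℤ) - 2) * c) : IsAdmissible n (crossWall H A B) := by
  obtain ⟨h1, h2⟩ := ad.ne_of_sub_eq hAB
  refine ⟨crossWall_odd ad.odd hA.1 hB.1 h1, fun X Y hX hY n1 n2 hdvd => ?_⟩
  obtain ⟨e, he⟩ := crossWall_eq ad.odd h1 h2 hAB hA.1 hB.1 X
  obtain ⟨f, hf⟩ := crossWall_eq ad.odd h1 h2 hAB hA.1 hB.1 Y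
  obtain ⟨g, hg⟩ := hdvd
  have a0 := hA.1
  have b0 := hB.1
  rw [he, hf] at hg
  have hs : ∀ Z, IsLetter n Z → IsLetter n (swapLetters A B Z) := by
    intro Z hZ
    unfold swapLetters
    split_ifs <;> first | assumption | exact IsLetter.neg ‹_›
  refine ad.res (swapLetters A B X) (swapLetters A B Y) (hs X hX) (hs Y hY) ?_ ?_
    ⟨g - e + f, by linarith⟩
  · unfold swapLetters
    split_ifs <;> omega
  · unfold swapLetters
    split_ifs <;> omega

theorem IsAdmissible.sameRegion_crossWall (ad : IsAdmissible n H) (hn : 2 ≤ n)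
    (hA : IsLetter n A) (hB : IsLetter n B)
    (hAB : H A - H B = 1 + (2 * (n : ℤ) - 2) * c) (hc : 2 ≤ c) :
    SameRegion n H (HLZeta.crossWall H A B) := by
  have ad' := ad.crossWall hA hB hAB
  obtain ⟨h1, h2⟩ := ad.ne_of_sub_eq hAB
  obtain ⟨h, hh⟩ : ∃ h : ℤ, h = 2 * (n : ℤ) - 2 := ⟨_, rfl⟩
  rw [← hh] at hAB
  have hbig : 2 * h ≤ h * c := by nlinarith
  obtain ⟨m, hm⟩ : ∃ m, m = h * c := ⟨_, rfl⟩
  rw [← hm] at hAB hbig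
  have a0 := hA.1
  have b0 := hB.1
  have oA := ad.odd A
  have oB := ad.odd B
  have key : ∀ X Y, IsLetter n X → IsLetter n Y → X ≠ Y → X ≠ -Y →
      (H Y < H X ↔ HLZeta.crossWall H A B Y < HLZeta.crossWall H A B X) ∧
      (H Y + h < H X ↔ HLZeta.crossWall H A B Y + h < HLZeta.crossWall H A B X) := by
    intro X Y hX hY n1 n2
    have r1 := ad.res X Y hX hY n1 n2
    have r2 := ad'.res X Y hX hY n1 n2
    rw [← hh] at r1 r2
    have r3 : H X - H Y ≠ 0 := fun h0 => r1 (by rw [h0]; exact dvd_zero h)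
    have r4 : H X - H Y ≠ h := fun h0 => r1 (by rw [h0])
    have r5 : HLZeta.crossWall H A B X - HLZeta.crossWall H A B Y ≠ 0 :=
      fun h0 => r2 (by rw [h0]; exact dvd_zero h)
    have r6 : HLZeta.crossWall H A B X - HLZeta.crossWall H A B Y ≠ h :=
      fun h0 => r2 (by rw [h0])
    have near : ∀ Z, HLZeta.crossWall H A B Z = H Z ∨
        HLZeta.crossWall H A B Z = H Z - 1 ∧ (Z = A ∨ Z = -B) ∨
        HLZeta.crossWall H A B Z = H Z + 1 ∧ (Z = B ∨ Z = -A) := by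
      intro Z
      unfold HLZeta.crossWall
      split_ifs <;> tauto
    rcases near X with eX | ⟨eX, hX'⟩ | ⟨eX, hX'⟩ <;>
      rcases near Y with eY | ⟨eY, hY'⟩ | ⟨eY, hY'⟩ <;> rw [eX, eY] at r5 r6 ⊢
    · omega
    · omega
    · omega
    · omega
    · omega
    · rcases hX' with rfl | rfl <;> rcases hY' with rfl | rfl <;> omega
    · omega
    · rcases hX' with rfl | rfl <;> rcases hY' with rfl | rfl <;> omega
    · omega
  exact ⟨fun X Y hX hY n1 n2 => (key X Y hX hY n1 n2).1,
    fun X Y hX hY n1 n2 => by rw [← hh]; exact (key X Y hX hY n1 n2).2⟩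

theorem IsAdmissible.sum_sq_crossWall_lt (ad : IsAdmissible n H) (hA : IsLetter n A)
    (hB : IsLetter n B) (h1 : A ≠ B) (h2 : A ≠ -B) (hAB : 1 < H A - H B) :
    ∑ X ∈ Finset.Icc (-(n : ℤ)) n, HLZeta.crossWall H A B X ^ 2 <
      ∑ X ∈ Finset.Icc (-(n : ℤ)) n, H X ^ 2 := by
  have hpt : ∀ X, HLZeta.crossWall H A B X ^ 2 = H X ^ 2 + ((if X = A then 1 - 2 * H A else 0) +
      (if X = -A then 1 - 2 * H A else 0) + (if X = B then 1 + 2 * H B else 0) +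
      (if X = -B then 1 + 2 * H B else 0)) := by
    intro X
    have a0 := hA.1
    have b0 := hB.1
    unfold HLZeta.crossWall
    by_cases e1 : X = A
    · subst e1
      rw [if_pos (by tauto), if_pos rfl, if_neg (by omega), if_neg h1, if_neg h2]
      ring
    by_cases e2 : X = B
    · subst e2
      rw [if_neg (by omega), if_pos (by tauto), if_neg e1, if_neg (by omega), if_pos rfl,
        if_neg (by omega)]
      ring
    by_cases e3 : X = -A
    · subst e3
      rw [if_neg (by omega), if_pos (by tauto), if_neg e1, if_pos rfl, if_neg e2,
        if_neg (by omega), ad.odd]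
      ring
    by_cases e4 : X = -B
    · subst e4
      rw [if_pos (by tauto), if_neg e1, if_neg e3, if_neg e2, if_pos rfl, ad.odd]
      ring
    · rw [if_neg (by omega), if_neg (by omega), if_neg e1, if_neg e3, if_neg e2, if_neg e4]
      ring
  obtain ⟨-, ha, ha'⟩ := hA
  obtain ⟨-, hb, hb'⟩ := hB
  rw [Finset.sum_congr rfl fun X _ => hpt X, Finset.sum_add_distrib, Finset.sum_add_distrib,
    Finset.sum_add_distrib, Finset.sum_add_distrib]
  simp only [Finset.sum_ite_eq', Finset.mem_Icc]
  rw [if_pos (by omega), if_pos (by omega), if_pos (by omega), if_pos (by omega)]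
  linarith

end crossWall

theorem Realizes.exists_stable {n : ℕ} {H : ℤ → ℤ} {β : List Step} {b : ℕ → ℤ}
    (hR : Realizes n H β b) (ad : IsAdmissible n H) (hb : IsLetterSeq n b)
    (hβ : IsBallotPath (2 * n - 1) β) (hn : 2 ≤ n)
    (hv : ∀ i j, IsValley β i j → b j < b i)
    (hv' : ∀ i, IsValley β i n → ebn β n = ebn β (n + 1) → |b n| < b i) :
    ∃ H', IsAdmissible n H' ∧ IsStable n H' ∧ Realizes n H' β b := by
  obtain ⟨k, hk⟩ : ∃ k : ℕ, ∑ X ∈ Finset.Icc (-(n : ℤ)) n, H X ^ 2 = k :=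
    Int.eq_ofNat_of_zero_le (Finset.sum_nonneg fun X _ => sq_nonneg (H X))
  induction k using Nat.strong_induction_on generalizing H with
  | _ k ih =>
    by_cases st : IsStable n H
    · exact ⟨H, ad, st, hR⟩
    · unfold IsStable at st
      push Not at st
      obtain ⟨A, B, c, hA, hB, h1, h2, hAB, hc⟩ := st
      by_cases hc1 : c ≤ 1
      · obtain ⟨rfl, hlt⟩ := hc hc1
        have := hR.lt_of_sub_eq hb hβ hn ad.odd hv hv' hA hB h2 (by linarith)
        omega
      · have hbig : 1 < H A - H B := by
          rw [hAB]
          have : 0 < (2 * (n : ℤ) - 2) * c := mul_pos (by omega) (by omega)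
          omega
        have hlt := ad.sum_sq_crossWall_lt hA hB h1 h2 hbig
        have ad' := ad.crossWall hA hB hAB
        obtain ⟨k', hk'⟩ : ∃ k' : ℕ, ∑ X ∈ Finset.Icc (-(n : ℤ)) n, crossWall H A B X ^ 2 = k' :=
          Int.eq_ofNat_of_zero_le (Finset.sum_nonneg fun X _ => sq_nonneg _)
        exact ih k' (by omega) (hR.of_sameRegion hb ad'.odd
          (ad.sameRegion_crossWall hn hA hB hAB (by omega)) hn) ad' hk'

end HLZeta

/-! ### Existence of realizing alcoves -/

open Step

namespace HLZeta

theorem pos_iff_of_sign_iff {M h d σ τ : ℤ} (hσ : |σ| < M) (hτ : |τ| < h)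
    (hs : 0 < σ ↔ 0 < τ) : 0 < M * d + σ ↔ 0 < h * d + τ := by
  rw [abs_lt] at hσ hτ
  rcases lt_trichotomy d 0 with hd | rfl | hd
  · exact iff_of_false (by nlinarith) (by nlinarith)
  · simpa using hs
  · exact iff_of_true (by nlinarith) (by nlinarith)

theorem exists_signed_remainder {m : ℤ} (hm : 0 < m) (z : ℤ) :
    ∃ x s r : ℤ, (s = 1 ∨ s = -1) ∧ 0 ≤ r ∧ r ≤ m ∧ z = 2 * m * x + s * r := by
  have h1 := Int.emod_add_mul_ediv z (2 * m)
  have h2 := Int.emod_nonneg z (show 2 * m ≠ 0 by omega)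
  have h3 := Int.emod_lt_of_pos z (show 0 < 2 * m by omega)
  by_cases hc : z % (2 * m) ≤ m
  · exact ⟨z / (2 * m), 1, z % (2 * m), Or.inl rfl, h2, hc, by linarith⟩
  · exact ⟨z / (2 * m) + 1, -1, 2 * m - z % (2 * m), Or.inr rfl, by omega, by omega, by linarith⟩

/-- Replacing the remainders of an odd function modulo `2 * m` by their ranks turns it into
an admissible function. -/
theorem exists_isAdmissible {n : ℕ} (hn : 2 ≤ n) {K : ℤ → ℤ} {m : ℤ} (hm : 0 < m)
    (odd : ∀ A, K (-A) = -K A)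
    (res : ∀ A B, IsLetter n A → IsLetter n B → A ≠ B → A ≠ -B → ¬ (2 * m ∣ K A - K B)) :
    ∃ H, IsAdmissible n H ∧ ∀ A B, IsLetter n A → IsLetter n B → A ≠ B → A ≠ -B →
      (K B < K A ↔ H B < H A) ∧ (K B + 2 * m < K A ↔ H B + (2 * (n : ℤ) - 2) < H A) := by
  obtain ⟨h, hh⟩ : ∃ h : ℤ, h = 2 * (n : ℤ) - 2 := ⟨_, rfl⟩
  choose x s r hs hr0 hrm hK using exists_signed_remainder hm
  let rk : ℤ → ℤ := fun A => ((Finset.Icc 1 (n : ℤ)).filter fun B => r (K B) < r (K A)).card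
  let H : ℤ → ℤ := fun A => if 0 < A then h * x (K A) + s (K A) * rk A else
    if A < 0 then -(h * x (K (-A)) + s (K (-A)) * rk (-A)) else 0
  have hpos : ∀ A, IsLetter n A → 1 ≤ |A| ∧ |A| ≤ n := by
    rintro A ⟨h1, h2, h3⟩
    rcases abs_cases A with h | h <;> omega
  have form : ∀ A, IsLetter n A → ∃ X S : ℤ, (S = 1 ∨ S = -1) ∧
      K A = 2 * m * X + S * r (K |A|) ∧ H A = h * X + S * rk |A| := by
    intro A hA
    rcases lt_or_gt_of_ne hA.1 with h0 | h0
    · have e := hK (K (-A))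
      refine ⟨-x (K (-A)), -s (K (-A)), ?_, ?_, ?_⟩
      · rcases hs (K (-A)) with h | h <;> simp [h]
      · rw [abs_of_neg h0]
        rw [odd] at e ⊢
        linarith
      · simp only [H]
        rw [abs_of_neg h0, if_neg (by omega), if_pos h0]
        ring
    · refine ⟨x (K A), s (K A), hs _, ?_, ?_⟩
      · rw [abs_of_pos h0]
        exact hK (K A)
      · simp only [H]
        rw [abs_of_pos h0, if_pos h0]
  have habs : ∀ A B : ℤ, A ≠ B → A ≠ -B → |A| ≠ |B| := by
    intro A B h1 h2 h3
    rcases abs_eq_abs.mp h3 with h | h <;> contradiction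
  have rne : ∀ A B, IsLetter n A → IsLetter n B → A ≠ B → A ≠ -B → r (K |A|) ≠ r (K |B|) := by
    intro A B hA hB h1 h2 heq
    obtain ⟨X, S, hS, hX, -⟩ := form A hA
    obtain ⟨Y, T, hT, hY, -⟩ := form B hB
    rw [heq] at hX
    have c1 := res A B hA hB h1 h2
    have c2 := res A (-B) hA hB.neg h2 (by omega)
    rw [odd] at c2
    rcases hS with rfl | rfl <;> rcases hT with rfl | rfl
    · exact c1 ⟨X - Y, by linarith⟩
    · exact c2 ⟨X + Y, by linarith⟩
    · exact c2 ⟨X + Y, by linarith⟩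
    · exact c1 ⟨X - Y, by linarith⟩
  have rklt : ∀ A B : ℤ, 1 ≤ A → A ≤ n → r (K A) < r (K B) → rk A < rk B := by
    intro A B hA hA' hlt
    simp only [rk]
    rw [Nat.cast_lt]
    apply Finset.card_lt_card
    refine (Finset.ssubset_iff_of_subset ?_).mpr ⟨A, ?_, ?_⟩
    · intro C hC
      rw [Finset.mem_filter] at hC ⊢
      exact ⟨hC.1, hC.2.trans hlt⟩
    · simp [hA, hA', hlt]
    · simp
  have rk0 : ∀ A : ℤ, 0 ≤ rk A := fun A => Nat.cast_nonneg _
  have rkn : ∀ A : ℤ, 1 ≤ A → A ≤ n → rk A ≤ n - 1 := by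
    intro A hA hA'
    have : ((Finset.Icc 1 (n : ℤ)).filter fun B => r (K B) < r (K A)).card <
        (Finset.Icc 1 (n : ℤ)).card := by
      apply Finset.card_lt_card
      refine (Finset.ssubset_iff_of_subset (Finset.filter_subset _ _)).mpr ⟨A, ?_, ?_⟩
      · simp [hA, hA']
      · simp
    rw [Int.card_Icc] at this
    simp only [rk]
    omega
  have cmp : ∀ A B, IsLetter n A → IsLetter n B → A ≠ B → A ≠ -B → ∃ X S Y T : ℤ,
      K A = 2 * m * X + S ∧ K B = 2 * m * Y + T ∧ |S - T| < 2 * m ∧ ∃ S' T' : ℤ,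
        H A = h * X + S' ∧ H B = h * Y + T' ∧ |S' - T'| < h ∧ S' ≠ T' ∧
        (0 < S - T ↔ 0 < S' - T') := by
    intro A B hA hB h1 h2
    have hne := rne A B hA hB h1 h2
    obtain ⟨X, S, hS, hX, hX'⟩ := form A hA
    obtain ⟨Y, T, hT, hY, hY'⟩ := form B hB
    have a1 := rk0 |A|
    have a2 := rkn |A| (hpos A hA).1 (hpos A hA).2
    have b1 := rk0 |B|
    have b2 := rkn |B| (hpos B hB).1 (hpos B hB).2
    have c1 := rklt |A| |B| (hpos A hA).1 (hpos A hA).2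
    have c2 := rklt |B| |A| (hpos B hB).1 (hpos B hB).2
    have d1 := hr0 (K |A|)
    have d2 := hrm (K |A|)
    have d3 := hr0 (K |B|)
    have d4 := hrm (K |B|)
    refine ⟨X, _, Y, _, hX, hY, ?_, _, _, hX', hY', ?_, ?_, ?_⟩
    all_goals
      generalize r (K |A|) = rA at *
      generalize r (K |B|) = rB at *
      generalize rk |A| = kA at *
      generalize rk |B| = kB at *
      rcases hS with rfl | rfl <;> rcases hT with rfl | rfl
    all_goals first | rw [abs_lt]; omega | omega
  refine ⟨H, ⟨?_, ?_⟩, ?_⟩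
  · intro A
    simp only [H]
    rw [neg_neg]
    split_ifs <;> omega
  · intro A B hA hB h1 h2 hdvd
    obtain ⟨X, S, Y, T, -, -, -, S', T', hX, hY, hlt, hne, -⟩ := cmp A B hA hB h1 h2
    rw [← hh, hX, hY] at hdvd
    have : h ∣ S' - T' := by
      have h3 : S' - T' = (h * X + S' - (h * Y + T')) - h * (X - Y) := by ring
      rw [h3]
      exact dvd_sub hdvd (dvd_mul_right _ _)
    have := Int.eq_zero_of_abs_lt_dvd this hlt
    omega
  · intro A B hA hB h1 h2
    obtain ⟨X, S, Y, T, kX, kY, kl, S', T', hX, hY, hlt, hne, hiff⟩ := cmp A B hA hB h1 h2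
    rw [← hh]
    constructor
    · have := pos_iff_of_sign_iff (d := X - Y) kl hlt hiff
      rw [kX, kY, hX, hY, ← sub_pos, ← sub_pos (b := h * Y + T')]
      convert this using 1 <;> ring_nf
    · have := pos_iff_of_sign_iff (d := X - Y - 1) kl hlt hiff
      rw [kX, kY, hX, hY, ← sub_pos, ← sub_pos (b := h * Y + T' + h)]
      convert this using 1 <;> ring_nf

/-- A semiorder given by a monotone table is represented by rational numbers. -/
theorem exists_semiorder_rep (T : ℕ → ℕ → Prop)
    (hmono : ∀ i j i' j', T i j → 1 ≤ i' → i' ≤ i → j ≤ j' → T i' j') (M : ℕ) :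
    ∃ f : ℕ → ℚ, ∀ i j, 1 ≤ i → i < j → j ≤ M →
      f j < f i ∧ (T i j → f j + 1 < f i) ∧ (¬ T i j → f i < f j + 1) := by
  classical
  induction M with
  | zero => exact ⟨fun _ => 0, fun i j _ _ _ => by omega⟩
  | succ M ih =>
    obtain ⟨f, hf⟩ := ih
    obtain ⟨y, hlo, hhi⟩ := Order.exists_between_finsets
      (((Finset.Icc 1 M).filter fun i => ¬ T i (M + 1)).image fun i => f i - 1)
      (((Finset.Icc 1 M).filter fun i => T i (M + 1)).image (fun i => f i - 1) ∪
        (Finset.Icc 1 M).image f) (by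
      intro x hx y hy
      obtain ⟨i, hi, rfl⟩ := Finset.mem_image.mp hx
      rw [Finset.mem_filter, Finset.mem_Icc] at hi
      obtain ⟨⟨hi1, hi2⟩, hi3⟩ := hi
      rw [Finset.mem_union, Finset.mem_image, Finset.mem_image] at hy
      rcases hy with ⟨k, hk, rfl⟩ | ⟨k, hk, rfl⟩
      · rw [Finset.mem_filter, Finset.mem_Icc] at hk
        obtain ⟨⟨hk1, hk2⟩, hk3⟩ := hk
        have hki : k < i := by
          by_contra hc
          exact hi3 (hmono k (M + 1) i (M + 1) hk3 hi1 (by omega) le_rfl)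
        have := (hf k i hk1 hki hi2).1
        linarith
      · rw [Finset.mem_Icc] at hk
        obtain ⟨hk1, hk2⟩ := hk
        rcases lt_trichotomy i k with hik | rfl | hik
        · have := (hf i k hi1 hik hk2).2.2
            fun hT => hi3 (hmono i k i (M + 1) hT hi1 le_rfl (by omega))
          linarith
        · linarith
        · have := (hf k i hk1 hik hi2).1
          linarith)
    refine ⟨fun i => if i = M + 1 then y else f i, fun i j hi hij hj => ?_⟩
    by_cases hjM : j = M + 1
    · subst hjM
      have hiM : i ∈ Finset.Icc 1 M := Finset.mem_Icc.mpr ⟨hi, by omega⟩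
      simp only [if_true, if_neg (show i ≠ M + 1 by omega)]
      refine ⟨?_, fun hT => ?_, fun hT => ?_⟩
      · exact hhi _ (Finset.mem_union_right _ (Finset.mem_image_of_mem f hiM))
      · have := hhi _ (Finset.mem_union_left _ (Finset.mem_image_of_mem (fun i => f i - 1)
          (Finset.mem_filter.mpr ⟨hiM, hT⟩)))
        linarith
      · have := hlo _ (Finset.mem_image_of_mem (fun i => f i - 1)
          (Finset.mem_filter.mpr ⟨hiM, hT⟩))
        linarith
    · simp only [if_neg hjM, if_neg (show i ≠ M + 1 by omega)]
      exact hf i j hi hij (by omega)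

/-- The extension of the table of a ballot path by its mirror image. -/
def fullTable (n : ℕ) (β : List Step) (i j : ℕ) : Prop :=
  1 ≤ i ∧ if i + j ≤ 2 * n + 1 then i ≤ ebn β j
    else j ≤ 2 * n ∧ i < j ∧ 2 * n + 1 - j ≤ ebn β (2 * n + 1 - i) ∨ 2 * n < j ∧ i < j

theorem lt_of_fullTable {n : ℕ} {β : List Step} (hβ : IsBallotPath (2 * n - 1) β) {i j : ℕ}
    (h : fullTable n β i j) : i < j := by
  obtain ⟨hi, h⟩ := h
  split_ifs at h with hc
  · by_cases hj : j = 0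
    · subst hj
      rw [ebn_zero] at h
      omega
    · have := ebn_lt_of_isBallotPath hβ (show 1 ≤ j by omega)
      omega
  · omega

theorem fullTable_mono {n : ℕ} {β : List Step} (hβ : IsBallotPath (2 * n - 1) β) {i j i' j' : ℕ}
    (h : fullTable n β i j) (hi' : 1 ≤ i') (hii : i' ≤ i) (hjj : j ≤ j') :
    fullTable n β i' j' := by
  have hlt := lt_of_fullTable hβ h
  obtain ⟨hi, h⟩ := h
  refine ⟨hi', ?_⟩
  by_cases h1 : i + j ≤ 2 * n + 1 <;> by_cases h2 : i' + j' ≤ 2 * n + 1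
  · rw [if_pos h1] at h
    rw [if_pos h2]
    have := ebn_mono β hjj
    omega
  · rw [if_pos h1] at h
    rw [if_neg h2]
    have := ebn_mono β (show j ≤ 2 * n + 1 - i' by omega)
    omega
  · rw [if_neg h1] at h
    rw [if_pos h2]
    have := ebn_mono β (show 2 * n + 1 - i ≤ j' by omega)
    omega
  · rw [if_neg h1] at h
    rw [if_neg h2]
    have := ebn_mono β (show 2 * n + 1 - i ≤ 2 * n + 1 - i' by omega)
    omega

theorem fullTable_mirror {n : ℕ} {β : List Step} (hβ : IsBallotPath (2 * n - 1) β) {i j : ℕ}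
    (hi : 1 ≤ i) (hi' : i ≤ 2 * n) (hj : 1 ≤ j) (hj' : j ≤ 2 * n) (hij : i + j ≠ 2 * n + 1) :
    fullTable n β (2 * n + 1 - j) (2 * n + 1 - i) ↔ fullTable n β i j := by
  have key : ∀ i j, 1 ≤ i → i ≤ 2 * n → 1 ≤ j → j ≤ 2 * n → i + j ≤ 2 * n →
      (fullTable n β (2 * n + 1 - j) (2 * n + 1 - i) ↔ fullTable n β i j) := by
    intro i j hi hi' hj hj' hij
    unfold fullTable
    rw [if_neg (by omega), if_pos (by omega)]
    have := ebn_lt_of_isBallotPath hβ hj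
    rw [show 2 * n + 1 - (2 * n + 1 - i) = i by omega,
      show 2 * n + 1 - (2 * n + 1 - j) = j by omega]
    omega
  by_cases h : i + j ≤ 2 * n
  · exact key i j hi hi' hj hj' h
  · have := key (2 * n + 1 - j) (2 * n + 1 - i) (by omega) (by omega) (by omega) (by omega)
      (by omega)
    rw [show 2 * n + 1 - (2 * n + 1 - i) = i by omega,
      show 2 * n + 1 - (2 * n + 1 - j) = j by omega] at this
    exact this.symm

/-- Integral symmetric version of `exists_semiorder_rep` for the full table of a ballot path. -/
theorem exists_symmetric_rep {n : ℕ} {β : List Step} (hβ : IsBallotPath (2 * n - 1) β) :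
    ∃ (D : ℤ) (z : ℕ → ℤ), 0 < D ∧ (∀ i, 1 ≤ i → i ≤ 2 * n → z (2 * n + 1 - i) = -z i) ∧
      ∀ i j, 1 ≤ i → i < j → j ≤ 2 * n → i + j ≠ 2 * n + 1 → z j < z i ∧
        (fullTable n β i j → z j + 2 * D < z i) ∧ (¬ fullTable n β i j → z i < z j + 2 * D) := by
  obtain ⟨f, hf⟩ := exists_semiorder_rep (fullTable n β)
    (fun i j i' j' => fullTable_mono hβ) (2 * n)
  obtain ⟨D, g, hD, hg⟩ : ∃ (D : ℤ) (g : ℕ → ℤ), 0 < D ∧ ∀ i ∈ Finset.Icc 1 (2 * n),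
      (g i : ℚ) = D * f i := by
    refine ⟨∏ i ∈ Finset.Icc 1 (2 * n), ((f i).den : ℤ),
      fun i => (f i).num * ∏ k ∈ (Finset.Icc 1 (2 * n)).erase i, ((f k).den : ℤ), ?_, ?_⟩
    · exact Finset.prod_pos fun i _ => by exact_mod_cast (f i).den_pos
    · intro i hi
      rw [← Finset.mul_prod_erase _ _ hi]
      push_cast
      have := Rat.den_mul_eq_num (f i)
      linear_combination -(∏ k ∈ (Finset.Icc 1 (2 * n)).erase i, ((f k).den : ℚ)) * this
  have hDQ : (0 : ℚ) < D := by exact_mod_cast hD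
  refine ⟨D, fun i => g i - g (2 * n + 1 - i), hD, ?_, ?_⟩
  · intro i hi hi'
    change g (2 * n + 1 - i) - g (2 * n + 1 - (2 * n + 1 - i)) = -(g i - g (2 * n + 1 - i))
    rw [show 2 * n + 1 - (2 * n + 1 - i) = i by omega]
    ring
  · intro i j hi hij hj hne
    have m := fullTable_mirror hβ hi (by omega) (by omega) hj hne
    obtain ⟨a1, a2, a3⟩ := hf i j hi hij hj
    obtain ⟨b1, b2, b3⟩ := hf (2 * n + 1 - j) (2 * n + 1 - i) (by omega) (by omega) (by omega)
    rw [m] at b2 b3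
    have e1 := hg i (Finset.mem_Icc.mpr ⟨hi, by omega⟩)
    have e2 := hg j (Finset.mem_Icc.mpr ⟨by omega, hj⟩)
    have e3 := hg (2 * n + 1 - i) (Finset.mem_Icc.mpr ⟨by omega, by omega⟩)
    have e4 := hg (2 * n + 1 - j) (Finset.mem_Icc.mpr ⟨by omega, by omega⟩)
    refine ⟨?_, fun hT => ?_, fun hT => ?_⟩
    · rw [← Int.cast_lt (R := ℚ)]
      push_cast
      rw [e1, e2, e3, e4]
      nlinarith
    · rw [← Int.cast_lt (R := ℚ)]
      push_cast
      rw [e1, e2, e3, e4]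
      nlinarith [a2 hT, b2 hT]
    · rw [← Int.cast_lt (R := ℚ)]
      push_cast
      rw [e1, e2, e3, e4]
      nlinarith [a3 hT, b3 hT]

theorem IsLetterSeq.exists_odd_extension {n : ℕ} {b : ℕ → ℤ} (hb : IsLetterSeq n b) {k : ℕ → ℤ}
    (hk : ∀ i, 1 ≤ i → i ≤ 2 * n → k (2 * n + 1 - i) = -k i) :
    ∃ K : ℤ → ℤ, (∀ A, K (-A) = -K A) ∧ ∀ i, 1 ≤ i → i ≤ 2 * n → K (b i) = k i := by
  classical
  let K : ℤ → ℤ := fun A => if h : ∃ i, 1 ≤ i ∧ i ≤ 2 * n ∧ b i = A then k h.choose else 0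
  have hK : ∀ i, 1 ≤ i → i ≤ 2 * n → K (b i) = k i := by
    intro i hi hi'
    have h : ∃ i', 1 ≤ i' ∧ i' ≤ 2 * n ∧ b i' = b i := ⟨i, hi, hi', rfl⟩
    simp only [K]
    rw [dif_pos h, hb.inj _ i h.choose_spec.1 h.choose_spec.2.1 hi hi' h.choose_spec.2.2]
  refine ⟨K, fun A => ?_, hK⟩
  by_cases h : ∃ i, 1 ≤ i ∧ i ≤ 2 * n ∧ b i = A
  · obtain ⟨i, hi, hi', rfl⟩ := h
    rw [← hb.mirror i hi hi', hK _ (by omega) (by omega), hK i hi hi', hk i hi hi']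
  · have h' : ¬∃ i, 1 ≤ i ∧ i ≤ 2 * n ∧ b i = -A := by
      rintro ⟨i, hi, hi', hA⟩
      exact h ⟨2 * n + 1 - i, by omega, by omega, by rw [hb.mirror i hi hi', hA, neg_neg]⟩
    simp only [K]
    rw [dif_neg h, dif_neg h', neg_zero]

theorem IsLetterSeq.exists_realizes {n : ℕ} {b : ℕ → ℤ} (hb : IsLetterSeq n b) (hn : 2 ≤ n)
    {β : List Step} (hβ : IsBallotPath (2 * n - 1) β) :
    ∃ H, IsAdmissible n H ∧ Realizes n H β b := by
  obtain ⟨D, z, hD, hz, hzT⟩ := exists_symmetric_rep hβ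
  obtain ⟨K, odd, hK⟩ := hb.exists_odd_extension
    (k := fun i => 4 * n * z i + (2 * n + 1 - 2 * i)) (by
      intro i hi hi'
      rw [hz i hi hi']
      push_cast [show i ≤ 2 * n + 1 by omega]
      ring)
  obtain ⟨m, hm⟩ : ∃ m, m = 4 * n * D := ⟨_, rfl⟩
  have hm0 : 0 < m := by rw [hm]; positivity
  obtain ⟨H, ad, hH⟩ := exists_isAdmissible hn hm0 odd (by
    intro A B hA hB h1 h2 hdvd
    obtain ⟨i, hi, hi', rfl⟩ := hb.surj hA
    obtain ⟨j, hj, hj', rfl⟩ := hb.surj hB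
    rw [hK i hi hi', hK j hj hj', hm] at hdvd
    obtain ⟨c, hc⟩ := hdvd
    have h3 : (4 * n : ℤ) ∣ 2 * j - 2 * i := ⟨2 * D * c - z i + z j, by linarith⟩
    have := Int.eq_zero_of_abs_lt_dvd h3 (by rw [abs_lt]; omega)
    exact h1 (by rw [show i = j by omega]))
  refine ⟨H, ad, ?_⟩
  have cmp : ∀ i j, 1 ≤ i → i < j → j ≤ 2 * n → i + j ≠ 2 * n + 1 → H (b j) < H (b i) ∧
      (fullTable n β i j ↔ H (b j) + (2 * (n : ℤ) - 2) < H (b i)) := by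
    intro i j hi hij hj hne
    obtain ⟨z1, z2, z3⟩ := hzT i j hi hij hj hne
    obtain ⟨h1, h2⟩ := hH (b i) (b j) (hb.letter i hi (by omega)) (hb.letter j (by omega) hj)
      (fun h => by have := hb.inj i j hi (by omega) (by omega) hj h; omega)
      (fun h => hne (hb.add_eq_of_eq_neg hi (by omega) (by omega) hj h))
    rw [← h1, ← h2, hK i hi (by omega), hK j (by omega) hj]
    refine ⟨by nlinarith, fun hT => ?_, fun h => ?_⟩
    · have := z2 hT
      rw [hm]
      nlinarith
    · by_contra hT
      have := z3 hT
      rw [hm] at h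
      have e : (4 * n : ℤ) * (z i + 1) ≤ 4 * n * (z j + 2 * D) :=
        mul_le_mul_of_nonneg_left (by omega) (by omega)
      nlinarith
  have anti : ∀ i j, 1 ≤ i → i < j → j ≤ 2 * n → i + j ≠ 2 * n + 1 → H (b j) < H (b i) :=
    fun i j hi hij hj hne => (cmp i j hi hij hj hne).1
  constructor
  · intro i j hi hij hj hne
    by_cases h : i + j = 2 * n + 1
    · have e1 := anti i n hi (by omega) (by omega) (by omega)
      have e2 := anti i (n + 1) hi (by omega) (by omega) (by omega)
      rw [hb.mirror_of_add_eq (i := n) (j := n + 1) (by omega) (by omega) (by omega), ad.odd] at e2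
      rw [hb.mirror_of_add_eq hi (by omega) h, ad.odd]
      omega
    · exact anti i j hi hij hj h
  · intro i j hi hj hij
    have hlt := ebn_lt_of_isBallotPath hβ hj
    rcases lt_trichotomy i j with h | rfl | h
    · rw [← (cmp i j hi h (by omega) (by omega)).2, fullTable, if_pos (by omega)]
      tauto
    · exact iff_of_false (by omega) (by omega)
    · have := anti j i hj h (by omega) (by omega)
      exact iff_of_false (by omega) (by omega)

end HLZeta

/-! ### Alcoves as labelled area vectors -/

open Step

namespace HLZeta

/-- Signed labels `ℓ 1, …, ℓ n` with an even number of negative labels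
together with a vector `μ` with even sum. -/
structure IsLabelling (n : ℕ) (μ ℓ : ℕ → ℤ) : Prop where
  letter : ∀ k, 1 ≤ k → k ≤ n → IsLetter n (ℓ k)
  ne : ∀ i j, 1 ≤ i → i ≤ n → 1 ≤ j → j ≤ n → i ≠ j → ℓ i ≠ ℓ j ∧ ℓ i ≠ -ℓ j
  even : 2 ∣ ∑ k ∈ Finset.Icc 1 n, μ k
  sign : ∏ k ∈ Finset.Icc 1 n, (ℓ k).sign = 1

/-- The inequalities describing vertically labelled paths in terms of area vector and labels. -/
structure IsShi (n : ℕ) (μ ℓ : ℕ → ℤ) : Prop where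
  step : ∀ k, 1 ≤ k → k < n → μ k - μ (k + 1) ≤ 1 ∧ (μ k - μ (k + 1) = 1 → ℓ k < ℓ (k + 1))
  low : -(μ 1 + μ 2) ≤ 1 ∧ (-(μ 1 + μ 2) = 1 → -ℓ 1 < ℓ 2)
  top : μ (n - 1) + μ n ≤ 2 ∧ (μ (n - 1) + μ n = 2 → ℓ (n - 1) < -ℓ n)
  two : n = 2 → μ 2 - μ 1 ≤ 2 ∧ (μ 2 - μ 1 = 2 → ℓ 2 < ℓ 1)

/-- The alcove `H` has area vector `μ` and labels `ℓ`. -/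
def Represents (n : ℕ) (H : ℤ → ℤ) (μ ℓ : ℕ → ℤ) : Prop :=
  ∀ k, 1 ≤ k → k ≤ n → H (ℓ k) = ((k : ℤ) - 1) - (2 * (n : ℤ) - 2) * μ k

theorem eq_zero_of_mul_eq {h t x : ℤ} (h1 : h * t = x) (h2 : |x| < h) : t = 0 ∧ x = 0 := by
  have hx : x = 0 := Int.eq_zero_of_abs_lt_dvd ⟨t, h1.symm⟩ h2
  subst hx
  rw [abs_zero] at h2
  rcases mul_eq_zero.mp h1 with h | h
  · omega
  · exact ⟨h, rfl⟩

namespace IsLabelling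

variable {n : ℕ} {μ ℓ μ' ℓ' : ℕ → ℤ} {H : ℤ → ℤ}

theorem isLetterSeq (hℓ : ∀ k, 1 ≤ k → k ≤ n → IsLetter n (ℓ k))
    (hne : ∀ i j, 1 ≤ i → i ≤ n → 1 ≤ j → j ≤ n → i ≠ j → ℓ i ≠ ℓ j ∧ ℓ i ≠ -ℓ j) :
    IsLetterSeq n fun i => if i ≤ n then ℓ i else -ℓ (2 * n + 1 - i) where
  letter i hi hi' := by
    split_ifs with h
    · exact hℓ i hi h
    · exact (hℓ _ (by omega) (by omega)).neg
  mirror i hi hi' := by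
    by_cases h : i ≤ n
    · simp only [if_pos h]
      rw [if_neg (by omega), show 2 * n + 1 - (2 * n + 1 - i) = i by omega]
    · simp only [if_neg h]
      rw [if_pos (by omega), neg_neg]
  inj i j hi hi' hj hj' hij := by
    by_contra hc
    have key : ∀ a b, 1 ≤ a → a ≤ n → 1 ≤ b → b ≤ n → ℓ a = -ℓ b → False := by
      intro a b ha ha' hb hb' hab
      by_cases e : a = b
      · subst e
        exact (hℓ a ha ha').1 (by omega)
      · exact (hne a b ha ha' hb hb' e).2 hab
    split_ifs at hij with h1 h2 h2
    · exact (hne i j hi h1 hj h2 hc).1 hij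
    · exact key _ _ hi h1 (by omega) (by omega) hij
    · exact key _ _ hj h2 (by omega) (by omega) hij.symm
    · exact (hne (2 * n + 1 - i) (2 * n + 1 - j) (by omega) (by omega) (by omega) (by omega)
        (by omega)).1 (by omega)

theorem exists_eq (L : IsLabelling n μ ℓ) {A : ℤ} (hA : IsLetter n A) :
    ∃ k, 1 ≤ k ∧ k ≤ n ∧ (A = ℓ k ∨ A = -ℓ k) := by
  obtain ⟨i, hi, hi', hiA⟩ := (isLetterSeq L.letter L.ne).surj hA
  split_ifs at hiA with h
  · exact ⟨i, hi, h, Or.inl hiA.symm⟩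
  · exact ⟨_, by omega, by omega, Or.inr hiA.symm⟩

theorem exists_represents (L : IsLabelling n μ ℓ) :
    ∃ H : ℤ → ℤ, (∀ A, H (-A) = -H A) ∧ Represents n H μ ℓ := by
  obtain ⟨H, odd, hH⟩ := (isLetterSeq L.letter L.ne).exists_odd_extension
    (k := fun i => if i ≤ n then ((i : ℤ) - 1) - (2 * (n : ℤ) - 2) * μ i
      else -((((2 * n + 1 - i : ℕ) : ℤ) - 1) - (2 * (n : ℤ) - 2) * μ (2 * n + 1 - i))) (by
    intro i hi hi'
    by_cases h : i ≤ n
    · simp only [if_pos h]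
      rw [if_neg (by omega), show 2 * n + 1 - (2 * n + 1 - i) = i by omega]
    · simp only [if_neg h]
      rw [if_pos (by omega), neg_neg])
  refine ⟨H, odd, fun k hk hk' => ?_⟩
  have := hH k hk (by omega)
  simpa only [if_pos hk'] using this

theorem isAdmissible (L : IsLabelling n μ ℓ) (odd : ∀ A, H (-A) = -H A)
    (hH : Represents n H μ ℓ) : IsAdmissible n H := by
  refine ⟨odd, fun A B hA hB h1 h2 hdvd => ?_⟩
  obtain ⟨h, hh⟩ : ∃ h : ℤ, h = 2 * (n : ℤ) - 2 := ⟨_, rfl⟩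
  obtain ⟨i, hi, hi', hiA⟩ := L.exists_eq hA
  obtain ⟨j, hj, hj', hjB⟩ := L.exists_eq hB
  have hij : i ≠ j := by
    rintro rfl
    omega
  obtain ⟨c, hc⟩ := hdvd
  rw [← hh] at hc
  have e1 := hH i hi hi'
  have e2 := hH j hj hj'
  rw [← hh] at e1 e2
  rcases hiA with rfl | rfl <;> rcases hjB with rfl | rfl <;> simp only [odd, e1, e2] at hc
  · have := eq_zero_of_mul_eq (h := h) (t := c + μ i - μ j) (x := i - j) (by linarith)
      (by rw [abs_lt]; omega)
    omega
  · have := eq_zero_of_mul_eq (h := h) (t := c + μ i + μ j) (x := i + j - 2) (by linarith)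
      (by rw [abs_lt]; omega)
    omega
  · have := eq_zero_of_mul_eq (h := h) (t := -c + μ i + μ j) (x := i + j - 2) (by linarith)
      (by rw [abs_lt]; omega)
    omega
  · have := eq_zero_of_mul_eq (h := h) (t := c - μ i + μ j) (x := j - i) (by linarith)
      (by rw [abs_lt]; omega)
    omega

theorem isStable (L : IsLabelling n μ ℓ) (S : IsShi n μ ℓ) (hn : 2 ≤ n)
    (odd : ∀ A, H (-A) = -H A) (hH : Represents n H μ ℓ) : IsStable n H := by
  obtain ⟨h, hh⟩ : ∃ h : ℤ, h = 2 * (n : ℤ) - 2 := ⟨_, rfl⟩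
  have key1 : ∀ i j c, 1 ≤ i → i ≤ n → 1 ≤ j → j ≤ n → i ≠ j →
      H (ℓ i) - H (ℓ j) = 1 + h * c → c ≤ 1 ∧ (c = 1 → ℓ j < ℓ i) := by
    intro i j c hi hi' hj hj' hij hc
    rw [hH i hi hi', hH j hj hj', ← hh] at hc
    by_cases h2 : n = 2 ∧ i = 1
    · obtain ⟨rfl, rfl⟩ := h2
      obtain rfl : j = 2 := by omega
      obtain rfl : h = 2 := by omega
      push_cast at hc
      have := S.two rfl
      omega
    · have := eq_zero_of_mul_eq (h := h) (t := c + μ i - μ j) (x := i - j - 1) (by linarith)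
        (by rw [abs_lt]; omega)
      obtain rfl : i = j + 1 := by omega
      have := S.step j hj (by omega)
      omega
  have key2 : ∀ i j c, 1 ≤ i → i ≤ n → 1 ≤ j → j ≤ n → i ≠ j →
      H (ℓ i) + H (ℓ j) = 1 + h * c → c ≤ 1 ∧ (c = 1 → -ℓ j < ℓ i) := by
    intro i j c hi hi' hj hj' hij hc
    rw [hH i hi hi', hH j hj hj', ← hh] at hc
    have := eq_zero_of_mul_eq (h := h) (t := c + μ i + μ j) (x := i + j - 3) (by linarith)
      (by rw [abs_lt]; omega)
    have h12 : i = 1 ∧ j = 2 ∨ i = 2 ∧ j = 1 := by omega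
    have := S.low
    rcases h12 with ⟨rfl, rfl⟩ | ⟨rfl, rfl⟩ <;> omega
  have key3 : ∀ i j c, 1 ≤ i → i ≤ n → 1 ≤ j → j ≤ n → i ≠ j →
      -H (ℓ i) - H (ℓ j) = 1 + h * c → c ≤ 1 ∧ (c = 1 → ℓ j < -ℓ i) := by
    intro i j c hi hi' hj hj' hij hc
    rw [hH i hi hi', hH j hj hj', ← hh] at hc
    have := eq_zero_of_mul_eq (h := h) (t := c - μ i - μ j + 1) (x := 2 * n - 1 - i - j)
      (by rw [hh] at hc ⊢; linarith) (by rw [abs_lt]; omega)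
    have h12 : i = n - 1 ∧ j = n ∨ i = n ∧ j = n - 1 := by omega
    have := S.top
    rcases h12 with ⟨rfl, rfl⟩ | ⟨rfl, rfl⟩ <;> omega
  intro A B c hA hB h1 h2 hc
  obtain ⟨i, hi, hi', hiA⟩ := L.exists_eq hA
  obtain ⟨j, hj, hj', hjB⟩ := L.exists_eq hB
  have hij : i ≠ j := by
    rintro rfl
    omega
  rw [← hh] at hc
  rcases hiA with rfl | rfl <;> rcases hjB with rfl | rfl <;> try simp only [odd] at hc
  · exact key1 i j c hi hi' hj hj' hij hc
  · exact key2 i j c hi hi' hj hj' hij (by linarith)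
  · exact key3 i j c hi hi' hj hj' hij hc
  · have := key1 j i c hj hj' hi hi' hij.symm (by linarith)
    omega

theorem isShi (L : IsLabelling n μ ℓ) (st : IsStable n H) (hn : 2 ≤ n)
    (odd : ∀ A, H (-A) = -H A) (hH : Represents n H μ ℓ) : IsShi n μ ℓ := by
  have l1 : ∀ k, 1 ≤ k → k < n → μ k - μ (k + 1) ≤ 1 ∧ (μ k - μ (k + 1) = 1 → ℓ k < ℓ (k + 1)) := by
    intro k hk hk'
    obtain ⟨h1, h2⟩ := L.ne (k + 1) k (by omega) (by omega) hk (by omega) (by omega)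
    refine st _ _ _ (L.letter (k + 1) (by omega) (by omega)) (L.letter k hk (by omega)) h1 h2 ?_
    rw [hH k hk (by omega), hH (k + 1) (by omega) (by omega)]
    push_cast
    ring
  refine ⟨l1, ?_, ?_, ?_⟩
  · obtain ⟨h1, h2⟩ := L.ne 2 1 (by omega) hn le_rfl (by omega) (by omega)
    refine st _ _ _ (L.letter 2 (by omega) hn) (L.letter 1 le_rfl (by omega)).neg h2 (by omega) ?_
    rw [odd, hH 1 le_rfl (by omega), hH 2 (by omega) hn]
    push_cast
    ring
  · obtain ⟨h1, h2⟩ := L.ne (n - 1) n (by omega) (by omega) (by omega) le_rfl (by omega)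
    have := st (-ℓ (n - 1)) (ℓ n) (μ (n - 1) + μ n - 1) (L.letter (n - 1) (by omega) (by omega)).neg
      (L.letter n (by omega) le_rfl) (by omega) (by omega) (by
        rw [odd, hH (n - 1) (by omega) (by omega), hH n (by omega) le_rfl]
        push_cast [show 1 ≤ n by omega]
        ring)
    omega
  · rintro rfl
    obtain ⟨h1, h2⟩ := L.ne 1 2 le_rfl (by omega) (by omega) le_rfl (by omega)
    have := st (ℓ 1) (ℓ 2) (μ 2 - μ 1 - 1) (L.letter 1 le_rfl (by omega))
      (L.letter 2 (by omega) le_rfl) h1 h2 (by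
        rw [hH 1 le_rfl (by omega), hH 2 (by omega) le_rfl]
        push_cast
        ring)
    omega

theorem eq_or_of_represents (L : IsLabelling n μ ℓ) (L' : IsLabelling n μ' ℓ') (hn : 2 ≤ n)
    (odd : ∀ A, H (-A) = -H A) (hH : Represents n H μ ℓ) (hH' : Represents n H μ' ℓ')
    {k : ℕ} (hk : 1 ≤ k) (hk' : k ≤ n) : ℓ' k = ℓ k ∧ μ' k = μ k ∨
      k = 1 ∧ ℓ' k = -ℓ k ∧ μ' k = -μ k ∨ k = n ∧ ℓ' k = -ℓ k ∧ μ' k = 1 - μ k := by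
  obtain ⟨h, hh⟩ : ∃ h : ℤ, h = 2 * (n : ℤ) - 2 := ⟨_, rfl⟩
  obtain ⟨j, hj, hj', hjA⟩ := L.exists_eq (L'.letter k hk hk')
  have e1 := hH j hj hj'
  have e2 := hH' k hk hk'
  rw [← hh] at e1 e2
  rcases hjA with hjA | hjA
  · rw [hjA, e1] at e2
    have := eq_zero_of_mul_eq (h := h) (t := μ j - μ' k) (x := j - k) (by linarith)
      (by rw [abs_lt]; omega)
    obtain rfl : j = k := by omega
    exact Or.inl ⟨hjA, by omega⟩
  · rw [hjA, odd, e1] at e2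
    by_cases hkn : k = n ∧ j = n
    · obtain ⟨rfl, rfl⟩ := hkn
      have := eq_zero_of_mul_eq (h := h) (t := μ j + μ' j - 1) (x := 0) (by
        rw [hh] at e2 ⊢; linarith) (by rw [abs_zero]; omega)
      exact Or.inr (Or.inr ⟨rfl, hjA, by omega⟩)
    · have := eq_zero_of_mul_eq (h := h) (t := μ j + μ' k) (x := j + k - 2) (by linarith)
        (by rw [abs_lt]; omega)
      obtain rfl : j = 1 := by omega
      obtain rfl : k = 1 := by omega
      exact Or.inr (Or.inl ⟨rfl, hjA, by omega⟩)

@[to_additive]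
theorem prod_Icc_ends {M : Type*} [CommMonoid M] (hn : 2 ≤ n) (f : ℕ → M) :
    ∏ k ∈ Finset.Icc 1 n, f k = f 1 * (∏ k ∈ Finset.Ioo 1 n, f k) * f n := by
  rw [← Finset.mul_prod_Ioc_eq_prod_Icc (by omega : 1 ≤ n),
    ← Finset.prod_Ioo_mul_eq_prod_Ioc (by omega), mul_assoc]

theorem eq_of_represents (L : IsLabelling n μ ℓ) (L' : IsLabelling n μ' ℓ') (hn : 2 ≤ n)
    (odd : ∀ A, H (-A) = -H A) (hH : Represents n H μ ℓ) (hH' : Represents n H μ' ℓ')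
    {k : ℕ} (hk : 1 ≤ k) (hk' : k ≤ n) : ℓ' k = ℓ k ∧ μ' k = μ k := by
  have key := fun k hk hk' => eq_or_of_represents (k := k) L L' hn odd hH hH' hk hk'
  have mid : ∀ k, k ∈ Finset.Ioo 1 n → ℓ' k = ℓ k ∧ μ' k = μ k := by
    intro k hk
    rw [Finset.mem_Ioo] at hk
    rcases key k (by omega) (by omega) with h | h | h
    · exact h
    · omega
    · omega
  have s := L.even
  have s' := L'.even
  have p := L.sign
  have p' := L'.sign
  rw [sum_Icc_ends hn] at s s'
  rw [prod_Icc_ends hn] at p p'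
  rw [Finset.sum_congr rfl fun k hk => (mid k hk).2] at s'
  rw [Finset.prod_congr rfl fun k hk => congrArg Int.sign (mid k hk).1] at p'
  have hlast : ℓ' n = ℓ n ∧ μ' n = μ n := by
    rcases key n (by omega) le_rfl with h | h | h
    · exact h
    · omega
    · have h1 : μ' 1 = μ 1 ∨ μ' 1 = -μ 1 := by
        rcases key 1 le_rfl (by omega) with h | h | h
        · exact Or.inl h.2
        · exact Or.inr h.2.2
        · omega
      generalize ∑ k ∈ Finset.Ioo 1 n, μ k = S at s s'
      omega
  have hfirst : ℓ' 1 = ℓ 1 ∧ μ' 1 = μ 1 := by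
    rcases key 1 le_rfl (by omega) with h | h | h
    · exact h
    · rw [h.2.1, hlast.1, Int.sign_neg, neg_mul, neg_mul, p] at p'
      omega
    · omega
  by_cases h1 : k = 1
  · exact h1 ▸ hfirst
  by_cases h2 : k = n
  · exact h2 ▸ hlast
  exact mid k (by rw [Finset.mem_Ioo]; omega)

end IsLabelling

theorem flip_ne {n m : ℕ} {ℓ : ℕ → ℤ}
    (hne : ∀ i j, 1 ≤ i → i ≤ n → 1 ≤ j → j ≤ n → i ≠ j → ℓ i ≠ ℓ j ∧ ℓ i ≠ -ℓ j) (i j : ℕ)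
    (hi : 1 ≤ i) (hi' : i ≤ n) (hj : 1 ≤ j) (hj' : j ≤ n) (hij : i ≠ j) :
    (Function.update ℓ m (-ℓ m)) i ≠ (Function.update ℓ m (-ℓ m)) j ∧
      (Function.update ℓ m (-ℓ m)) i ≠ -(Function.update ℓ m (-ℓ m)) j := by
  have := hne i j hi hi' hj hj' hij
  simp only [Function.update_apply]
  split_ifs with h1 h2 h2
  · omega
  · subst h1
    omega
  · subst h2
    omega
  · exact this

theorem flip_letter {n m : ℕ} {ℓ : ℕ → ℤ} (hℓ : ∀ k, 1 ≤ k → k ≤ n → IsLetter n (ℓ k)) (k : ℕ)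
    (hk : 1 ≤ k) (hk' : k ≤ n) : IsLetter n ((Function.update ℓ m (-ℓ m)) k) := by
  simp only [Function.update_apply]
  split_ifs with h
  · exact (hℓ m (by omega) (by omega)).neg
  · exact hℓ k hk hk'

theorem IsAdmissible.exists_isLabelling {n : ℕ} {H : ℤ → ℤ} (ad : IsAdmissible n H) (hn : 2 ≤ n) :
    ∃ μ ℓ, IsLabelling n μ ℓ ∧ Represents n H μ ℓ := by
  obtain ⟨h, hh⟩ : ∃ h : ℤ, h = 2 * (n : ℤ) - 2 := ⟨_, rfl⟩
  have ex : ∀ k : ℕ, ∃ A q, 1 ≤ k → k ≤ n → IsLetter n A ∧ H A = ((k : ℤ) - 1) - h * q := by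
    intro k
    by_cases hk : 1 ≤ k ∧ k ≤ n
    · obtain ⟨A, q, hA, hq⟩ := ad.exists_eq_add hn (k - 1) (by omega)
      exact ⟨A, -q, fun _ _ => ⟨hA, by rw [hq, hh]; push_cast [hk.1]; ring⟩⟩
    · exact ⟨0, 0, fun h1 h2 => absurd ⟨h1, h2⟩ hk⟩
  choose ℓ μ hℓ using ex
  have hne : ∀ i j, 1 ≤ i → i ≤ n → 1 ≤ j → j ≤ n → i ≠ j → ℓ i ≠ ℓ j ∧ ℓ i ≠ -ℓ j := by
    intro i j hi hi' hj hj' hij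
    have e1 := (hℓ i hi hi').2
    have e2 := (hℓ j hj hj').2
    constructor
    · intro e
      rw [e, e2] at e1
      have := eq_zero_of_mul_eq (h := h) (t := μ i - μ j) (x := i - j) (by linarith)
        (by rw [abs_lt]; omega)
      omega
    · intro e
      rw [e, ad.odd, e2] at e1
      have := eq_zero_of_mul_eq (h := h) (t := μ i + μ j) (x := i + j - 2) (by linarith)
        (by rw [abs_lt]; omega)
      omega
  -- make the sum even
  obtain ⟨μ₁, ℓ₁, l₁, ne₁, r₁, even₁⟩ : ∃ μ₁ ℓ₁, (∀ k, 1 ≤ k → k ≤ n → IsLetter n (ℓ₁ k)) ∧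
      (∀ i j, 1 ≤ i → i ≤ n → 1 ≤ j → j ≤ n → i ≠ j → ℓ₁ i ≠ ℓ₁ j ∧ ℓ₁ i ≠ -ℓ₁ j) ∧
      Represents n H μ₁ ℓ₁ ∧ 2 ∣ ∑ k ∈ Finset.Icc 1 n, μ₁ k := by
    have hl : ∀ k, 1 ≤ k → k ≤ n → IsLetter n (ℓ k) := fun k h1 h2 => (hℓ k h1 h2).1
    have hr : Represents n H μ ℓ := fun k h1 h2 => hh ▸ (hℓ k h1 h2).2
    by_cases hs : 2 ∣ ∑ k ∈ Finset.Icc 1 n, μ k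
    · exact ⟨μ, ℓ, hl, hne, hr, hs⟩
    · refine ⟨Function.update μ n (1 - μ n), Function.update ℓ n (-ℓ n), flip_letter hl,
        flip_ne hne, fun k hk hk' => ?_, ?_⟩
      · by_cases e : k = n
        · subst e
          rw [Function.update_self, Function.update_self, ad.odd, hr k hk hk']
          ring
        · rw [Function.update_of_ne e, Function.update_of_ne e, hr k hk hk']
      · rw [IsLabelling.sum_Icc_ends hn] at hs ⊢
        rw [Function.update_self, Function.update_of_ne (by omega),
          Finset.sum_update_of_notMem (by simp)]
        omega
  -- make the number of negative labels even
  by_cases hp : ∏ k ∈ Finset.Icc 1 n, (ℓ₁ k).sign = 1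
  · exact ⟨μ₁, ℓ₁, ⟨l₁, ne₁, even₁, hp⟩, r₁⟩
  · refine ⟨Function.update μ₁ 1 (-μ₁ 1), Function.update ℓ₁ 1 (-ℓ₁ 1), ⟨flip_letter l₁,
      flip_ne ne₁, ?_, ?_⟩, fun k hk hk' => ?_⟩
    · rw [IsLabelling.sum_Icc_ends hn] at even₁ ⊢
      rw [Function.update_self, Function.update_of_ne (by omega),
        Finset.sum_update_of_notMem (by simp)]
      omega
    · have hu : IsUnit (∏ k ∈ Finset.Icc 1 n, (ℓ₁ k).sign) := by
        rw [IsUnit.prod_iff]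
        intro k hk
        rw [Finset.mem_Icc] at hk
        rw [Int.isUnit_iff]
        rcases lt_trichotomy (ℓ₁ k) 0 with h | h | h
        · exact Or.inr (Int.sign_eq_neg_one_of_neg h)
        · exact absurd h (l₁ k hk.1 hk.2).1
        · exact Or.inl (Int.sign_eq_one_of_pos h)
      have hp' := (Int.isUnit_iff.mp hu).resolve_left hp
      rw [IsLabelling.prod_Icc_ends hn] at hp' ⊢
      rw [Function.update_self, Function.update_of_ne (by omega),
        Finset.prod_congr rfl (g := fun k => (ℓ₁ k).sign) fun k hk => by
          rw [Function.update_of_ne (by rw [Finset.mem_Ioo] at hk; omega)], Int.sign_neg, neg_mul, neg_mul, hp', neg_neg]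
    · by_cases e : k = 1
      · subst e
        rw [Function.update_self, Function.update_self, ad.odd, r₁ 1 hk hk']
        push_cast
        ring
      · rw [Function.update_of_ne e, Function.update_of_ne e, r₁ k hk hk']

end HLZeta

/-! ### Windows of signed permutations -/

open Step

namespace HLZeta

variable {n : ℕ}

theorem evalSP_natCast (w : Fin n → ℤ) {k : ℕ} (hk : 1 ≤ k) (hk' : k ≤ n) :
    evalSP w k = w ⟨k - 1, by omega⟩ := by
  rw [evalSP, dif_pos ⟨by omega, by omega⟩]
  congr 2
  omega

theorem evalSP_succ (w : Fin n → ℤ) (i : Fin n) : evalSP w ((i.val + 1 : ℕ) : ℤ) = w i := by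
  rw [evalSP_natCast w (by omega) (by omega)]
  rfl

theorem evalSP_neg (w : Fin n → ℤ) (j : ℤ) : evalSP w (-j) = -evalSP w j := by
  unfold evalSP
  by_cases h : 1 ≤ j ∧ j ≤ n
  · rw [dif_pos h, dif_neg (by omega), dif_pos (by omega)]
    simp
  · rw [dif_neg h]
    by_cases h' : 1 ≤ -j ∧ -j ≤ n
    · rw [dif_pos h', dif_pos h', neg_neg]
    · rw [dif_neg h', dif_neg h', dif_neg (by omega), neg_zero]

theorem isSignedPerm_iff (w : Fin n → ℤ) : IsSignedPerm n w ↔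
    (∀ k : ℕ, 1 ≤ k → k ≤ n → IsLetter n (evalSP w k)) ∧
      ∀ i j : ℕ, 1 ≤ i → i ≤ n → 1 ≤ j → j ≤ n → i ≠ j →
        evalSP w i ≠ evalSP w j ∧ evalSP w i ≠ -evalSP w j := by
  constructor
  · rintro ⟨h1, h2⟩
    constructor
    · intro k hk hk'
      rw [evalSP_natCast w hk hk']
      have := h1 ⟨k - 1, by omega⟩
      rw [abs_le] at this
      refine ⟨?_, this.2⟩
      rintro h
      rw [h, abs_zero] at this
      omega
    · intro i j hi hi' hj hj' hij
      rw [evalSP_natCast w hi hi', evalSP_natCast w hj hj', ← not_or, ← abs_eq_abs]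
      intro h
      have := congrArg Fin.val (h2 h)
      simp only at this
      omega
  · rintro ⟨h1, h2⟩
    constructor
    · intro i
      rw [← evalSP_succ w i]
      have := h1 (i + 1) (by omega) (by omega)
      exact ⟨Int.one_le_abs this.1, abs_le.mpr this.2⟩
    · intro i j hij
      by_contra h
      have := h2 (i + 1) (j + 1) (by omega) (by omega) (by omega) (by omega) (by omega)
      rw [evalSP_succ, evalSP_succ, ← not_or, ← abs_eq_abs] at this
      exact this hij

theorem prod_sign_eq (w : Fin n → ℤ) :
    ∏ i : Fin n, (w i).sign = ∏ k ∈ Finset.Icc 1 n, (evalSP w k).sign := by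
  have h : Finset.Icc 1 n = Finset.Ico 1 (n + 1) := by
    ext k
    simp only [Finset.mem_Icc, Finset.mem_Ico]
    omega
  rw [h, Finset.prod_Ico_eq_prod_range, Nat.add_sub_cancel, Finset.prod_range]
  exact Finset.prod_congr rfl fun i _ => by rw [add_comm, evalSP_succ]

theorem window_ext {w w' : Fin n → ℤ}
    (h : ∀ k : ℕ, 1 ≤ k → k ≤ n → evalSP w k = evalSP w' k) : w = w' := by
  funext i
  rw [← evalSP_succ w i, ← evalSP_succ w' i, h _ (by omega) (by omega)]

theorem evalSP_window (f : ℕ → ℤ) {k : ℕ} (hk : 1 ≤ k) (hk' : k ≤ n) :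
    evalSP (fun i : Fin n => f (i + 1)) k = f k := by
  rw [evalSP_natCast _ hk hk']
  congr 1
  simp only
  omega

/-! ### Area vectors and labels of vertically labelled paths -/

/-- The sign by which the type `Dₙ` diagonal reading word changes the `j`-th label. -/
def mult (n : ℕ) (π : SPath) (j : ℕ) : ℤ :=
  (if j = n then (if (1 + areaD n π (n - 1) + areaD n π n) % 2 = 0 then 1 else -1) else 1) *
    (if j = 1 then
        π.sgn * (if (1 + ((n : ℤ) - 2) +
            (if (n - 1) % 4 = 0 ∨ (n - 1) % 4 = 3 then (n : ℤ) - 1 else (n : ℤ))) % 2 = 0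
          then 1 else -1)
      else 1)

/-- The signed labels of a vertically labelled path. -/
def labD (n : ℕ) (π : SPath) (v : Fin n → ℤ) (j : ℕ) : ℤ := mult n π j * evalSP v j

/-- The area vector `μ` and signed labels `ℓ` of the path with `q k` East steps before the
`k`-th North step, sign `ε` and labels `v`. -/
structure Encodes (n : ℕ) (q : ℕ → ℕ) (ε : ℤ) (v μ ℓ : ℕ → ℤ) (s d : ℤ) : Prop where
  s_eq : (s = 1 ∧ (n % 4 = 0 ∨ n % 4 = 1)) ∨ (s = -1 ∧ (n % 4 = 2 ∨ n % 4 = 3))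
  d_eq : (d = 1 ∧ (∑ k ∈ Finset.Icc 1 (n - 2), q k) % 2 = 0) ∨
    (d = -1 ∧ (∑ k ∈ Finset.Icc 1 (n - 2), q k) % 2 = 1)
  area_one : μ 1 = s * (ε * q 1)
  area_mid : ∀ k, 1 < k → k < n → μ k = q k - ((k : ℤ) - 1)
  area_last : ∃ x : ℤ, (s = 1 → μ n = x - ((n : ℤ) - 1)) ∧ (s = -1 → μ n = n - x) ∧
    (d = 1 → x = 2 * q n - q (n - 1)) ∧ (d = -1 → x = 2 * n - 1 - 2 * q n + q (n - 1))
  label_one : ℓ 1 = s * (ε * v 1)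
  label_mid : ∀ k, 1 < k → k < n → ℓ k = v k
  label_last : ℓ n = s * (d * v n)

theorem exists_encodes (hn : 2 ≤ n) {π : SPath} (hπ : π.sgn = 1 ∨ π.sgn = -1) (v : Fin n → ℤ) :
    ∃ s d, Encodes n (ebn π.path) π.sgn (fun k => evalSP v k) (areaD n π) (labD n π v) s d ∧
      d = if (lamD n π (n - 1) + lamD n π n) % 2 = 0 then 1 else -1 := by
  obtain ⟨x, hx⟩ : ∃ x, x = lamD n π n := ⟨_, rfl⟩
  obtain ⟨y, hy⟩ : ∃ y, y = lamD n π (n - 1) := ⟨_, rfl⟩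
  have hx1 : (∑ k ∈ Finset.Icc 1 (n - 2), ebn π.path k) % 2 = 0 →
      x = 2 * ebn π.path n - ebn π.path (n - 1) := by
    intro h
    rw [hx, lamD, if_neg (by omega), if_pos rfl, if_pos h]
  have hx2 : (∑ k ∈ Finset.Icc 1 (n - 2), ebn π.path k) % 2 = 1 →
      x = 2 * n - 1 - 2 * ebn π.path n + ebn π.path (n - 1) := by
    intro h
    rw [hx, lamD, if_neg (by omega), if_pos rfl, if_neg (by omega)]
  have hy1 : 2 ∣ y - ebn π.path (n - 1) := by
    rw [hy, lamD]
    by_cases h1 : n - 1 = 1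
    · rw [if_pos h1, h1]
      rcases hπ with h | h <;> rw [h] <;> omega
    · rw [if_neg h1, if_neg (by omega), sub_self]
      exact dvd_zero 2
  have hxn : areaD n π n = if (n - 1) % 4 = 0 ∨ (n - 1) % 4 = 3 then x - ((n : ℤ) - 1)
      else (n : ℤ) - x := by
    rw [areaD, if_neg (by omega), if_pos rfl, hx]
  have hyn : 2 ∣ areaD n π (n - 1) - (y - (n - 2)) := by
    rw [areaD, hy]
    split_ifs with h1 h2 h3 h3
    · rw [h1]
      omega
    · rw [h1]
      omega
    · omega
    · omega
    · push_cast [show 1 ≤ n by omega]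
      omega
  have hm1 : labD n π v 1 = (if (n - 1) % 4 = 0 ∨ (n - 1) % 4 = 3 then 1 else -1) *
      (π.sgn * evalSP v (1 : ℕ)) := by
    rw [labD, mult, if_neg (by omega), if_pos rfl]
    split_ifs with h1 h2 h2
    · ring
    · omega
    · omega
    · ring
  have hmn : labD n π v n = (if (n - 1) % 4 = 0 ∨ (n - 1) % 4 = 3 then 1 else -1) *
      ((if (y + x) % 2 = 0 then 1 else -1) * evalSP v n) := by
    rw [labD, mult, if_pos rfl, if_neg (show n ≠ 1 by omega), hxn]
    split_ifs <;> omega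
  have hd : ((if (y + x) % 2 = 0 then 1 else -1 : ℤ) = 1 ∧
      (∑ k ∈ Finset.Icc 1 (n - 2), ebn π.path k) % 2 = 0) ∨
      ((if (y + x) % 2 = 0 then 1 else -1 : ℤ) = -1 ∧
      (∑ k ∈ Finset.Icc 1 (n - 2), ebn π.path k) % 2 = 1) := by
    by_cases h : (∑ k ∈ Finset.Icc 1 (n - 2), ebn π.path k) % 2 = 0
    · have := hx1 h
      rw [if_pos (by omega)]
      exact Or.inl ⟨rfl, h⟩
    · have := hx2 (by omega)
      rw [if_neg (by omega)]
      exact Or.inr ⟨rfl, by omega⟩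
  rw [← hx, ← hy]
  refine ⟨if (n - 1) % 4 = 0 ∨ (n - 1) % 4 = 3 then 1 else -1, _,
    ⟨?_, hd, ?_, ?_, ⟨x, ?_, ?_, ?_, ?_⟩, hm1, ?_, hmn⟩, rfl⟩
  · by_cases h : (n - 1) % 4 = 0 ∨ (n - 1) % 4 = 3
    · rw [if_pos h]
      omega
    · rw [if_neg h]
      omega
  · rw [areaD, if_pos rfl, lamD, if_pos rfl]
    split_ifs <;> ring
  · intro k hk hk'
    rw [areaD, if_neg (by omega), if_neg (by omega), lamD, if_neg (by omega), if_neg (by omega)]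
  · rw [hxn]
    by_cases h : (n - 1) % 4 = 0 ∨ (n - 1) % 4 = 3
    · exact fun _ => if_pos h
    · rw [if_neg h]
      omega
  · rw [hxn]
    by_cases h : (n - 1) % 4 = 0 ∨ (n - 1) % 4 = 3
    · rw [if_pos h]
      omega
    · exact fun _ => if_neg h
  · exact fun h => hx1 (by omega)
  · exact fun h => hx2 (by omega)
  · intro k hk hk'
    rw [labD, mult, if_neg (by omega), if_neg (by omega), one_mul, one_mul]

theorem sum_sub_one_mod_two (m : ℕ) :
    (∑ k ∈ Finset.Icc 1 m, ((k : ℤ) - 1)) % 2 = if m % 4 = 0 ∨ m % 4 = 1 then 0 else 1 := by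
  suffices h : (∑ k ∈ Finset.Icc 1 m, ((k : ℤ) - 1)) % 4 =
      if m % 8 = 0 ∨ m % 8 = 1 then 0 else if m % 8 = 2 ∨ m % 8 = 7 then 1
        else if m % 8 = 4 ∨ m % 8 = 5 then 2 else 3 by
    split_ifs at h ⊢ <;> omega
  induction m with
  | zero => rfl
  | succ m ih =>
    rw [Finset.sum_Icc_succ_top (by omega)]
    push_cast
    split_ifs at ih ⊢ <;> omega

theorem two_dvd_sum_iff (hn : 2 ≤ n) {q : ℕ → ℕ} {μ : ℕ → ℤ}
    (h : ∀ k, 1 ≤ k → k < n → 2 ∣ μ k - (q k - ((k : ℤ) - 1))) :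
    2 ∣ ∑ k ∈ Finset.Icc 1 n, μ k ↔
      2 ∣ ((∑ k ∈ Finset.Icc 1 (n - 2), q k : ℕ) : ℤ) + q (n - 1) + μ n +
        (if n % 4 = 0 ∨ n % 4 = 3 then 1 else 0) := by
  obtain ⟨m, rfl⟩ : ∃ m, n = m + 1 + 1 := ⟨n - 2, by omega⟩
  rw [Finset.sum_Icc_succ_top (by omega), Finset.sum_Icc_succ_top (by omega)]
  have h1 : 2 ∣ ∑ k ∈ Finset.Icc 1 m, (μ k - (q k - ((k : ℤ) - 1))) := by
    refine Finset.dvd_sum fun k hk => ?_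
    rw [Finset.mem_Icc] at hk
    exact h k (by omega) (by omega)
  rw [Finset.sum_sub_distrib, Finset.sum_sub_distrib] at h1
  have h2 := sum_sub_one_mod_two m
  have h3 := h (m + 1) (by omega) (by omega)
  rw [show m + 1 + 1 - 2 = m by omega, show m + 1 + 1 - 1 = m + 1 by omega]
  push_cast at h3 ⊢
  generalize ∑ k ∈ Finset.Icc 1 m, ((k : ℤ) - 1) = a at *
  generalize ∑ k ∈ Finset.Icc 1 m, (q k : ℤ) = b at *
  generalize ∑ k ∈ Finset.Icc 1 m, μ k = c at *
  generalize μ (m + 1 + 1) = d at *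
  clear h
  split_ifs at h2 ⊢ <;> omega

end HLZeta

/-! ### Vertically labelled paths and labelled area vectors -/

open Step

namespace HLZeta

/-- The conditions on a vertically labelled path, expressed by the numbers `q k` of East steps
preceding the North steps, the sign `ε` and the labels `v`. -/
structure IsVert (n : ℕ) (q : ℕ → ℕ) (ε : ℤ) (v : ℕ → ℤ) (d : ℤ) : Prop where
  sgn : ε = 1 ∨ ε = -1
  sgn_zero : q 1 = 0 → ε = 1
  mono : ∀ k, 1 ≤ k → k < n → q k ≤ q (k + 1)
  last_le : q n ≤ n - 1
  letter : ∀ k, 1 ≤ k → k ≤ n → IsLetter n (v k)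
  ne : ∀ i j, 1 ≤ i → i ≤ n → 1 ≤ j → j ≤ n → i ≠ j → v i ≠ v j ∧ v i ≠ -v j
  rise : ∀ k, 1 ≤ k → k < n → q k = q (k + 1) → v k < v (k + 1)
  start : q 2 = 0 → |v 1| < v 2
  sign : ∏ k ∈ Finset.Icc 1 n, (v k).sign = ε * d

namespace Encodes

variable {n : ℕ} {q : ℕ → ℕ} {ε : ℤ} {v μ ℓ : ℕ → ℤ} {s d : ℤ}

theorem label_eq_or (C : Encodes n q ε v μ ℓ s d) (hε : ε = 1 ∨ ε = -1) {k : ℕ} (hk : 1 ≤ k)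
    (hk' : k ≤ n) : ℓ k = v k ∨ ℓ k = -v k := by
  by_cases h1 : k = 1
  · rw [h1, C.label_one]
    rcases C.s_eq with ⟨rfl, -⟩ | ⟨rfl, -⟩ <;> rcases hε with rfl | rfl <;> omega
  by_cases h2 : k = n
  · rw [h2, C.label_last]
    rcases C.s_eq with ⟨rfl, -⟩ | ⟨rfl, -⟩ <;> rcases C.d_eq with ⟨rfl, -⟩ | ⟨rfl, -⟩ <;> omega
  exact Or.inl (C.label_mid k (by omega) (by omega))

theorem letter_ne_iff (C : Encodes n q ε v μ ℓ s d) (hε : ε = 1 ∨ ε = -1) :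
    ((∀ k, 1 ≤ k → k ≤ n → IsLetter n (ℓ k)) ∧
      ∀ i j, 1 ≤ i → i ≤ n → 1 ≤ j → j ≤ n → i ≠ j → ℓ i ≠ ℓ j ∧ ℓ i ≠ -ℓ j) ↔
    ((∀ k, 1 ≤ k → k ≤ n → IsLetter n (v k)) ∧
      ∀ i j, 1 ≤ i → i ≤ n → 1 ≤ j → j ≤ n → i ≠ j → v i ≠ v j ∧ v i ≠ -v j) := by
  refine and_congr (forall_congr' fun k => forall_congr' fun hk => forall_congr' fun hk' => ?_)
    (forall_congr' fun i => forall_congr' fun j => forall_congr' fun hi => forall_congr' fun hi' =>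
      forall_congr' fun hj => forall_congr' fun hj' => forall_congr' fun _ => ?_)
  · rcases C.label_eq_or hε hk hk' with h | h <;> rw [h]
    exact ⟨fun h => by simpa using h.neg, fun h => h.neg⟩
  · rcases C.label_eq_or hε hi hi' with h | h <;> rcases C.label_eq_or hε hj hj' with h' | h' <;>
      rw [h, h'] <;> omega

theorem prod_sign (C : Encodes n q ε v μ ℓ s d) (hn : 2 ≤ n) (hε : ε = 1 ∨ ε = -1) :
    ∏ k ∈ Finset.Icc 1 n, (ℓ k).sign = ε * d * ∏ k ∈ Finset.Icc 1 n, (v k).sign := by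
  rw [IsLabelling.prod_Icc_ends hn, IsLabelling.prod_Icc_ends hn, C.label_one, C.label_last,
    Finset.prod_congr rfl (g := fun k => (v k).sign) fun k hk => by
      rw [Finset.mem_Ioo] at hk
      rw [C.label_mid k hk.1 hk.2]]
  rcases C.s_eq with ⟨rfl, -⟩ | ⟨rfl, -⟩ <;> rcases C.d_eq with ⟨rfl, -⟩ | ⟨rfl, -⟩ <;>
    rcases hε with rfl | rfl <;>
    simp only [one_mul, neg_neg, Int.sign_neg, mul_neg, neg_mul]

theorem two_dvd (C : Encodes n q ε v μ ℓ s d) (hε : ε = 1 ∨ ε = -1) (k : ℕ)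
    (hk : 1 ≤ k) (hk' : k < n) : 2 ∣ μ k - (q k - ((k : ℤ) - 1)) := by
  by_cases h1 : k = 1
  · rw [h1, C.area_one]
    rcases C.s_eq with ⟨rfl, -⟩ | ⟨rfl, -⟩ <;> rcases hε with rfl | rfl <;> omega
  · rw [C.area_mid k (by omega) hk', sub_self]
    exact dvd_zero 2

theorem isLabelling (C : Encodes n q ε v μ ℓ s d) (V : IsVert n q ε v d) (hn : 2 ≤ n) :
    IsLabelling n μ ℓ := by
  obtain ⟨h1, h2⟩ := (C.letter_ne_iff V.sgn).2 ⟨V.letter, V.ne⟩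
  refine ⟨h1, h2, ?_, ?_⟩
  · rw [two_dvd_sum_iff hn (C.two_dvd V.sgn)]
    obtain ⟨x, x1, x2, x3, x4⟩ := C.area_last
    rcases C.s_eq with ⟨rfl, _⟩ | ⟨rfl, _⟩ <;> rcases C.d_eq with ⟨rfl, _⟩ | ⟨rfl, _⟩ <;>
      split_ifs <;> omega
  · rw [C.prod_sign hn V.sgn, V.sign]
    rcases V.sgn with rfl | rfl <;> rcases C.d_eq with ⟨rfl, -⟩ | ⟨rfl, -⟩ <;> rfl

theorem isShi (C : Encodes n q ε v μ ℓ s d) (V : IsVert n q ε v d) (hn : 2 ≤ n) :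
    IsShi n μ ℓ := by
  have mid : ∀ k, 1 < k → k + 1 < n → μ k - μ (k + 1) ≤ 1 ∧
      (μ k - μ (k + 1) = 1 → ℓ k < ℓ (k + 1)) := by
    intro k hk hk'
    have := V.mono k (by omega) (by omega)
    have := V.rise k (by omega) (by omega)
    rw [C.area_mid k hk (by omega), C.area_mid (k + 1) (by omega) hk',
      C.label_mid k hk (by omega), C.label_mid (k + 1) (by omega) hk']
    omega
  obtain ⟨x, x1, x2, x3, x4⟩ := C.area_last
  have a1 := C.area_one
  have l1 := C.label_one
  have ln := C.label_last
  have hsgn := V.sgn_zero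
  have hst := V.start
  have hle := V.last_le
  have m1 := V.mono 1 le_rfl (by omega)
  have r1 := V.rise 1 le_rfl (by omega)
  rw [abs_lt] at hst
  by_cases h2 : n = 2
  · subst h2
    simp only [Nat.reduceAdd, Nat.reduceSub, Nat.cast_ofNat] at *
    have hd : d = 1 := by
      rcases C.d_eq with h | h
      · exact h.1
      · simp at h
    have hs : s = -1 := by
      have := C.s_eq
      omega
    subst hd hs
    rcases V.sgn with rfl | rfl
    all_goals
      refine ⟨fun k hk hk' => ?_, ?_, ?_, ?_⟩
      · obtain rfl : k = 1 := by omega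
        simp only [Nat.reduceAdd]
        omega
      all_goals
        try simp only [Nat.reduceSub]
        omega
  · have m2 := V.mono (n - 1) (by omega) (by omega)
    have r2 := V.rise (n - 1) (by omega) (by omega)
    have a2 := C.area_mid 2 (by omega) (by omega)
    have a3 := C.area_mid (n - 1) (by omega) (by omega)
    have l2 := C.label_mid 2 (by omega) (by omega)
    have l3 := C.label_mid (n - 1) (by omega) (by omega)
    rw [show n - 1 + 1 = n by omega] at m2 r2
    push_cast [show 1 ≤ n by omega] at a3 hle
    simp only [Nat.reduceAdd, Nat.cast_ofNat] at *
    have first : (μ 1 - μ 2 ≤ 1 ∧ (μ 1 - μ 2 = 1 → ℓ 1 < ℓ 2)) ∧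
        -(μ 1 + μ 2) ≤ 1 ∧ (-(μ 1 + μ 2) = 1 → -ℓ 1 < ℓ 2) := by
      clear m2 r2 a3 l3 ln hle x1 x2 x3 x4
      have hs : s * ε = 1 ∨ s * ε = -1 := by
        rcases C.s_eq with ⟨rfl, _⟩ | ⟨rfl, _⟩ <;> rcases V.sgn with rfl | rfl <;> omega
      rw [← mul_assoc] at a1 l1
      by_cases hq : q 2 = 0
      · have hv := hst hq
        clear hst r1 hsgn
        rcases hs with h | h <;> rw [h] at a1 l1 <;> clear h <;>
          refine ⟨⟨by omega, fun _ => by omega⟩, by omega, fun _ => by omega⟩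
      · clear hst hsgn
        rcases hs with h | h <;> rw [h] at a1 l1 <;> clear h <;>
          refine ⟨⟨by omega, fun _ => by omega⟩, by omega, fun _ => by omega⟩
    have last : (μ (n - 1) - μ n ≤ 1 ∧ (μ (n - 1) - μ n = 1 → ℓ (n - 1) < ℓ n)) ∧
        μ (n - 1) + μ n ≤ 2 ∧ (μ (n - 1) + μ n = 2 → ℓ (n - 1) < -ℓ n) := by
      clear m1 r1 a2 l2 a1 l1 hst hsgn first
      rcases C.s_eq with ⟨rfl, _⟩ | ⟨rfl, _⟩ <;> rcases C.d_eq with ⟨rfl, _⟩ | ⟨rfl, _⟩ <;> omega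
    refine ⟨fun k hk hk' => ?_, first.2, last.2, fun h => absurd h h2⟩
    by_cases e1 : k = 1
    · subst e1
      exact first.1
    by_cases e2 : k = n - 1
    · rw [e2, show n - 1 + 1 = n by omega]
      exact last.1
    exact mid k (by omega) (by omega)

end Encodes

end HLZeta

/-! ### Recovering the vertically labelled path -/

open Step

namespace HLZeta

namespace Encodes

variable {n : ℕ} {q q' : ℕ → ℕ} {ε ε' : ℤ} {v v' μ μ' ℓ ℓ' : ℕ → ℤ} {s s' d d' : ℤ}

theorem eq_of_eq (C : Encodes n q ε v μ ℓ s d) (C' : Encodes n q' ε' v' μ' ℓ' s' d') (hn : 2 ≤ n)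
    (hμ : ∀ k, 1 ≤ k → k ≤ n → μ k = μ' k) (hℓ : ∀ k, 1 ≤ k → k ≤ n → ℓ k = ℓ' k)
    (hε : ε = 1 ∨ ε = -1) (hε' : ε' = 1 ∨ ε' = -1)
    (hq : q 1 = 0 → ε = 1) (hq' : q' 1 = 0 → ε' = 1) :
    ε = ε' ∧ ∀ k, 1 ≤ k → k ≤ n → q k = q' k ∧ v k = v' k := by
  have hs : s = s' := by
    have := C.s_eq
    have := C'.s_eq
    omega
  subst hs
  have q1 : q 1 = q' 1 ∧ ε = ε' := by
    have := C.area_one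
    rw [hμ 1 le_rfl (by omega), C'.area_one] at this
    rcases C.s_eq with ⟨rfl, -⟩ | ⟨rfl, -⟩ <;> rcases hε with rfl | rfl <;>
      rcases hε' with rfl | rfl <;> omega
  have qk : ∀ k, 1 ≤ k → k < n → q k = q' k := by
    intro k hk hk'
    by_cases h : k = 1
    · exact h ▸ q1.1
    · have := C.area_mid k (by omega) hk'
      rw [hμ k hk (by omega), C'.area_mid k (by omega) hk'] at this
      omega
  have hd : d = d' := by
    have h1 := C.d_eq
    have h2 := C'.d_eq
    have h3 : ∑ k ∈ Finset.Icc 1 (n - 2), q k = ∑ k ∈ Finset.Icc 1 (n - 2), q' k :=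
      Finset.sum_congr rfl fun k hk => by
        rw [Finset.mem_Icc] at hk
        exact qk k (by omega) (by omega)
    rw [h3] at h1
    omega
  subst hd
  obtain ⟨rfl⟩ := q1.2
  have qn : q n = q' n := by
    obtain ⟨x, x1, x2, x3, x4⟩ := C.area_last
    obtain ⟨y, y1, y2, y3, y4⟩ := C'.area_last
    have := qk (n - 1) (by omega) (by omega)
    have := hμ n (by omega) le_rfl
    rcases C.s_eq with ⟨rfl, -⟩ | ⟨rfl, -⟩ <;> rcases C.d_eq with ⟨rfl, -⟩ | ⟨rfl, -⟩ <;> omega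
  refine ⟨rfl, fun k hk hk' => ?_⟩
  by_cases h1 : k = 1
  · subst h1
    refine ⟨q1.1, ?_⟩
    have := C.label_one
    rw [hℓ 1 le_rfl (by omega), C'.label_one] at this
    rcases C.s_eq with ⟨rfl, -⟩ | ⟨rfl, -⟩ <;> rcases hε with rfl | rfl <;> omega
  by_cases h2 : k = n
  · subst h2
    refine ⟨qn, ?_⟩
    have := C.label_last
    rw [hℓ k hk le_rfl, C'.label_last] at this
    rcases C.s_eq with ⟨rfl, -⟩ | ⟨rfl, -⟩ <;> rcases C.d_eq with ⟨rfl, -⟩ | ⟨rfl, -⟩ <;> omega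
  · refine ⟨qk k hk (by omega), ?_⟩
    have := C.label_mid k (by omega) (by omega)
    rw [hℓ k hk hk', C'.label_mid k (by omega) (by omega)] at this
    exact this.symm

theorem area_label_eq (C : Encodes n q ε v μ ℓ s d) (C' : Encodes n q' ε v' μ' ℓ' s' d')
    (hn : 2 ≤ n) (hq : ∀ k, 1 ≤ k → k ≤ n → q k = q' k) (hv : ∀ k, 1 ≤ k → k ≤ n → v k = v' k)
    {k : ℕ} (hk : 1 ≤ k) (hk' : k ≤ n) : μ k = μ' k ∧ ℓ k = ℓ' k := by
  have hs : s = s' := by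
    have := C.s_eq
    have := C'.s_eq
    omega
  have hd : d = d' := by
    have h1 := C.d_eq
    have h2 := C'.d_eq
    have h3 : ∑ k ∈ Finset.Icc 1 (n - 2), q k = ∑ k ∈ Finset.Icc 1 (n - 2), q' k :=
      Finset.sum_congr rfl fun k hk => by
        rw [Finset.mem_Icc] at hk
        exact hq k (by omega) (by omega)
    rw [h3] at h1
    omega
  subst hs hd
  by_cases h1 : k = 1
  · subst h1
    rw [C.area_one, C'.area_one, C.label_one, C'.label_one, hq 1 hk hk', hv 1 hk hk']
    exact ⟨rfl, rfl⟩
  by_cases h2 : k = n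
  · subst h2
    rw [C.label_last, C'.label_last, hv k hk le_rfl]
    refine ⟨?_, rfl⟩
    obtain ⟨x, x1, x2, x3, x4⟩ := C.area_last
    obtain ⟨y, y1, y2, y3, y4⟩ := C'.area_last
    have := hq (k - 1) (by omega) (by omega)
    have := hq k hk le_rfl
    rcases C.s_eq with ⟨rfl, -⟩ | ⟨rfl, -⟩ <;> rcases C.d_eq with ⟨rfl, -⟩ | ⟨rfl, -⟩ <;> omega
  · rw [C.area_mid k (by omega) (by omega), C'.area_mid k (by omega) (by omega),
      C.label_mid k (by omega) (by omega), C'.label_mid k (by omega) (by omega), hq k hk hk',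
      hv k hk hk']
    exact ⟨rfl, rfl⟩

theorem isVert (C : Encodes n q ε v μ ℓ s d) (L : IsLabelling n μ ℓ) (S : IsShi n μ ℓ)
    (hn : 2 ≤ n) (hε : ε = 1 ∨ ε = -1) (hq : q 1 = 0 → ε = 1) : IsVert n q ε v d := by
  obtain ⟨c1, c2⟩ := (C.letter_ne_iff hε).1 ⟨L.letter, L.ne⟩
  have mid : ∀ k, 1 < k → k + 1 < n → q k ≤ q (k + 1) ∧ (q k = q (k + 1) → v k < v (k + 1)) := by
    intro k hk hk'
    have := S.step k (by omega) (by omega)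
    rw [C.area_mid k hk (by omega), C.area_mid (k + 1) (by omega) hk',
      C.label_mid k hk (by omega), C.label_mid (k + 1) (by omega) hk'] at this
    omega
  obtain ⟨first, last, start⟩ : (q 1 ≤ q 2 ∧ (q 1 = q 2 → v 1 < v 2)) ∧
      ((q (n - 1) ≤ q n ∧ (q (n - 1) = q n → v (n - 1) < v n)) ∧ q n ≤ n - 1) ∧
      (q 2 = 0 → |v 1| < v 2) := by
    obtain ⟨x, x1, x2, x3, x4⟩ := C.area_last
    have a1 := C.area_one
    have l1 := C.label_one
    have ln := C.label_last
    have s1 := S.step 1 le_rfl (by omega)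
    have s2 := S.low
    have s3 := S.top
    rw [abs_lt]
    simp only [Nat.reduceAdd] at *
    by_cases h2 : n = 2
    · subst h2
      have s4 := S.two rfl
      simp only [Nat.reduceSub, Nat.cast_ofNat] at *
      have hd : d = 1 := by
        rcases C.d_eq with h | h
        · exact h.1
        · simp at h
      have hs : s = -1 := by
        have := C.s_eq
        omega
      subst hd hs
      clear mid c1 c2
      rcases hε with rfl | rfl
      all_goals
        refine ⟨⟨by omega, fun _ => by omega⟩, ⟨⟨by omega, fun _ => by omega⟩, by omega⟩,
          fun _ => ⟨by omega, by omega⟩⟩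
    · have a2 := C.area_mid 2 (by omega) (by omega)
      have a3 := C.area_mid (n - 1) (by omega) (by omega)
      have l2 := C.label_mid 2 (by omega) (by omega)
      have l3 := C.label_mid (n - 1) (by omega) (by omega)
      have s4 := S.step (n - 1) (by omega) (by omega)
      rw [show n - 1 + 1 = n by omega] at s4
      push_cast [show 1 ≤ n by omega] at a3
      simp only [Nat.cast_ofNat] at a2
      clear mid c1 c2
      rw [← and_assoc, and_right_comm, and_comm]
      constructor
      · clear a1 l1 a2 l2 s1 s2 hq
        rcases C.s_eq with ⟨rfl, _⟩ | ⟨rfl, _⟩ <;> rcases C.d_eq with ⟨rfl, _⟩ | ⟨rfl, _⟩ <;>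
          refine ⟨⟨by omega, fun _ => by omega⟩, by omega⟩
      · clear x1 x2 x3 x4 a3 l3 s3 s4 ln
        have hs : s * ε = 1 ∨ s * ε = -1 := by
          rcases C.s_eq with ⟨rfl, _⟩ | ⟨rfl, _⟩ <;> rcases hε with rfl | rfl <;> omega
        rw [← mul_assoc] at a1 l1
        rcases hs with h | h <;> rw [h] at a1 l1 <;> clear h hq <;>
          refine ⟨⟨by omega, fun _ => by omega⟩, fun _ => ⟨by omega, by omega⟩⟩
  have step : ∀ k, 1 ≤ k → k < n → q k ≤ q (k + 1) ∧ (q k = q (k + 1) → v k < v (k + 1)) := by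
    intro k hk hk'
    by_cases e1 : k = 1
    · subst e1
      exact first
    by_cases e2 : k = n - 1
    · rw [e2, show n - 1 + 1 = n by omega]
      exact last.1
    exact mid k (by omega) (by omega)
  refine ⟨hε, hq, fun k hk hk' => (step k hk hk').1, last.2, c1, c2,
    fun k hk hk' => (step k hk hk').2, start, ?_⟩
  have := L.sign
  rw [C.prod_sign hn hε] at this
  rcases hε with rfl | rfl <;> rcases C.d_eq with ⟨rfl, -⟩ | ⟨rfl, -⟩ <;> omega

end Encodes

theorem IsLabelling.exists_encodes {n : ℕ} {μ ℓ : ℕ → ℤ} (L : IsLabelling n μ ℓ)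
    (S : IsShi n μ ℓ) (hn : 2 ≤ n) :
    ∃ q ε v s d, Encodes n q ε v μ ℓ s d ∧ (ε = 1 ∨ ε = -1) ∧ (q 1 = 0 → ε = 1) := by
  obtain ⟨s, hs⟩ : ∃ s : ℤ, (s = 1 ∧ (n % 4 = 0 ∨ n % 4 = 1)) ∨
      (s = -1 ∧ (n % 4 = 2 ∨ n % 4 = 3)) := by
    by_cases h : n % 4 = 0 ∨ n % 4 = 1
    · exact ⟨1, Or.inl ⟨rfl, h⟩⟩
    · exact ⟨-1, Or.inr ⟨rfl, by omega⟩⟩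
  obtain ⟨ε, r, hr, hε, hr0⟩ : ∃ (ε : ℤ) (r : ℕ), μ 1 = s * (ε * r) ∧ (ε = 1 ∨ ε = -1) ∧
      (r = 0 → ε = 1) := by
    by_cases h : 0 ≤ s * μ 1
    · exact ⟨1, (μ 1).natAbs, by rcases hs with ⟨rfl, -⟩ | ⟨rfl, -⟩ <;> omega, Or.inl rfl,
        fun _ => rfl⟩
    · exact ⟨-1, (μ 1).natAbs, by rcases hs with ⟨rfl, -⟩ | ⟨rfl, -⟩ <;> omega, Or.inr rfl,
        by rcases hs with ⟨rfl, -⟩ | ⟨rfl, -⟩ <;> omega⟩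
  have nonneg : ∀ k, 2 ≤ k → k < n → (r : ℤ) ≤ μ k + (k - 1) := by
    intro k hk
    induction k, hk using Nat.le_induction with
    | base =>
      intro h
      have h1 := S.step 1 le_rfl (by omega)
      have h2 := S.low
      simp only [Nat.reduceAdd] at h1
      rcases hs with ⟨rfl, -⟩ | ⟨rfl, -⟩ <;> rcases hε with rfl | rfl <;> omega
    | succ k hk ih =>
      intro h
      have := ih (by omega)
      have := S.step k (by omega) (by omega)
      push_cast
      omega
  -- the numbers of East steps before all but the last North step
  obtain ⟨p, p1, pk⟩ : ∃ p : ℕ → ℕ, p 1 = r ∧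
      ∀ k, 1 < k → k < n → μ k = p k - ((k : ℤ) - 1) := by
    refine ⟨fun k => if k = 1 then r else (μ k + (k - 1)).toNat, if_pos rfl, fun k hk hk' => ?_⟩
    have := nonneg k (by omega) hk'
    simp only [if_neg (show k ≠ 1 by omega)]
    omega
  obtain ⟨d, hd⟩ : ∃ d : ℤ, (d = 1 ∧ (∑ k ∈ Finset.Icc 1 (n - 2), p k) % 2 = 0) ∨
      (d = -1 ∧ (∑ k ∈ Finset.Icc 1 (n - 2), p k) % 2 = 1) := by
    by_cases h : (∑ k ∈ Finset.Icc 1 (n - 2), p k) % 2 = 0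
    · exact ⟨1, Or.inl ⟨rfl, h⟩⟩
    · exact ⟨-1, Or.inr ⟨rfl, by omega⟩⟩
  have hμ : ∀ k, 1 ≤ k → k < n → 2 ∣ μ k - (p k - ((k : ℤ) - 1)) := by
    intro k hk hk'
    by_cases h1 : k = 1
    · rw [h1, hr, p1]
      rcases hs with ⟨rfl, -⟩ | ⟨rfl, -⟩ <;> rcases hε with rfl | rfl <;> omega
    · rw [pk k (by omega) hk', sub_self]
      exact dvd_zero 2
  have hsum := (two_dvd_sum_iff hn hμ).1 L.even
  obtain ⟨x, t, x1, x2, x3, x4⟩ : ∃ (x : ℤ) (t : ℕ), (s = 1 → μ n = x - ((n : ℤ) - 1)) ∧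
      (s = -1 → μ n = n - x) ∧ (d = 1 → x = 2 * t - p (n - 1)) ∧
      (d = -1 → x = 2 * n - 1 - 2 * t + p (n - 1)) := by
    have s1 := S.step (n - 1) (by omega) (by omega)
    have s2 := S.top
    rw [show n - 1 + 1 = n by omega] at s1
    have hp : (μ (n - 1) = p (n - 1) - ((n : ℤ) - 2)) ∨
        n = 2 ∧ (μ (n - 1) = p (n - 1) ∨ μ (n - 1) = -p (n - 1)) := by
      by_cases h2 : n = 2
      · subst h2
        rw [show 2 - 1 = 1 from rfl, hr, p1]
        rcases hs with ⟨rfl, -⟩ | ⟨rfl, -⟩ <;> rcases hε with rfl | rfl <;> omega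
      · left
        rw [pk (n - 1) (by omega) (by omega)]
        omega
    have s3 : n = 2 → d = 1 := by
      rintro rfl
      simpa using hd
    obtain ⟨x, x1, x2⟩ : ∃ x : ℤ, (s = 1 → μ n = x - ((n : ℤ) - 1)) ∧ (s = -1 → μ n = n - x) := by
      rcases hs with ⟨rfl, -⟩ | ⟨rfl, -⟩
      · exact ⟨μ n + (n - 1), by omega⟩
      · exact ⟨n - μ n, by omega⟩
    have s4 := S.two
    have bound : p (n - 1) ≤ x ∧ (d = -1 → x + p (n - 1) ≤ 2 * n - 1) := by
      rcases hp with hp | ⟨rfl, hp⟩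
      · rcases hs with ⟨rfl, -⟩ | ⟨rfl, -⟩ <;> omega
      · have s5 := (s4 rfl).1
        have s6 := s3 rfl
        have s7 := s2.1
        have hs' : s = -1 := by omega
        have x3 := x2 hs'
        clear s1 s2 s3 s4 x1 x2 hs hsum nonneg
        simp only [Nat.reduceSub] at *
        omega
    have parity : 2 ∣ ((∑ k ∈ Finset.Icc 1 (n - 2), p k : ℕ) : ℤ) + p (n - 1) + x := by
      rcases hs with ⟨rfl, _⟩ | ⟨rfl, _⟩ <;> split_ifs at hsum <;> omega
    clear hsum hp s1 s2 s3 s4 hs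
    rcases hd with ⟨rfl, hd⟩ | ⟨rfl, hd⟩
    · exact ⟨x, ((x + p (n - 1)) / 2).toNat, x1, x2, fun _ => by omega, fun h => by omega⟩
    · exact ⟨x, ((2 * n - 1 - x + p (n - 1)) / 2).toNat, x1, x2, fun h => by omega,
        fun _ => by omega⟩
  refine ⟨fun k => if k = n then t else p k, ε, fun k => if k = 1 then s * (ε * ℓ 1)
    else if k = n then s * (d * ℓ n) else ℓ k, s, d, ⟨hs, ?_, ?_, ?_, ⟨x, x1, x2, ?_, ?_⟩,
      ?_, ?_, ?_⟩, hε, ?_⟩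
  · rw [Finset.sum_congr rfl fun k hk => if_neg (by rw [Finset.mem_Icc] at hk; omega)]
    exact hd
  · rw [if_neg (by omega), p1, hr]
  · intro k hk hk'
    rw [if_neg (by omega), pk k hk hk']
  · rwa [if_pos rfl, if_neg (by omega)]
  · rwa [if_pos rfl, if_neg (by omega)]
  · rw [if_pos rfl]
    rcases hs with ⟨rfl, -⟩ | ⟨rfl, -⟩ <;> rcases hε with rfl | rfl <;> omega
  · intro k hk hk'
    rw [if_neg (by omega), if_neg (by omega)]
  · rw [if_neg (by omega), if_pos rfl]
    rcases hs with ⟨rfl, -⟩ | ⟨rfl, -⟩ <;> rcases hd with ⟨rfl, -⟩ | ⟨rfl, -⟩ <;> omega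
  · simpa only [if_neg (show 1 ≠ n by omega), p1] using hr0

end HLZeta

/-! ### Vertically labelled paths -/

open Step

namespace HLZeta

variable {n : ℕ}

theorem IsLabelling.congr {μ ℓ μ' ℓ' : ℕ → ℤ} (L : IsLabelling n μ ℓ)
    (h : ∀ k, 1 ≤ k → k ≤ n → μ' k = μ k ∧ ℓ' k = ℓ k) : IsLabelling n μ' ℓ' := by
  refine ⟨fun k h1 h2 => (h k h1 h2).2 ▸ L.letter k h1 h2, fun i j h1 h2 h3 h4 => ?_, ?_, ?_⟩
  · rw [(h i h1 h2).2, (h j h3 h4).2]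
    exact L.ne i j h1 h2 h3 h4
  · rw [Finset.sum_congr rfl fun k hk => (h k (Finset.mem_Icc.1 hk).1 (Finset.mem_Icc.1 hk).2).1]
    exact L.even
  · rw [Finset.prod_congr rfl fun k hk => congrArg Int.sign
      (h k (Finset.mem_Icc.1 hk).1 (Finset.mem_Icc.1 hk).2).2]
    exact L.sign

theorem IsShi.congr {μ ℓ μ' ℓ' : ℕ → ℤ} (S : IsShi n μ ℓ) (hn : 2 ≤ n)
    (h : ∀ k, 1 ≤ k → k ≤ n → μ' k = μ k ∧ ℓ' k = ℓ k) : IsShi n μ' ℓ' := by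
  obtain ⟨h1, h1'⟩ := h 1 le_rfl (by omega)
  obtain ⟨h2, h2'⟩ := h 2 (by omega) hn
  obtain ⟨h3, h3'⟩ := h (n - 1) (by omega) (by omega)
  obtain ⟨h4, h4'⟩ := h n (by omega) le_rfl
  refine ⟨fun k hk hk' => ?_, ?_, ?_, ?_⟩
  · obtain ⟨h5, h5'⟩ := h k hk (by omega)
    obtain ⟨h6, h6'⟩ := h (k + 1) (by omega) (by omega)
    rw [h5, h5', h6, h6']
    exact S.step k hk hk'
  · rw [h1, h1', h2, h2']
    exact S.low
  · rw [h3, h3', h4, h4']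
    exact S.top
  · rw [h1, h1', h2, h2']
    exact S.two

theorem IsVert.mono_le {q : ℕ → ℕ} {ε : ℤ} {v : ℕ → ℤ} {d : ℤ} (V : IsVert n q ε v d) (i j : ℕ)
    (hi : 1 ≤ i) (hij : i ≤ j) (hj : j ≤ n) : q i ≤ q j := by
  induction j, hij using Nat.le_induction with
  | base => exact le_rfl
  | succ j hij ih => exact (ih (by omega)).trans (V.mono j (by omega) (by omega))

theorem mem_vertD_iff (hn : 2 ≤ n) {π : SPath} {v : Fin n → ℤ} :
    (π, v) ∈ VertD n ↔ IsLatticePath (n - 1) n π.path ∧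
      IsVert n (ebn π.path) π.sgn (fun k => evalSP v k)
        (if (lamD n π (n - 1) + lamD n π n) % 2 = 0 then 1 else -1) := by
  constructor
  · rintro ⟨⟨hp, hs, hs'⟩, hv, hr, hst, hsign⟩
    obtain ⟨v1, v2⟩ := (isSignedPerm_iff v).1 hv
    have hN := hp.2
    refine ⟨hp, hs, fun h => hs' ((head?_eq_N_iff (by omega)).2 h),
      fun k _ _ => ebn_mono _ (Nat.le_succ k), hp.1 ▸ ebn_le_count _ _, v1, v2,
      fun k hk hk' h => ?_, fun h => ?_, ?_⟩
    · exact_mod_cast hr k ((isRise_iff _).2 ⟨hk, by omega, h⟩)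
    · exact_mod_cast hst ((take_two_eq_iff (by omega)).2 h)
    · rw [← prod_sign_eq]
      exact hsign
  · rintro ⟨hp, V⟩
    have hN := hp.2
    refine ⟨⟨hp, V.sgn, fun h => V.sgn_zero ((head?_eq_N_iff (by omega)).1 h)⟩,
      (isSignedPerm_iff v).2 ⟨V.letter, V.ne⟩, fun i hi => ?_, fun h => ?_, ?_⟩
    · obtain ⟨h1, h2, h3⟩ := (isRise_iff _).1 hi
      exact_mod_cast V.rise i h1 (Nat.lt_of_succ_le (hN ▸ h2)) h3
    · exact_mod_cast V.start ((take_two_eq_iff (by omega)).1 h)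
    · rw [prod_sign_eq]
      exact V.sign

theorem exists_encodes_of_mem_vertD (hn : 2 ≤ n) {π : SPath} {v : Fin n → ℤ}
    (h : (π, v) ∈ VertD n) : ∃ s d, Encodes n (ebn π.path) π.sgn (fun k => evalSP v k)
      (areaD n π) (labD n π v) s d ∧ IsVert n (ebn π.path) π.sgn (fun k => evalSP v k) d := by
  obtain ⟨-, V⟩ := (mem_vertD_iff hn).1 h
  obtain ⟨s, d, C, rfl⟩ := exists_encodes hn V.sgn v
  exact ⟨s, _, C, V⟩

theorem vertD_ext (hn : 2 ≤ n) {π π' : SPath} {v v' : Fin n → ℤ}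
    (h : (π, v) ∈ VertD n) (h' : (π', v') ∈ VertD n)
    (hμ : ∀ k, 1 ≤ k → k ≤ n → areaD n π k = areaD n π' k)
    (hℓ : ∀ k, 1 ≤ k → k ≤ n → labD n π v k = labD n π' v' k) : (π, v) = (π', v') := by
  obtain ⟨s, d, C, V⟩ := exists_encodes_of_mem_vertD hn h
  obtain ⟨s', d', C', V'⟩ := exists_encodes_of_mem_vertD hn h'
  obtain ⟨hε, hk⟩ := C.eq_of_eq C' hn hμ hℓ V.sgn V'.sgn V.sgn_zero V'.sgn_zero
  have hp := latticePath_ext ((mem_vertD_iff hn).1 h).1 ((mem_vertD_iff hn).1 h').1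
    fun k h1 h2 => (hk k h1 h2).1
  have hv : v = v' := window_ext fun k h1 h2 => (hk k h1 h2).2
  rcases π with ⟨p, e⟩
  rcases π' with ⟨p', e'⟩
  simp only at hp hε
  rw [hp, hε, hv]

theorem exists_mem_vertD (hn : 2 ≤ n) {μ ℓ : ℕ → ℤ} (L : IsLabelling n μ ℓ) (S : IsShi n μ ℓ) :
    ∃ π v, (π, v) ∈ VertD n ∧ ∀ k, 1 ≤ k → k ≤ n → areaD n π k = μ k ∧ labD n π v k = ℓ k := by
  obtain ⟨q, ε, v, s, d, C, hε, hq⟩ := L.exists_encodes S hn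
  have V := C.isVert L S hn hε hq
  obtain ⟨p, hp, hpq⟩ := exists_latticePath n (n - 1) q V.mono_le fun i h1 h2 =>
    (V.mono_le i n h1 h2 le_rfl).trans V.last_le
  have hw : ∀ k : ℕ, 1 ≤ k → k ≤ n → evalSP (fun i : Fin n => v (i + 1)) k = v k :=
    fun k => evalSP_window v
  obtain ⟨s', d', C', hd'⟩ :=
    exists_encodes hn (π := ⟨p, ε⟩) hε (fun i : Fin n => v (i + 1))
  have key := fun k hk hk' => C'.area_label_eq (k := k) C hn hpq hw hk hk'
  refine ⟨⟨p, ε⟩, fun i => v (i + 1), (mem_vertD_iff hn).2 ⟨hp, ?_⟩, key⟩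
  rw [← hd']
  exact C'.isVert (L.congr key) (S.congr hn key) hn hε
    fun h => hq (by rwa [← hpq 1 le_rfl (by omega)])

end HLZeta

/-! ### The steps of the image of the zeta map, sorted by value -/

open Step

namespace HLZeta

variable {n : ℕ}

theorem IsShi.abs_area_lt {μ ℓ : ℕ → ℤ} (S : IsShi n μ ℓ) (hn : 2 ≤ n) {k : ℕ} (hk : 1 ≤ k)
    (hk' : k ≤ n) : |μ k| < 2 * n := by
  have h2 : ∀ k, 2 ≤ k → k ≤ n → -((k : ℤ) - 1) ≤ μ k := by
    intro k hk
    induction k, hk using Nat.le_induction with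
    | base =>
      intro _
      have h1 := S.low.1
      have h3 := (S.step 1 le_rfl (by omega)).1
      simp only [Nat.reduceAdd] at h3
      push_cast
      omega
    | succ k hk ih =>
      intro hkn
      have h1 := ih (by omega)
      have h3 := (S.step k (by omega) (by omega)).1
      push_cast
      omega
  have htop := S.top.1
  have h3 : ∀ d, d + 1 < n → μ (n - 1 - d) ≤ 1 + d := by
    intro d
    induction d with
    | zero =>
      intro _
      have h3 := (S.step (n - 1) (by omega) (by omega)).1
      rw [show n - 1 + 1 = n by omega] at h3
      rw [Nat.sub_zero]
      push_cast
      omega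
    | succ d ih =>
      intro hd
      have h1 := ih (by omega)
      have h3 := (S.step (n - 1 - (d + 1)) (by omega) (by omega)).1
      rw [show n - 1 - (d + 1) + 1 = n - 1 - d by omega] at h3
      push_cast at h3 ⊢
      omega
  have hlow := S.low.1
  rw [abs_lt]
  by_cases hn2 : n = 2
  · subst hn2
    have h4 := (S.two rfl).1
    have h5 := (S.step 1 le_rfl (by omega)).1
    simp only [Nat.reduceAdd, Nat.reduceSub] at h5 htop
    obtain rfl | rfl : k = 1 ∨ k = 2 := by omega
    · omega
    · omega
  · have h6 := h2 2 le_rfl hn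
    have h7 := h3 (n - 1 - 2) (by omega)
    rw [show n - 1 - (n - 1 - 2) = 2 by omega] at h7
    have h8 := h2 (n - 1) (by omega) (by omega)
    have h9 : k = 1 ∨ k = n ∨ (2 ≤ k ∧ k ≤ n - 1) := by omega
    rcases h9 with rfl | rfl | h9
    · have h10 := h3 (n - 1 - 1) (by omega)
      rw [show n - 1 - (n - 1 - 1) = 1 by omega] at h10
      omega
    · have := h2 k hn le_rfl
      omega
    · have h10 := h2 k h9.1 hk'
      have h11 := h3 (n - 1 - k) (by omega)
      rw [show n - 1 - (n - 1 - k) = k by omega] at h11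
      omega

/-- The word whose initial part is the image of the zeta map, for the area vector `μ`. -/
def zetaWord (n : ℕ) (μ : ℕ → ℤ) : List Step :=
  ((List.range (2 * n)).reverse.map (fun j : ℕ =>
    sMinusR (j : ℤ) ((List.range n).map fun k => μ (k + 1)) ++
      sPlusL (j : ℤ) ((List.range n).map fun k => μ (k + 1)))).flatten

/-- The steps arising from the negative entries of the area vector, with their values. -/
def minusEvent (n : ℕ) (μ : ℕ → ℤ) (j : ℤ) (k : ℕ) : Option (Step × ℤ) :=
  if μ (k + 1) = -j then some (N, k - (2 * (n : ℤ) - 2) * μ (k + 1))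
  else if μ (k + 1) = -j - 1 then
    some (E, k - (2 * (n : ℤ) - 2) * μ (k + 1) - (2 * (n : ℤ) - 2))
  else none

/-- The steps arising from the positive entries of the area vector, with their values. -/
def plusEvent (n : ℕ) (μ : ℕ → ℤ) (j : ℤ) (k : ℕ) : Option (Step × ℤ) :=
  if μ (k + 1) = j then some (N, -(k - (2 * (n : ℤ) - 2) * μ (k + 1)))
  else if μ (k + 1) = j + 1 then
    some (E, -(k - (2 * (n : ℤ) - 2) * μ (k + 1)) - (2 * (n : ℤ) - 2))
  else none

/-- The word `zetaWord n μ` with its steps marked by their values. -/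
def events (n : ℕ) (μ : ℕ → ℤ) : List (Step × ℤ) :=
  ((List.range (2 * n)).reverse.map (fun j : ℕ =>
    (List.range n).reverse.filterMap (minusEvent n μ j) ++
      (List.range n).filterMap (plusEvent n μ j))).flatten

theorem map_fst_events (n : ℕ) (μ : ℕ → ℤ) : (events n μ).map Prod.fst = zetaWord n μ := by
  rw [events, zetaWord, List.map_flatten, List.map_map]
  congr 1
  refine List.map_congr_left fun j _ => ?_
  simp only [Function.comp, List.map_append, sMinusR, sMinusL, sPlusL, ← List.map_reverse,
    List.filterMap_map, List.map_filterMap]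
  congr 2
  · funext k
    simp only [minusEvent]
    split_ifs <;> rfl
  · funext k
    simp only [plusEvent]
    split_ifs <;> rfl

theorem minusEvent_eq_some {μ : ℕ → ℤ} {j : ℤ} {k : ℕ} {e : Step × ℤ}
    (h : minusEvent n μ j k = some e) : e.2 = k + (2 * (n : ℤ) - 2) * j := by
  unfold minusEvent at h
  split_ifs at h with h1 h2 <;> rw [← Option.some.inj h] <;> simp only
  · rw [h1]; ring
  · rw [h2]; ring

theorem plusEvent_eq_some {μ : ℕ → ℤ} {j : ℤ} {k : ℕ} {e : Step × ℤ}
    (h : plusEvent n μ j k = some e) : e.2 = (2 * (n : ℤ) - 2) * j - k := by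
  unfold plusEvent at h
  split_ifs at h with h1 h2 <;> rw [← Option.some.inj h] <;> simp only
  · rw [h1]; ring
  · rw [h2]; ring

theorem pairwise_events (hn : 2 ≤ n) (μ : ℕ → ℤ) :
    (events n μ).Pairwise fun e e' => e'.2 ≤ e.2 := by
  rw [events, List.pairwise_flatten]
  have hmem : ∀ (j : ℕ) (e : Step × ℤ), e ∈ (List.range n).reverse.filterMap (minusEvent n μ j) ++
      (List.range n).filterMap (plusEvent n μ j) →
      (2 * (n : ℤ) - 2) * j - (n - 1) ≤ e.2 ∧ e.2 ≤ (2 * (n : ℤ) - 2) * j + (n - 1) := by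
    intro j e he
    rw [List.mem_append, List.mem_filterMap, List.mem_filterMap] at he
    rcases he with ⟨k, hk, he⟩ | ⟨k, hk, he⟩
    · rw [List.mem_reverse, List.mem_range] at hk
      rw [minusEvent_eq_some he]
      omega
    · rw [List.mem_range] at hk
      rw [plusEvent_eq_some he]
      omega
  constructor
  · simp only [List.mem_map, forall_exists_index, and_imp, forall_apply_eq_imp_iff₂]
    intro j _
    rw [List.pairwise_append, List.pairwise_filterMap, List.pairwise_filterMap,
      List.pairwise_reverse]
    refine ⟨?_, ?_, ?_⟩
    · refine List.pairwise_lt_range.imp ?_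
      intro k k' hk e he e' he'
      rw [minusEvent_eq_some he, minusEvent_eq_some he']
      omega
    · refine List.pairwise_lt_range.imp ?_
      intro k k' hk e he e' he'
      rw [plusEvent_eq_some he, plusEvent_eq_some he']
      omega
    · intro e he e' he'
      obtain ⟨k, _, he⟩ := List.mem_filterMap.mp he
      obtain ⟨k', _, he'⟩ := List.mem_filterMap.mp he'
      rw [minusEvent_eq_some he, plusEvent_eq_some he']
      omega
  · rw [List.pairwise_map, List.pairwise_reverse]
    refine List.pairwise_lt_range.imp ?_
    intro j j' hj e he e' he'
    have h1 := hmem _ _ he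
    have h2 := hmem _ _ he'
    have h3 : (2 * (n : ℤ) - 2) * (j + 1) ≤ (2 * (n : ℤ) - 2) * j' :=
      mul_le_mul_of_nonneg_left (by omega) (by omega)
    rw [mul_add, mul_one] at h3
    omega

theorem sum_map_filterMap {α β : Type*} (f : α → Option β) (φ : β → ℕ) (l : List α) :
    ((l.filterMap f).map φ).sum = (l.map fun a => ((f a).map φ).getD 0).sum := by
  induction l with
  | nil => rfl
  | cons a l ih =>
    rw [List.filterMap_cons]
    cases h : f a with
    | none => simp [h, ih]
    | some b => simp [h, ih]

theorem sum_map_range (f : ℕ → ℕ) (m : ℕ) :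
    ((List.range m).map f).sum = ∑ k ∈ Finset.range m, f k := by
  induction m with
  | zero => rfl
  | succ m ih => rw [List.range_succ, List.map_append, List.sum_append, ih,
      Finset.sum_range_succ, List.map_singleton, List.sum_singleton]

theorem sum_ite_eq_cast (x : ℤ) (m c : ℕ) (hx : x < m) :
    ∑ j ∈ Finset.range m, (if x = (j : ℤ) then c else 0) = if 0 ≤ x then c else 0 := by
  by_cases h : 0 ≤ x
  · obtain ⟨y, rfl⟩ := Int.eq_ofNat_of_zero_le h
    simp only [Nat.cast_inj, Finset.sum_ite_eq, Finset.mem_range]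
    rw [if_pos (by omega), if_pos h]
  · rw [if_neg h]
    exact Finset.sum_eq_zero fun j _ => if_neg (by omega)

theorem sum_events {μ : ℕ → ℤ} (hμ : ∀ k, 1 ≤ k → k ≤ n → |μ k| < 2 * n) (φ : Step × ℤ → ℕ) :
    ((events n μ).map φ).sum = ∑ k ∈ Finset.range n,
      ((if 0 ≤ -μ (k + 1) then φ (N, k - (2 * (n : ℤ) - 2) * μ (k + 1)) else 0) +
      (if 0 ≤ -μ (k + 1) - 1 then
        φ (E, k - (2 * (n : ℤ) - 2) * μ (k + 1) - (2 * (n : ℤ) - 2)) else 0) +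
      ((if 0 ≤ μ (k + 1) then φ (N, -(k - (2 * (n : ℤ) - 2) * μ (k + 1))) else 0) +
      (if 0 ≤ μ (k + 1) - 1 then
        φ (E, -(k - (2 * (n : ℤ) - 2) * μ (k + 1)) - (2 * (n : ℤ) - 2)) else 0))) := by
  rw [events, List.map_flatten, List.sum_flatten, List.map_map, List.map_map, List.map_reverse,
    List.sum_reverse, sum_map_range]
  simp only [Function.comp, List.map_append, List.sum_append, sum_map_filterMap, List.map_reverse,
    List.sum_reverse, sum_map_range]
  simp_rw [← Finset.sum_add_distrib]
  rw [Finset.sum_comm]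
  refine Finset.sum_congr rfl fun k hk => ?_
  rw [Finset.mem_range] at hk
  have h1 := abs_lt.mp (hμ (k + 1) (by omega) (by omega))
  rw [← sum_ite_eq_cast _ (2 * n) _ (by push_cast; omega),
    ← sum_ite_eq_cast _ (2 * n) _ (by push_cast; omega),
    ← sum_ite_eq_cast _ (2 * n) _ (by push_cast; omega),
    ← sum_ite_eq_cast _ (2 * n) _ (by push_cast; omega),
    ← Finset.sum_add_distrib, ← Finset.sum_add_distrib, Finset.sum_add_distrib]
  congr 1
  · refine Finset.sum_congr rfl fun j _ => ?_
    unfold minusEvent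
    by_cases h1 : μ (k + 1) = -(j : ℤ)
    · rw [if_pos h1, if_pos (show -μ (k + 1) = j by omega),
        if_neg (show ¬-μ (k + 1) - 1 = j by omega)]
      rfl
    · rw [if_neg h1, if_neg (show ¬-μ (k + 1) = j by omega)]
      by_cases h2 : μ (k + 1) = -(j : ℤ) - 1
      · rw [if_pos h2, if_pos (show -μ (k + 1) - 1 = j by omega), zero_add]
        rfl
      · rw [if_neg h2, if_neg (show ¬-μ (k + 1) - 1 = j by omega)]
        rfl
  · refine Finset.sum_congr rfl fun j _ => ?_
    unfold plusEvent
    by_cases h1 : μ (k + 1) = (j : ℤ)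
    · rw [if_pos h1, if_pos h1, if_neg (show ¬μ (k + 1) - 1 = j by omega)]
      rfl
    · rw [if_neg h1, if_neg h1]
      by_cases h2 : μ (k + 1) = (j : ℤ) + 1
      · rw [if_pos h2, if_pos (show μ (k + 1) - 1 = j by omega), zero_add]
        rfl
      · rw [if_neg h2, if_neg (show ¬μ (k + 1) - 1 = j by omega)]
        rfl

theorem zetaDraw_eq (n : ℕ) (π : SPath) : zetaDraw n π = (zetaWord n (areaD n π)).dropLast := by
  unfold zetaDraw zetaWord areaDList
  rw [bind_pure_comp, List.map_eq_map, List.map_map]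
  rfl

end HLZeta

/-! ### The image of the zeta map realizes the alcove -/

open Step

namespace HLZeta

variable {n : ℕ}

theorem sum_Icc_two_mul (f : ℕ → ℕ) (n : ℕ) :
    ∑ i ∈ Finset.Icc 1 (2 * n), f i = ∑ i ∈ Finset.Icc 1 n, (f i + f (2 * n + 1 - i)) := by
  have h : Finset.Icc 1 (2 * n) = Finset.Icc 1 n ∪ Finset.Icc (n + 1) (2 * n) := by
    ext i
    simp only [Finset.mem_union, Finset.mem_Icc]
    omega
  rw [h, Finset.sum_union, Finset.sum_add_distrib]
  · congr 1
    refine Finset.sum_nbij' (fun i => 2 * n + 1 - i) (fun i => 2 * n + 1 - i) ?_ ?_ ?_ ?_ ?_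
    all_goals intro i hi; rw [Finset.mem_Icc] at hi
    · rw [Finset.mem_Icc]
      omega
    · rw [Finset.mem_Icc]
      omega
    · omega
    · omega
    · congr 1
      omega
  · rw [Finset.disjoint_left]
    intro i hi hi'
    rw [Finset.mem_Icc] at hi hi'
    omega

theorem IsLetterSeq.sum_eq {b b' : ℕ → ℤ} (hb : IsLetterSeq n b) (hb' : IsLetterSeq n b')
    (f : ℤ → ℕ) :
    ∑ i ∈ Finset.Icc 1 (2 * n), f (b i) = ∑ i ∈ Finset.Icc 1 (2 * n), f (b' i) := by
  have h : ∀ b, IsLetterSeq n b → (Finset.Icc 1 (2 * n)).image b =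
      (Finset.Icc (-(n : ℤ)) n).erase 0 := by
    intro b hb
    ext A
    simp only [Finset.mem_image, Finset.mem_erase, Finset.mem_Icc]
    constructor
    · rintro ⟨i, hi, rfl⟩
      exact hb.letter i hi.1 hi.2
    · intro hA
      obtain ⟨i, h1, h2, h3⟩ := hb.surj hA
      exact ⟨i, ⟨h1, h2⟩, h3⟩
  have h' : ∀ b, IsLetterSeq n b →
      ∑ i ∈ Finset.Icc 1 (2 * n), f (b i) = ∑ A ∈ (Finset.Icc (-(n : ℤ)) n).erase 0, f A := by
    intro b hb
    rw [← h b hb, Finset.sum_image]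
    intro i hi j hj hij
    simp only [Finset.coe_Icc, Set.mem_Icc] at hi hj
    exact hb.inj i j hi.1 hi.2 hj.1 hj.2 hij
  rw [h' b hb, h' b' hb']

theorem IsLabelling.sum_eq {μ ℓ b : ℕ → ℤ} (L : IsLabelling n μ ℓ) (hb : IsLetterSeq n b)
    (f : ℤ → ℕ) :
    ∑ i ∈ Finset.Icc 1 (2 * n), f (b i) =
      ∑ k ∈ Finset.range n, (f (ℓ (k + 1)) + f (-ℓ (k + 1))) := by
  rw [hb.sum_eq (IsLabelling.isLetterSeq L.letter L.ne) f, sum_Icc_two_mul]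
  have h : Finset.Icc 1 n = Finset.Ico 1 (n + 1) := by
    ext k
    simp only [Finset.mem_Icc, Finset.mem_Ico]
    omega
  rw [h, Finset.sum_Ico_eq_sum_range, Nat.add_sub_cancel]
  refine Finset.sum_congr rfl fun k hk => ?_
  rw [Finset.mem_range] at hk
  rw [if_pos (by omega), if_neg (by omega), add_comm 1 k]
  congr 3
  congr 1
  omega

/-- The indicator function of the steps `s` with value larger than `t`. -/
def above (t : ℤ) (s : Step) (e : Step × ℤ) : ℕ := if e.1 = s ∧ t < e.2 then 1 else 0

theorem exists_append_of_pairwise (t : ℤ) {l : List (Step × ℤ)}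
    (hl : l.Pairwise fun e e' => e'.2 ≤ e.2) :
    ∃ x y, l.map Prod.fst = x ++ y ∧ ∀ s, x.count s = (l.map (above t s)).sum := by
  induction l with
  | nil => exact ⟨[], [], rfl, fun s => rfl⟩
  | cons e l ih =>
    rw [List.pairwise_cons] at hl
    by_cases h : t < e.2
    · obtain ⟨x, y, h1, h2⟩ := ih hl.2
      refine ⟨e.1 :: x, y, by rw [List.map_cons, h1, List.cons_append], fun s => ?_⟩
      rw [List.count_cons, h2, List.map_cons, List.sum_cons, above, add_comm]
      by_cases hs : e.1 = s
      · simp [hs, h]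
      · simp [hs]
    · refine ⟨[], _, rfl, fun s => ?_⟩
      symm
      rw [List.count_nil, List.sum_eq_zero_iff]
      intro c hc
      obtain ⟨e', he', rfl⟩ := List.mem_map.mp hc
      refine if_neg fun h' => h ?_
      rcases List.mem_cons.mp he' with rfl | he'
      · exact h'.2
      · exact h'.2.trans_le (hl.1 e' he')

section

variable {μ ℓ b : ℕ → ℤ} {H : ℤ → ℤ}

/-- The number of terms of the sequence `b` with value larger than `t`. -/
def numAbove (n : ℕ) (H : ℤ → ℤ) (b : ℕ → ℤ) (t : ℤ) : ℕ :=
  ∑ i ∈ Finset.Icc 1 (2 * n), if t < H (b i) then 1 else 0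

theorem le_numAbove_iff (hmono : ∀ i j, 1 ≤ i → i ≤ j → j ≤ 2 * n → H (b j) ≤ H (b i)) {t : ℤ}
    {j : ℕ} (hj : 1 ≤ j) (hj' : j ≤ 2 * n) : j ≤ numAbove n H b t ↔ t < H (b j) := by
  rw [numAbove, ← Finset.card_filter]
  constructor
  · intro h
    by_contra hc
    have h1 : (Finset.Icc 1 (2 * n)).filter (fun i => t < H (b i)) ⊆ Finset.Icc 1 (j - 1) := by
      intro i hi
      rw [Finset.mem_filter, Finset.mem_Icc] at hi
      rw [Finset.mem_Icc]
      refine ⟨hi.1.1, ?_⟩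
      by_contra hij
      have := hmono j i hj (by omega) hi.1.2
      omega
    have h2 := Finset.card_le_card h1
    rw [Nat.card_Icc] at h2
    omega
  · intro h
    have h1 : Finset.Icc 1 j ⊆ (Finset.Icc 1 (2 * n)).filter (fun i => t < H (b i)) := by
      intro i hi
      rw [Finset.mem_Icc] at hi
      rw [Finset.mem_filter, Finset.mem_Icc]
      exact ⟨⟨hi.1, hi.2.trans hj'⟩, h.trans_le (hmono i j hi.1 hi.2 hj')⟩
    have h2 := Finset.card_le_card h1
    rwa [Nat.card_Icc, Nat.add_sub_cancel] at h2

theorem sum_above_events (hn : 2 ≤ n) (L : IsLabelling n μ ℓ)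
    (hμ : ∀ k, 1 ≤ k → k ≤ n → |μ k| < 2 * n) (odd : ∀ A, H (-A) = -H A)
    (hH : Represents n H μ ℓ) (hb : IsLetterSeq n b) {t : ℤ} (ht : -((n : ℤ) - 1) ≤ t) :
    ((events n μ).map (above t N)).sum = numAbove n H b t ∧
      ((events n μ).map (above t E)).sum = numAbove n H b (t + (2 * (n : ℤ) - 2)) := by
  have hval : ∀ k, k < n → H (ℓ (k + 1)) = k - (2 * (n : ℤ) - 2) * μ (k + 1) := by
    intro k hk
    rw [hH _ (by omega) (by omega)]
    push_cast
    ring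
  have hpos : ∀ k, k < n → 1 ≤ μ (k + 1) → H (ℓ (k + 1)) ≤ k - (2 * (n : ℤ) - 2) := by
    intro k hk h
    have := mul_le_mul_of_nonneg_left h (show 0 ≤ 2 * (n : ℤ) - 2 by omega)
    rw [hval k hk]
    omega
  have hneg : ∀ k, k < n → μ (k + 1) ≤ -1 → 2 * (n : ℤ) - 2 + k ≤ H (ℓ (k + 1)) := by
    intro k hk h
    have := mul_le_mul_of_nonneg_left h (show 0 ≤ 2 * (n : ℤ) - 2 by omega)
    rw [hval k hk]
    omega
  have hzero : ∀ k, k < n → μ (k + 1) = 0 → H (ℓ (k + 1)) = k := by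
    intro k hk h
    rw [hval k hk, h, mul_zero, sub_zero]
  constructor
  · rw [sum_events hμ, numAbove, L.sum_eq hb (fun A => if t < H A then 1 else 0)]
    refine Finset.sum_congr rfl fun k hk => ?_
    rw [Finset.mem_range] at hk
    rw [← hval k hk, odd]
    have h1 := hpos k hk
    have h2 := hneg k hk
    have h3 := hzero k hk
    simp only [above, true_and, reduceCtorEq, false_and, if_false, ite_self, add_zero]
    split_ifs <;> omega
  · rw [sum_events hμ, numAbove,
      L.sum_eq hb (fun A => if t + (2 * (n : ℤ) - 2) < H A then 1 else 0)]
    refine Finset.sum_congr rfl fun k hk => ?_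
    rw [Finset.mem_range] at hk
    rw [← hval k hk, odd]
    have h1 := hpos k hk
    have h2 := hneg k hk
    have h3 := hzero k hk
    simp only [above, true_and, reduceCtorEq, false_and, if_false, ite_self, zero_add]
    split_ifs <;> omega

theorem length_zetaWord (hμ : ∀ k, 1 ≤ k → k ≤ n → |μ k| < 2 * n) :
    (zetaWord n μ).length = 2 * n := by
  have h := sum_events hμ fun _ => 1
  rw [List.map_const', List.sum_replicate, smul_eq_mul, mul_one] at h
  rw [← map_fst_events, List.length_map, h, Finset.sum_congr rfl (g := fun _ => 2),
    Finset.sum_const, Finset.card_range, smul_eq_mul, mul_comm]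
  intro k _
  split_ifs <;> omega

theorem realizes_zetaWord (hn : 2 ≤ n) (L : IsLabelling n μ ℓ) (S : IsShi n μ ℓ)
    (odd : ∀ A, H (-A) = -H A) (hH : Represents n H μ ℓ) (hb : IsLetterSeq n b)
    (anti : ∀ i j, 1 ≤ i → i < j → j ≤ 2 * n → ¬(i = n ∧ j = n + 1) → H (b j) < H (b i))
    (hmid : H (b (n + 1)) ≤ H (b n)) : Realizes n H (zetaWord n μ).dropLast b := by
  refine ⟨anti, fun i j hi hj hij => ?_⟩
  have hμ : ∀ k, 1 ≤ k → k ≤ n → |μ k| < 2 * n := fun k => S.abs_area_lt hn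
  have ad := L.isAdmissible odd hH
  have hmono : ∀ i j, 1 ≤ i → i ≤ j → j ≤ 2 * n → H (b j) ≤ H (b i) := by
    intro i j hi hij hj
    rcases hij.eq_or_lt with rfl | hij
    · exact le_rfl
    · by_cases h : i = n ∧ j = n + 1
      · rw [h.1, h.2]
        exact hmid
      · exact (anti i j hi hij hj h).le
  rw [le_ebn_dropLast_iff _ (by rw [length_zetaWord hμ]; exact hij)]
  have hmir : H (b (2 * n + 1 - j)) = -H (b j) := by rw [hb.mirror j hj (by omega), odd]
  have hle : -H (b j) ≤ H (b i) := by
    rw [← hmir]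
    exact hmono _ _ hi (by omega) (by omega)
  have hne : H (b i) ≠ H (b j) + (2 * (n : ℤ) - 2) := by
    intro h
    by_cases h0 : i = j
    · subst h0
      omega
    · refine ad.res (b i) (b j) (hb.letter i hi (by omega)) (hb.letter j hj (by omega)) ?_ ?_
        ⟨1, by rw [h]; ring⟩
      · exact fun h' => h0 (hb.inj i j hi (by omega) hj (by omega) h')
      · intro h'
        rw [← hb.mirror j hj (by omega)] at h'
        have := hb.inj i _ hi (by omega) (by omega) (by omega) h'
        omega
  constructor
  · intro h
    by_contra hc
    obtain ⟨x, y, h1, h2⟩ := exists_append_of_pairwise (H (b j) - 1) (pairwise_events hn μ)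
    obtain ⟨h3, h4⟩ := sum_above_events hn L hμ odd hH hb (t := H (b j) - 1) (by omega)
    rw [map_fst_events] at h1
    have h5 : j ≤ x.count N := by
      rw [h2, h3, le_numAbove_iff hmono hj (by omega)]
      omega
    have h6 := ebn_append_le_count x y h5
    rw [← h1, h2, h4] at h6
    have h7 := (le_numAbove_iff hmono hi (by omega)).mp (h.trans h6)
    omega
  · intro h
    obtain ⟨t, ht⟩ : ∃ t, t = max (H (b j)) (-((n : ℤ) - 1)) := ⟨_, rfl⟩
    obtain ⟨x, y, h1, h2⟩ := exists_append_of_pairwise t (pairwise_events hn μ)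
    obtain ⟨h3, h4⟩ := sum_above_events hn L hμ odd hH hb (t := t) (by omega)
    rw [map_fst_events] at h1
    have h5 : x.count N < j := by
      by_contra hc
      rw [not_lt, h2, h3, le_numAbove_iff hmono hj (by omega)] at hc
      omega
    have h6 := count_le_ebn_append x y h5
    rw [← h1, h2, h4] at h6
    refine le_trans ?_ h6
    rw [le_numAbove_iff hmono hi (by omega)]
    omega

end

end HLZeta

/-! ### The diagonal reading word -/

open Step

namespace HLZeta

variable {n : ℕ}

theorem prod_Icc_eq_prod_range {M : Type*} [CommMonoid M] (f : ℕ → M) (n : ℕ) :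
    ∏ k ∈ Finset.Icc 1 n, f k = ∏ k ∈ Finset.range n, f (k + 1) := by
  have h : Finset.Icc 1 n = Finset.Ico 1 (n + 1) := by
    ext k
    simp only [Finset.mem_Icc, Finset.mem_Ico]
    omega
  rw [h, Finset.prod_Ico_eq_prod_range, Nat.add_sub_cancel]
  exact Finset.prod_congr rfl fun k _ => by rw [add_comm]

theorem prod_map_range {M : Type*} [CommMonoid M] (f : ℕ → M) (m : ℕ) :
    ((List.range m).map f).prod = ∏ k ∈ Finset.range m, f k := by
  induction m with
  | zero => rfl
  | succ m ih => rw [List.range_succ, List.map_append, List.prod_append, ih,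
      Finset.prod_range_succ, List.map_singleton, List.prod_singleton]

/-- The diagonal reading word before the final sign change of its first letter. -/
def baseWord (n : ℕ) (μ ℓ : ℕ → ℤ) : List ℤ :=
  ((List.range (4 * n + 4)).map (fun i : ℕ =>
    ((List.finRange n).filterMap (fun j =>
      if μ (j.val + 1) = -(i : ℤ) then some (ℓ (j.val + 1)) else none)) ++
    ((List.finRange n).reverse.filterMap (fun j =>
      if μ (j.val + 1) = (i : ℤ) + 1 then some (-ℓ (j.val + 1)) else none)))).flatten

theorem dDList_eq (n : ℕ) (π : SPath) (v : Fin n → ℤ) : dDList n π v =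
    if ((Finset.Icc 1 n).filter (fun r => 0 < areaD n π r)).card % 2 = 1 then
      (match baseWord n (areaD n π) (labD n π v) with
        | [] => ([] : List ℤ)
        | x :: rest => -x :: rest)
    else baseWord n (areaD n π) (labD n π v) := by
  have h : ∀ j : Fin n, labD n π v (j.val + 1) = mult n π (j.val + 1) * v j := by
    intro j
    rw [labD, evalSP_succ]
  unfold dDList baseWord
  simp only [h]
  rw [bind_pure_comp, List.map_eq_map, List.map_map]
  rfl

section

variable {μ ℓ : ℕ → ℤ} {H : ℤ → ℤ}

theorem mem_baseWord (hμ : ∀ k, 1 ≤ k → k ≤ n → |μ k| < 2 * n) {A : ℤ} :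
    A ∈ baseWord n μ ℓ ↔ ∃ k, k < n ∧ A = if 0 < μ (k + 1) then -ℓ (k + 1) else ℓ (k + 1) := by
  simp only [baseWord, List.mem_flatten, List.mem_map, List.mem_range, exists_exists_and_eq_and,
    List.mem_append, List.mem_filterMap, List.mem_reverse, List.mem_finRange, true_and,
    Option.ite_none_right_eq_some, Option.some.injEq]
  constructor
  · rintro ⟨i, _, ⟨k, h1, h2⟩ | ⟨k, h1, h2⟩⟩
    · exact ⟨k, k.2, by rw [if_neg (by omega), h2]⟩
    · exact ⟨k, k.2, by rw [if_pos (by omega), h2]⟩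
  · rintro ⟨k, hk, h⟩
    have h1 := abs_lt.mp (hμ (k + 1) (by omega) (by omega))
    by_cases h2 : 0 < μ (k + 1)
    · rw [if_pos h2] at h
      exact ⟨(μ (k + 1) - 1).toNat, by omega, Or.inr ⟨⟨k, hk⟩, by simp only; omega, h.symm⟩⟩
    · rw [if_neg h2] at h
      exact ⟨(-μ (k + 1)).toNat, by omega, Or.inl ⟨⟨k, hk⟩, by simp only; omega, h.symm⟩⟩

theorem pairwise_baseWord (hn : 2 ≤ n) (odd : ∀ A, H (-A) = -H A) (hH : Represents n H μ ℓ) :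
    (baseWord n μ ℓ).Pairwise fun A B => H A < H B := by
  have hval : ∀ k, k < n → H (ℓ (k + 1)) = k - (2 * (n : ℤ) - 2) * μ (k + 1) := by
    intro k hk
    rw [hH _ (by omega) (by omega)]
    push_cast
    ring
  have h1 : ∀ (i : ℤ) (k : Fin n) (A : ℤ),
      (if μ (k.val + 1) = -i then some (ℓ (k.val + 1)) else none) = some A →
      μ (k + 1) = -i ∧ H A = k + (2 * (n : ℤ) - 2) * i := by
    intro i k A h
    rw [Option.ite_none_right_eq_some, Option.some.injEq] at h
    refine ⟨h.1, ?_⟩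
    rw [← h.2, hval k k.2, h.1]
    ring
  have h2 : ∀ (i : ℤ) (k : Fin n) (A : ℤ),
      (if μ (k.val + 1) = i + 1 then some (-ℓ (k.val + 1)) else none) = some A →
      μ (k + 1) = i + 1 ∧ H A = (2 * (n : ℤ) - 2) * i + (2 * (n : ℤ) - 2) - k := by
    intro i k A h
    rw [Option.ite_none_right_eq_some, Option.some.injEq] at h
    refine ⟨h.1, ?_⟩
    rw [← h.2, odd, hval k k.2, h.1]
    ring
  rw [baseWord, List.pairwise_flatten]
  constructor
  · simp only [List.mem_map, forall_exists_index, and_imp, forall_apply_eq_imp_iff₂]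
    intro i _
    rw [List.pairwise_append, List.pairwise_filterMap, List.pairwise_filterMap,
      List.pairwise_reverse]
    refine ⟨?_, ?_, ?_⟩
    · refine (List.pairwise_lt_finRange n).imp ?_
      intro k k' hk A hA B hB
      have := h1 _ _ _ hA
      have := h1 _ _ _ hB
      omega
    · refine (List.pairwise_lt_finRange n).imp ?_
      intro k k' hk A hA B hB
      have := h2 _ _ _ hA
      have := h2 _ _ _ hB
      omega
    · intro A hA B hB
      obtain ⟨k, _, hA⟩ := List.mem_filterMap.mp hA
      obtain ⟨k', _, hB⟩ := List.mem_filterMap.mp hB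
      have e1 := h1 _ _ _ hA
      have e2 := h2 _ _ _ hB
      have e3 : k ≠ k' := by
        rintro rfl
        omega
      omega
  · rw [List.pairwise_map]
    refine List.pairwise_lt_range.imp ?_
    intro i i' hi A hA B hB
    have h3 : (2 * (n : ℤ) - 2) * (i + 1) ≤ (2 * (n : ℤ) - 2) * i' :=
      mul_le_mul_of_nonneg_left (by omega) (by omega)
    rw [mul_add, mul_one] at h3
    rw [List.mem_append, List.mem_filterMap, List.mem_filterMap] at hA hB
    rcases hA with ⟨k, _, hA⟩ | ⟨k, _, hA⟩ <;> rcases hB with ⟨k', _, hB⟩ | ⟨k', _, hB⟩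
    · have e1 := h1 _ _ _ hA
      have e2 := h1 _ _ _ hB
      omega
    · have e1 := h1 _ _ _ hA
      have e2 := h2 _ _ _ hB
      omega
    · have e1 := h2 _ _ _ hA
      have e2 := h1 _ _ _ hB
      have e3 : k ≠ k' := by
        rintro rfl
        omega
      omega
    · have e1 := h2 _ _ _ hA
      have e2 := h2 _ _ _ hB
      omega

theorem nonneg_of_mem_baseWord (hn : 2 ≤ n) (hμ : ∀ k, 1 ≤ k → k ≤ n → |μ k| < 2 * n)
    (odd : ∀ A, H (-A) = -H A) (hH : Represents n H μ ℓ) {A : ℤ} (hA : A ∈ baseWord n μ ℓ) :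
    0 ≤ H A := by
  obtain ⟨k, hk, rfl⟩ := (mem_baseWord hμ).mp hA
  have h := hH (k + 1) (by omega) (by omega)
  push_cast at h
  split_ifs with h1
  · have := mul_le_mul_of_nonneg_left (show 1 ≤ μ (k + 1) by omega)
      (show 0 ≤ 2 * (n : ℤ) - 2 by omega)
    rw [odd]
    omega
  · have := mul_nonpos_of_nonneg_of_nonpos (show 0 ≤ 2 * (n : ℤ) - 2 by omega)
      (show μ (k + 1) ≤ 0 by omega)
    omega

theorem baseWord_perm (hn : 2 ≤ n) (L : IsLabelling n μ ℓ)
    (hμ : ∀ k, 1 ≤ k → k ≤ n → |μ k| < 2 * n) (odd : ∀ A, H (-A) = -H A)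
    (hH : Represents n H μ ℓ) : (baseWord n μ ℓ).Perm
      ((List.range n).map fun k => if 0 < μ (k + 1) then -ℓ (k + 1) else ℓ (k + 1)) := by
  rw [List.perm_ext_iff_of_nodup]
  · intro A
    rw [mem_baseWord hμ, List.mem_map]
    simp only [List.mem_range, eq_comm]
  · refine (pairwise_baseWord hn odd hH).imp ?_
    rintro A B h rfl
    exact lt_irrefl _ h
  · refine List.Nodup.map_on ?_ List.nodup_range
    intro k hk k' hk' h
    rw [List.mem_range] at hk hk'
    by_contra hne
    have h1 := L.ne (k + 1) (k' + 1) (by omega) (by omega) (by omega) (by omega) (by omega)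
    split_ifs at h <;> omega

theorem prod_map_sign_baseWord (hn : 2 ≤ n) (L : IsLabelling n μ ℓ)
    (hμ : ∀ k, 1 ≤ k → k ≤ n → |μ k| < 2 * n) (odd : ∀ A, H (-A) = -H A)
    (hH : Represents n H μ ℓ) : ((baseWord n μ ℓ).map Int.sign).prod =
      (-1) ^ ((Finset.Icc 1 n).filter (fun r => 0 < μ r)).card := by
  rw [((baseWord_perm hn L hμ odd hH).map Int.sign).prod_eq, List.map_map,
    prod_map_range]
  simp only [Function.comp]
  rw [← prod_Icc_eq_prod_range
      (fun k => (if 0 < μ k then -ℓ k else ℓ k).sign)]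
  have h : ∀ k, (if 0 < μ k then -ℓ k else ℓ k).sign =
      (if 0 < μ k then -1 else 1) * (ℓ k).sign := by
    intro k
    split_ifs
    · rw [Int.sign_neg, neg_one_mul]
    · rw [one_mul]
  simp only [h]
  rw [Finset.prod_mul_distrib, L.sign, mul_one, Finset.prod_ite, Finset.prod_const,
    Finset.prod_const_one, mul_one]

end

theorem prod_sign_eq_one_iff {w : Fin n → ℤ} (hw : ∀ i, w i ≠ 0) :
    ∏ i, (w i).sign = 1 ↔ (Finset.univ.filter (fun i => w i < 0)).card % 2 = 0 := by
  have h : ∀ i, (w i).sign = if w i < 0 then -1 else 1 := by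
    intro i
    rcases lt_or_gt_of_ne (hw i) with h | h
    · rw [if_pos h, Int.sign_eq_neg_one_of_neg h]
    · rw [if_neg (by omega), Int.sign_eq_one_of_pos h]
  simp only [h]
  rw [Finset.prod_ite, Finset.prod_const, Finset.prod_const_one, mul_one,
    neg_one_pow_eq_one_iff_even (by decide), Nat.even_iff]

end HLZeta

/-! ### The letter sequence of a diagonally labelled path -/

open Step

namespace HLZeta

variable {n : ℕ}

/-- The sequence of labels of the steps of a diagonally labelled path: the East step `i` carries
the label number `i`, and a valley `(i, j)` requires a descent between the terms `i` and `j`. -/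
def diagSeq (n : ℕ) (w : ℕ → ℤ) (ε : ℤ) (i : ℕ) : ℤ :=
  if i < n then w (n + 1 - i)
  else if i = n then ε * w 1
  else if i = n + 1 then -(ε * w 1)
  else -w (i - n)

theorem diagSeq_one_of_le {w : ℕ → ℤ} {i : ℕ} (hi : i ≤ n) :
    diagSeq n w 1 i = w (n + 1 - i) := by
  unfold diagSeq
  split_ifs with h1 h2
  · rfl
  · rw [one_mul, h2]
    congr 1
    omega
  · omega
  · omega

theorem diagSeq_one_of_lt {w : ℕ → ℤ} {i : ℕ} (hi : n < i) : diagSeq n w 1 i = -w (i - n) := by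
  unfold diagSeq
  rw [if_neg (by omega), if_neg (by omega)]
  split_ifs with h
  · rw [one_mul, h]
    congr 2
    omega
  · rfl

theorem swapMid_diagSeq (w : ℕ → ℤ) (ε : ℤ) :
    swapMid n (diagSeq n w ε) = diagSeq n w (-ε) := by
  funext i
  unfold swapMid diagSeq
  by_cases h1 : i < n
  · rw [if_neg (by omega), if_pos h1, if_pos h1]
  · rw [if_neg h1, if_neg h1]
    by_cases h2 : i = n
    · rw [if_pos (Or.inl h2), if_pos h2, if_pos h2, neg_mul]
    · rw [if_neg h2, if_neg h2]
      by_cases h3 : i = n + 1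
      · rw [if_pos (Or.inr h3), if_pos h3, if_pos h3, neg_mul]
      · rw [if_neg (by omega), if_neg h3, if_neg h3]

theorem diagSeq_congr (_hn : 2 ≤ n) {w w' : ℕ → ℤ} {δ : ℤ}
    (h : ∀ k, w k = (if k = 1 then δ else 1) * w' k) (ε : ℤ) :
    diagSeq n w ε = diagSeq n w' (ε * δ) := by
  funext i
  unfold diagSeq
  rw [h 1, if_pos rfl]
  split_ifs
  · rw [h, if_neg (by omega), one_mul]
  · rw [mul_assoc]
  · rw [mul_assoc]
  · rw [h, if_neg (by omega), one_mul]

theorem isLetterSeq_diagSeq {w : ℕ → ℤ} (hw : ∀ k, 1 ≤ k → k ≤ n → IsLetter n (w k))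
    (hne : ∀ i j, 1 ≤ i → i ≤ n → 1 ≤ j → j ≤ n → i ≠ j → w i ≠ w j ∧ w i ≠ -w j)
    {ε : ℤ} (hε : ε = 1 ∨ ε = -1) : IsLetterSeq n (diagSeq n w ε) := by
  have key : IsLetterSeq n (diagSeq n w 1) := by
    have mirror : ∀ i, 1 ≤ i → i ≤ 2 * n → diagSeq n w 1 (2 * n + 1 - i) = -diagSeq n w 1 i := by
      intro i hi hi'
      by_cases h : i ≤ n
      · rw [diagSeq_one_of_le h, diagSeq_one_of_lt (by omega)]
        congr 2
        omega
      · rw [diagSeq_one_of_lt (show n < i by omega), diagSeq_one_of_le (by omega), neg_neg]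
        congr 1
        omega
    have letter : ∀ i, 1 ≤ i → i ≤ 2 * n → IsLetter n (diagSeq n w 1 i) := by
      intro i hi hi'
      by_cases h : i ≤ n
      · rw [diagSeq_one_of_le h]
        exact hw _ (by omega) (by omega)
      · rw [diagSeq_one_of_lt (by omega)]
        exact (hw _ (by omega) (by omega)).neg
    refine ⟨letter, mirror, fun i j hi hi' hj hj' hij => ?_⟩
    by_contra h0
    by_cases h1 : i + j = 2 * n + 1
    · have h2 := mirror j hj hj'
      rw [show 2 * n + 1 - j = i by omega, hij] at h2
      have := (letter j hj hj').1
      omega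
    · by_cases h2 : i ≤ n <;> by_cases h3 : j ≤ n
      · rw [diagSeq_one_of_le h2, diagSeq_one_of_le h3] at hij
        exact (hne _ _ (by omega) (by omega) (by omega) (by omega) (by omega)).1 hij
      · rw [diagSeq_one_of_le h2, diagSeq_one_of_lt (show n < j by omega)] at hij
        exact (hne _ _ (by omega) (by omega) (by omega) (by omega) (by omega)).2 hij
      · rw [diagSeq_one_of_lt (show n < i by omega), diagSeq_one_of_le h3, neg_eq_iff_eq_neg]
          at hij
        exact (hne _ _ (by omega) (by omega) (by omega) (by omega) (by omega)).2 hij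
      · rw [diagSeq_one_of_lt (show n < i by omega), diagSeq_one_of_lt (show n < j by omega),
          neg_inj] at hij
        exact (hne _ _ (by omega) (by omega) (by omega) (by omega) (by omega)).1 hij
  rcases hε with rfl | rfl
  · exact key
  · rw [← swapMid_diagSeq]
    exact key.swapMid

theorem not_nthNFollowedByE_iff (hn : 2 ≤ n) {β : List Step} (hβ : IsBallotPath (2 * n - 1) β) :
    ¬NthNFollowedByE β n ↔ ebn β n = ebn β (n + 1) := by
  rw [nthNFollowedByE_iff β (by omega)]
  have h1 := le_count_of_isBallotPath hβ
  have h2 : ebn β n ≤ ebn β (n + 1) := ebn_mono β (by omega)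
  omega

theorem mem_diagD_iff (hn : 2 ≤ n) {β : SPath} {w : Fin n → ℤ} : (β, w) ∈ DiagD n ↔
    IsSignedBallotPath n β ∧ IsSignedPermD n w ∧
      (∀ i j, IsValley β.path i j → diagSeq n (fun k => evalSP w k) β.sgn j <
        diagSeq n (fun k => evalSP w k) β.sgn i) ∧
      ∀ i, IsValley β.path i n → ebn β.path n = ebn β.path (n + 1) →
        |diagSeq n (fun k => evalSP w k) β.sgn n| < diagSeq n (fun k => evalSP w k) β.sgn i := by
  unfold DiagD
  rw [Set.mem_ofPred_eq]
  refine and_congr_right fun hβ => and_congr_right fun _ => ?_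
  have hi : ∀ i j, IsValley β.path i j →
      diagSeq n (fun k => evalSP w k) β.sgn i = evalSP w ((n : ℤ) + 1 - i) := by
    intro i j hv
    have h := isValley_bounds hn hβ.1 hv
    rw [diagSeq, if_pos (by omega), Nat.cast_sub (by omega)]
    push_cast
    rfl
  have hone : evalSP w ((1 : ℕ) : ℤ) = evalSP w 1 := by rw [Nat.cast_one]
  refine and_congr ?_ ?_
  · refine forall_congr' fun i => forall_congr' fun j => forall_congr' fun hv => ?_
    have h := isValley_bounds hn hβ.1 hv
    rw [hi i j hv]
    unfold diagSeq
    dsimp only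
    rw [hone]
    rcases lt_trichotomy j n with h1 | h1 | h1
    · rw [if_pos h1, Nat.cast_sub (by omega)]
      push_cast
      constructor
      · exact fun h => h.1 h1
      · exact fun h => ⟨fun _ => h, by omega, by omega, by omega⟩
    · rw [if_neg (by omega), if_pos h1]
      constructor
      · exact fun h => h.2.1 h1
      · exact fun h => ⟨by omega, fun _ => h, by omega, by omega⟩
    · rw [if_neg (by omega), if_neg (by omega)]
      by_cases h2 : j = n + 1
      · rw [if_pos h2]
        constructor
        · exact fun h => h.2.2.1 h2
        · exact fun h => ⟨by omega, by omega, fun _ => h, by omega⟩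
      · rw [if_neg h2, ← evalSP_neg, Nat.cast_sub (by omega), neg_sub]
        constructor
        · exact fun h => h.2.2.2 (by omega)
        · exact fun h => ⟨by omega, by omega, by omega, fun _ => h⟩
  · refine forall_congr' fun i => forall_congr' fun hv => ?_
    rw [not_nthNFollowedByE_iff hn hβ.1, hi i n hv, diagSeq, if_neg (by omega), if_pos rfl,
      abs_mul]
    dsimp only
    rw [hone]
    have : |β.sgn| = 1 := by rcases hβ.2.1 with h | h <;> rw [h] <;> rfl
    rw [this, one_mul]

end HLZeta

/-! ### The image of a vertically labelled path -/

open Step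

namespace HLZeta

variable {n : ℕ}

theorem evalSP_eq_of_first {w w' : Fin n → ℤ} {δ : ℤ}
    (h : ∀ i, w i = (if i.val = 0 then δ else 1) * w' i) (k : ℕ) :
    evalSP w k = (if k = 1 then δ else 1) * evalSP w' k := by
  by_cases hk : 1 ≤ k ∧ k ≤ n
  · rw [evalSP_natCast w hk.1 hk.2, evalSP_natCast w' hk.1 hk.2, h]
    congr 1
    simp only
    split_ifs <;> first | rfl | omega
  · rw [evalSP, evalSP, dif_neg (by omega), dif_neg (by omega), dif_neg (by omega),
      dif_neg (by omega), mul_zero]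

theorem prod_map_eq_prod_getD (f : ℤ → ℤ) (l : List ℤ) :
    (l.map f).prod = ∏ k ∈ Finset.range l.length, f (l.getD k 0) := by
  induction l with
  | nil => rfl
  | cons x l ih =>
    rw [List.map_cons, List.prod_cons, ih, List.length_cons, Finset.prod_range_succ', mul_comm]
    rfl

theorem prod_sign_of_first (hn : 2 ≤ n) {w w' : Fin n → ℤ} {δ : ℤ} (hδ : δ = 1 ∨ δ = -1)
    (h : ∀ i, w i = (if i.val = 0 then δ else 1) * w' i) :
    ∏ i, (w i).sign = δ * ∏ i, (w' i).sign := by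
  have h1 : ∀ i, (w i).sign = (if i.val = 0 then δ else 1) * (w' i).sign := by
    intro i
    rw [h i, Int.sign_mul]
    congr 1
    rcases hδ with rfl | rfl <;> split_ifs <;> rfl
  simp only [h1]
  rw [Finset.prod_mul_distrib,
    Fin.prod_univ_eq_prod_range (fun k => if k = 0 then δ else (1 : ℤ)) n,
    Finset.prod_ite_eq', if_pos (Finset.mem_range.mpr (by omega))]

section

variable {μ ℓ : ℕ → ℤ} {H : ℤ → ℤ}

/-- The window whose entries are the letters of the diagonal reading word before the final
sign change. -/
def baseWindow (n : ℕ) (μ ℓ : ℕ → ℤ) (i : Fin n) : ℤ := (baseWord n μ ℓ).getD i.val 0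

theorem length_baseWord (hn : 2 ≤ n) (L : IsLabelling n μ ℓ) (S : IsShi n μ ℓ)
    (odd : ∀ A, H (-A) = -H A) (hH : Represents n H μ ℓ) : (baseWord n μ ℓ).length = n := by
  rw [(baseWord_perm hn L (fun k => S.abs_area_lt hn) odd hH).length_eq, List.length_map,
    List.length_range]

theorem baseWindow_mem (hn : 2 ≤ n) (L : IsLabelling n μ ℓ) (S : IsShi n μ ℓ)
    (odd : ∀ A, H (-A) = -H A) (hH : Represents n H μ ℓ) (i : Fin n) :
    baseWindow n μ ℓ i ∈ baseWord n μ ℓ := by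
  have hl := length_baseWord hn L S odd hH
  rw [baseWindow, List.getD_eq_getElem _ _ (by omega)]
  exact List.getElem_mem _

theorem baseWindow_lt (hn : 2 ≤ n) (L : IsLabelling n μ ℓ) (S : IsShi n μ ℓ)
    (odd : ∀ A, H (-A) = -H A) (hH : Represents n H μ ℓ) {i j : Fin n} (hij : i < j) :
    H (baseWindow n μ ℓ i) < H (baseWindow n μ ℓ j) := by
  have hl := length_baseWord hn L S odd hH
  rw [baseWindow, baseWindow, List.getD_eq_getElem _ _ (by omega),
    List.getD_eq_getElem _ _ (by omega)]
  exact List.pairwise_iff_getElem.mp (pairwise_baseWord hn odd hH) _ _ _ _ hij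

theorem isLetter_baseWindow (hn : 2 ≤ n) (L : IsLabelling n μ ℓ) (S : IsShi n μ ℓ)
    (odd : ∀ A, H (-A) = -H A) (hH : Represents n H μ ℓ) (i : Fin n) :
    IsLetter n (baseWindow n μ ℓ i) := by
  obtain ⟨k, hk, h⟩ :=
    (mem_baseWord fun k => S.abs_area_lt hn).mp (baseWindow_mem hn L S odd hH i)
  have := L.letter (k + 1) (by omega) (by omega)
  rw [h]
  split_ifs
  · exact this.neg
  · exact this

theorem prod_sign_baseWindow (hn : 2 ≤ n) (L : IsLabelling n μ ℓ) (S : IsShi n μ ℓ)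
    (odd : ∀ A, H (-A) = -H A) (hH : Represents n H μ ℓ) :
    ∏ i, (baseWindow n μ ℓ i).sign =
      (-1) ^ ((Finset.Icc 1 n).filter (fun r => 0 < μ r)).card := by
  rw [← prod_map_sign_baseWord hn L (fun k => S.abs_area_lt hn) odd hH, prod_map_eq_prod_getD,
    length_baseWord hn L S odd hH]
  exact Fin.prod_univ_eq_prod_range (fun k => ((baseWord n μ ℓ).getD k 0).sign) n

theorem evalSP_baseWindow_lt (hn : 2 ≤ n) (L : IsLabelling n μ ℓ) (S : IsShi n μ ℓ)
    (odd : ∀ A, H (-A) = -H A) (hH : Represents n H μ ℓ) {i j : ℕ} (hi : 1 ≤ i) (hij : i < j)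
    (hj : j ≤ n) : H (evalSP (baseWindow n μ ℓ) i) < H (evalSP (baseWindow n μ ℓ) j) := by
  rw [evalSP_natCast _ hi (by omega), evalSP_natCast _ (by omega) hj]
  exact baseWindow_lt hn L S odd hH (Fin.mk_lt_mk.mpr (by omega))

theorem evalSP_baseWindow_nonneg (hn : 2 ≤ n) (L : IsLabelling n μ ℓ) (S : IsShi n μ ℓ)
    (odd : ∀ A, H (-A) = -H A) (hH : Represents n H μ ℓ) {i : ℕ} (hi : 1 ≤ i) (hi' : i ≤ n) :
    0 ≤ H (evalSP (baseWindow n μ ℓ) i) := by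
  rw [evalSP_natCast _ hi hi']
  exact nonneg_of_mem_baseWord hn (fun k => S.abs_area_lt hn) odd hH
    (baseWindow_mem hn L S odd hH _)

theorem isSignedPerm_baseWindow (hn : 2 ≤ n) (L : IsLabelling n μ ℓ) (S : IsShi n μ ℓ)
    (odd : ∀ A, H (-A) = -H A) (hH : Represents n H μ ℓ) :
    IsSignedPerm n (baseWindow n μ ℓ) := by
  refine (isSignedPerm_iff _).mpr ⟨?_, ?_⟩
  · intro k hk hk'
    rw [evalSP_natCast _ hk hk']
    exact isLetter_baseWindow hn L S odd hH _
  · have key : ∀ i j : ℕ, 1 ≤ i → i < j → j ≤ n →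
        evalSP (baseWindow n μ ℓ) i ≠ evalSP (baseWindow n μ ℓ) j ∧
        evalSP (baseWindow n μ ℓ) i ≠ -evalSP (baseWindow n μ ℓ) j := by
      intro i j hi hij hj
      have h1 := evalSP_baseWindow_lt hn L S odd hH hi hij hj
      have h2 := evalSP_baseWindow_nonneg hn L S odd hH hi (by omega)
      constructor
      · intro h
        rw [h] at h1
        omega
      · intro h
        rw [h, odd] at h1 h2
        omega
    intro i j hi hi' hj hj' hij
    rcases lt_or_gt_of_ne hij with h | h
    · exact key i j hi h hj'
    · have := key j i hj h hi'
      omega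

theorem realizes_baseWindow (hn : 2 ≤ n) (L : IsLabelling n μ ℓ) (S : IsShi n μ ℓ)
    (odd : ∀ A, H (-A) = -H A) (hH : Represents n H μ ℓ) :
    IsLetterSeq n (diagSeq n (fun k => evalSP (baseWindow n μ ℓ) k) 1) ∧
      Realizes n H (zetaWord n μ).dropLast
        (diagSeq n (fun k => evalSP (baseWindow n μ ℓ) k) 1) := by
  have lt : ∀ i j : ℕ, 1 ≤ i → i < j → j ≤ n →
      H (evalSP (baseWindow n μ ℓ) i) < H (evalSP (baseWindow n μ ℓ) j) :=
    fun i j => evalSP_baseWindow_lt hn L S odd hH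
  have nonneg : ∀ i : ℕ, 1 ≤ i → i ≤ n → 0 ≤ H (evalSP (baseWindow n μ ℓ) i) :=
    fun i => evalSP_baseWindow_nonneg hn L S odd hH
  have hw := (isSignedPerm_iff _).mp (isSignedPerm_baseWindow hn L S odd hH)
  have hb := isLetterSeq_diagSeq hw.1 hw.2 (Or.inl rfl)
  refine ⟨hb, realizes_zetaWord hn L S odd hH hb ?_ ?_⟩
  · intro i j hi hij hj hmid
    by_cases h1 : j ≤ n
    · rw [diagSeq_one_of_le h1, diagSeq_one_of_le (by omega)]
      exact lt _ _ (by omega) (by omega) (by omega)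
    · rw [diagSeq_one_of_lt (show n < j by omega), odd]
      have h2 := nonneg (j - n) (by omega) (by omega)
      by_cases h3 : i ≤ n
      · rw [diagSeq_one_of_le h3]
        have h4 := nonneg (n + 1 - i) (by omega) (by omega)
        by_cases h5 : i = n
        · have h6 := lt 1 (j - n) le_rfl (by omega) (by omega)
          have h7 := nonneg 1 le_rfl (by omega)
          omega
        · have h6 := lt 1 (n + 1 - i) le_rfl (by omega) (by omega)
          have h7 := nonneg 1 le_rfl (by omega)
          omega
      · rw [diagSeq_one_of_lt (show n < i by omega), odd]
        have h6 := lt (i - n) (j - n) (by omega) (by omega) (by omega)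
        omega
  · have h := hb.mirror_of_add_eq (i := n) (j := n + 1) (by omega) (by omega) (by omega)
    have h1 := nonneg 1 le_rfl (by omega)
    rw [h, odd, diagSeq_one_of_le le_rfl, Nat.add_sub_cancel_left]
    omega

theorem isBallotPath_zetaWord (hn : 2 ≤ n) (L : IsLabelling n μ ℓ) (S : IsShi n μ ℓ)
    (odd : ∀ A, H (-A) = -H A) (hH : Represents n H μ ℓ) :
    IsBallotPath (2 * n - 1) (zetaWord n μ).dropLast := by
  have hl : (zetaWord n μ).dropLast.length = 2 * n - 1 := by
    rw [List.length_dropLast, length_zetaWord fun k => S.abs_area_lt hn]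
  rw [← hl]
  refine isBallotPath_of_ebn_lt fun i hi hi' => ?_
  by_contra h
  have := ((realizes_baseWindow hn L S odd hH).2.table i i hi hi (by omega)).mp (by omega)
  omega

end

theorem dD_eq (n : ℕ) (π : SPath) (v : Fin n → ℤ) (i : Fin n) : dD n π v i =
    (if i.val = 0 then
      (if ((Finset.Icc 1 n).filter (fun r => 0 < areaD n π r)).card % 2 = 1 then -1 else 1)
      else 1) * baseWindow n (areaD n π) (labD n π v) i := by
  rw [dD, dDList_eq, baseWindow]
  obtain ⟨k, hk⟩ := i
  by_cases h : ((Finset.Icc 1 n).filter (fun r => 0 < areaD n π r)).card % 2 = 1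
  · rw [if_pos h, if_pos h]
    cases baseWord n (areaD n π) (labD n π v) with
    | nil => simp
    | cons x l => cases k <;> simp
  · rw [if_neg h, if_neg h]
    simp

open scoped Classical in
theorem realizes_image (hn : 2 ≤ n) {π : SPath} {v : Fin n → ℤ} {H : ℤ → ℤ}
    (L : IsLabelling n (areaD n π) (labD n π v)) (S : IsShi n (areaD n π) (labD n π v))
    (odd : ∀ A, H (-A) = -H A) (hH : Represents n H (areaD n π) (labD n π v)) :
    IsSignedBallotPath n (zetaD n π) ∧ IsSignedPermD n (dD n π v) ∧
      Realizes n H (zetaD n π).path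
        (diagSeq n (fun k => evalSP (dD n π v) k) (zetaD n π).sgn) := by
  obtain ⟨hb, hR⟩ := realizes_baseWindow hn L S odd hH
  have hβ := isBallotPath_zetaWord hn L S odd hH
  rw [← zetaDraw_eq] at hβ hR
  obtain ⟨δ, hδ⟩ : ∃ δ : ℤ, δ =
    if ((Finset.Icc 1 n).filter (fun r => 0 < areaD n π r)).card % 2 = 1 then -1 else 1 :=
    ⟨_, rfl⟩
  have hw : ∀ i, dD n π v i =
      (if i.val = 0 then δ else 1) * baseWindow n (areaD n π) (labD n π v) i := by
    rw [hδ]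
    exact dD_eq n π v
  have hδ1 : δ = 1 ∨ δ = -1 := by
    rw [hδ]
    split_ifs <;> tauto
  have hsgn : (zetaD n π).sgn = if NthNFollowedByE (zetaDraw n π) n then δ else 1 := by
    rw [hδ]
    unfold zetaD
    dsimp only
    split_ifs <;> first | rfl | omega
  have hseq : ∀ ε, diagSeq n (fun k => evalSP (dD n π v) k) ε =
      diagSeq n (fun k => evalSP (baseWindow n (areaD n π) (labD n π v)) k) (ε * δ) :=
    diagSeq_congr hn fun k => evalSP_eq_of_first hw k
  refine ⟨⟨hβ, ?_, ?_⟩, ⟨?_, ?_⟩, ?_⟩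
  · rw [hsgn]
    split_ifs
    · exact hδ1
    · exact Or.inl rfl
  · intro h
    rw [hsgn]
    exact if_neg h
  · have habs : ∀ i, |dD n π v i| = |baseWindow n (areaD n π) (labD n π v) i| := by
      intro i
      rw [hw i]
      rcases hδ1 with rfl | rfl <;> split_ifs <;> simp
    unfold IsSignedPerm
    simp only [habs]
    exact isSignedPerm_baseWindow hn L S odd hH
  · rw [← prod_sign_eq_one_iff, prod_sign_of_first hn hδ1 hw,
      prod_sign_baseWindow hn L S odd hH, hδ]
    · split_ifs with h
      · rw [Odd.neg_one_pow (Nat.odd_iff.mpr h)]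
        rfl
      · rw [Even.neg_one_pow (Nat.even_iff.mpr (by omega))]
        rfl
    · intro i
      have := (isLetter_baseWindow hn L S odd hH i).1
      rw [hw i]
      rcases hδ1 with rfl | rfl <;> split_ifs <;> omega
  · rw [hseq, hsgn]
    change Realizes n H (zetaDraw n π) _
    by_cases h : NthNFollowedByE (zetaDraw n π) n
    · rw [if_pos h, show δ * δ = 1 by rcases hδ1 with rfl | rfl <;> rfl]
      exact hR
    · rw [if_neg h, one_mul]
      rcases hδ1 with rfl | rfl
      · exact hR
      · rw [← swapMid_diagSeq]
        exact hR.swapMid hb hn hβ ((not_nthNFollowedByE_iff hn hβ).mp h)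

end HLZeta

/-! ### Uniqueness of the diagonally labelled path of an alcove -/

open Step

namespace HLZeta

variable {n : ℕ} {H : ℤ → ℤ} {β β' : List Step} {b b' : ℕ → ℤ}

theorem Realizes.eq_of_lt_mid (hR : Realizes n H β b) (hR' : Realizes n H β' b')
    (hb : IsLetterSeq n b) (hb' : IsLetterSeq n b') {i : ℕ} (hi : 1 ≤ i) (hi' : i < n) :
    b' i = b i := by
  induction i using Nat.strong_induction_on with
  | _ i ih =>
    obtain ⟨j, hj, hj', hji⟩ := hb'.surj (hb.letter i hi (by omega))
    obtain ⟨k, hk, hk', hki⟩ := hb.surj (hb'.letter i hi (by omega))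
    have h1 : i ≤ j := by
      by_contra h
      have h2 := ih j (by omega) hj (by omega)
      have := hb.inj j i hj hj' hi (by omega) (by rw [← h2, hji])
      omega
    have h2 : i ≤ k := by
      by_contra h
      have h2 := ih k (by omega) hk (by omega)
      have := hb'.inj k i hk hk' hi (by omega) (by rw [h2, hki])
      omega
    rcases h1.eq_or_lt with rfl | h1
    · exact hji
    · have h3 := hR'.anti i j hi h1 hj' (by omega)
      rw [hji, ← hki] at h3
      rcases h2.eq_or_lt with rfl | h2
      · omega
      · have := hR.anti i k hi h2 hk' (by omega)
        omega

theorem Realizes.mid_eq_or (hR : Realizes n H β b) (hR' : Realizes n H β' b')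
    (hb : IsLetterSeq n b) (hb' : IsLetterSeq n b') (hn : 2 ≤ n) :
    (∀ i, 1 ≤ i → i ≤ 2 * n → b' i = b i) ∨
      ∀ i, 1 ≤ i → i ≤ 2 * n → b' i = HLZeta.swapMid n b i := by
  have h1 := fun i => hR.eq_of_lt_mid hR' hb hb' (i := i)
  have h2 : ∀ i, n + 1 < i → i ≤ 2 * n → b' i = b i := by
    intro i hi hi'
    have h := h1 (2 * n + 1 - i) (by omega) (by omega)
    rw [hb.mirror i (by omega) hi', hb'.mirror i (by omega) hi'] at h
    omega
  obtain ⟨j, hj, hj', hjn⟩ := hb.surj (hb'.letter n (by omega) (by omega))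
  have h3 : j = n ∨ j = n + 1 := by
    by_contra h
    have h4 : b' j = b j := by
      by_cases h5 : j < n
      · exact h1 j hj h5
      · exact h2 j (by omega) hj'
    have := hb'.inj j n hj hj' (by omega) (by omega) (by rw [h4, hjn])
    omega
  have e := hb.mirror_of_add_eq (i := n) (j := n + 1) (by omega) (by omega) (by omega)
  have e' := hb'.mirror_of_add_eq (i := n) (j := n + 1) (by omega) (by omega) (by omega)
  rcases h3 with rfl | rfl
  · left
    intro i hi hi'
    rcases lt_trichotomy i j with h | rfl | h
    · exact h1 i hi h
    · exact hjn.symm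
    · by_cases h4 : i = j + 1
      · rw [h4, e, e', hjn]
      · exact h2 i (by omega) hi'
  · right
    intro i hi hi'
    unfold HLZeta.swapMid
    rcases lt_trichotomy i n with h | rfl | h
    · rw [if_neg (by omega), h1 i hi h]
    · rw [if_pos (Or.inl rfl), ← hjn, e]
    · by_cases h4 : i = n + 1
      · rw [if_pos (Or.inr h4), h4, hjn, e']
      · rw [if_neg (by omega), h2 i (by omega) hi']

theorem Realizes.path_eq (hR : Realizes n H β b) (hR' : Realizes n H β' b')
    (hβ : IsBallotPath (2 * n - 1) β) (hβ' : IsBallotPath (2 * n - 1) β')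
    (h : ∀ i, 1 ≤ i → i ≤ 2 * n → b' i = b i) : β' = β := by
  refine word_ext (by rw [hβ.1, hβ'.1]) fun i j hi hj hij => ?_
  rw [hβ'.1] at hij
  rw [hR.table i j hi hj (by omega), hR'.table i j hi hj (by omega), h i hi (by omega),
    h j hj (by omega)]

theorem Realizes.path_eq_of_swapMid (hR : Realizes n H β b) (hR' : Realizes n H β' b')
    (hb : IsLetterSeq n b) (hb' : IsLetterSeq n b') (odd : ∀ A, H (-A) = -H A) (hn : 2 ≤ n)
    (hβ : IsBallotPath (2 * n - 1) β) (hβ' : IsBallotPath (2 * n - 1) β')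
    (h : ∀ i, 1 ≤ i → i ≤ 2 * n → b' i = HLZeta.swapMid n b i) :
    β' = β ∧ ebn β n = ebn β (n + 1) := by
  have hn' := h n (by omega) (by omega)
  rw [HLZeta.swapMid, if_pos (Or.inl rfl)] at hn'
  have key : ebn β n < ebn β (n + 1) → ebn β' n < ebn β' (n + 1) → False := by
    intro h1 h2
    have e1 := hR.mid_lt hβ hn h1
    have e2 := hR'.mid_lt hβ' hn h2
    rw [hb.mirror_of_add_eq (i := n) (by omega) (by omega) (by omega), odd] at e1
    rw [hb'.mirror_of_add_eq (i := n) (by omega) (by omega) (by omega), odd, hn', odd] at e2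
    omega
  have m1 : ebn β n ≤ ebn β (n + 1) := ebn_mono β (by omega)
  have m2 : ebn β' n ≤ ebn β' (n + 1) := ebn_mono β' (by omega)
  have hor : ebn β n = ebn β (n + 1) ∨ ebn β' n = ebn β' (n + 1) := by
    by_contra h
    exact key (by omega) (by omega)
  have heq : β' = β := by
    by_cases h1 : ebn β n = ebn β (n + 1)
    · exact (hR.swapMid hb hn hβ h1).path_eq hR' hβ hβ' h
    · refine ((hR'.swapMid hb' hn hβ' (by omega)).path_eq hR hβ' hβ ?_).symm
      intro i hi hi'
      unfold HLZeta.swapMid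
      rw [h i hi hi']
      unfold HLZeta.swapMid
      split_ifs
      · rw [neg_neg]
      · rfl
  subst heq
  exact ⟨rfl, by omega⟩

theorem isSignedPermD_ext (hn : 2 ≤ n) {w w' : Fin n → ℤ} (hw : IsSignedPermD n w)
    (hw' : IsSignedPermD n w') {δ : ℤ} (hδ : δ = 1 ∨ δ = -1)
    (h : ∀ i, w' i = (if i.val = 0 then δ else 1) * w i) : w' = w := by
  have hne : ∀ {u : Fin n → ℤ}, IsSignedPermD n u → ∀ i, u i ≠ 0 := by
    intro u hu i h0
    have := (hu.1.1 i).1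
    rw [h0, abs_zero] at this
    omega
  have h1 := prod_sign_of_first hn hδ h
  rw [(prod_sign_eq_one_iff (hne hw)).mpr hw.2, (prod_sign_eq_one_iff (hne hw')).mpr hw'.2,
    mul_one] at h1
  funext i
  rw [h i, ← h1, ite_self, one_mul]

theorem eq_of_realizes (hn : 2 ≤ n) (odd : ∀ A, H (-A) = -H A) {β β' : SPath}
    {w w' : Fin n → ℤ} (hβ : IsSignedBallotPath n β) (hw : IsSignedPermD n w)
    (hβ' : IsSignedBallotPath n β') (hw' : IsSignedPermD n w')
    (hR : Realizes n H β.path (diagSeq n (fun k => evalSP w k) β.sgn))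
    (hR' : Realizes n H β'.path (diagSeq n (fun k => evalSP w' k) β'.sgn)) :
    (β', w') = (β, w) := by
  have s := (isSignedPerm_iff w).mp hw.1
  have s' := (isSignedPerm_iff w').mp hw'.1
  have hb := isLetterSeq_diagSeq s.1 s.2 hβ.2.1
  have hb' := isLetterSeq_diagSeq s'.1 s'.2 hβ'.2.1
  have hcases : ∃ δ : ℤ, (δ = 1 ∨ δ = -1) ∧
      β'.path = β.path ∧ β'.sgn * evalSP w' (1 : ℕ) = δ * (β.sgn * evalSP w (1 : ℕ)) ∧
      (δ = 1 ∨ β.sgn = 1 ∧ β'.sgn = 1) := by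
    have e : ∀ (u : Fin n → ℤ) ε, diagSeq n (fun k => evalSP u k) ε n =
        ε * evalSP u (1 : ℕ) := by
      intro u ε
      rw [diagSeq, if_neg (by omega), if_pos rfl]
    rcases hR.mid_eq_or hR' hb hb' hn with h | h
    · refine ⟨1, Or.inl rfl, hR.path_eq hR' hβ.1 hβ'.1 h, ?_, Or.inl rfl⟩
      rw [← e, ← e, h n (by omega) (by omega), one_mul]
    · obtain ⟨h1, h2⟩ := hR.path_eq_of_swapMid hR' hb hb' odd hn hβ.1 hβ'.1 h
      refine ⟨-1, Or.inr rfl, h1, ?_, Or.inr ⟨?_, ?_⟩⟩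
      · rw [← e, ← e, h n (by omega) (by omega), swapMid, if_pos (Or.inl rfl), neg_one_mul]
      · exact hβ.2.2 ((not_nthNFollowedByE_iff hn hβ.1).mpr h2)
      · exact hβ'.2.2 ((not_nthNFollowedByE_iff hn hβ'.1).mpr (by rw [h1]; exact h2))
  obtain ⟨δ, hδ, hpath, hmid, hsgn⟩ := hcases
  have hother : ∀ k : ℕ, 2 ≤ k → k ≤ n → evalSP w' k = evalSP w k := by
    intro k hk hk'
    have h := hR.eq_of_lt_mid hR' hb hb' (i := n + 1 - k) (by omega) (by omega)
    unfold diagSeq at h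
    rw [if_pos (by omega), if_pos (by omega), show n + 1 - (n + 1 - k) = k by omega] at h
    exact h
  have h0 := (s.1 1 le_rfl (by omega)).1
  obtain ⟨γ, hγ, hone⟩ : ∃ γ : ℤ, (γ = 1 ∨ γ = -1) ∧ evalSP w' (1 : ℕ) = γ * evalSP w (1 : ℕ) := by
    rcases hβ.2.1 with h1 | h1 <;> rcases hβ'.2.1 with h2 | h2 <;> rcases hδ with rfl | rfl <;>
      rw [h1, h2] at hmid <;>
      first
        | exact ⟨1, Or.inl rfl, by linarith⟩
        | exact ⟨-1, Or.inr rfl, by linarith⟩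
  have hww : w' = w := by
    refine isSignedPermD_ext hn hw hw' hγ fun i => ?_
    rw [← evalSP_succ w i, ← evalSP_succ w' i]
    split_ifs with h
    · rw [h]
      exact hone
    · rw [one_mul, hother _ (by omega) (by omega)]
  subst hww
  have hs : β'.sgn = β.sgn := by
    rcases hsgn with rfl | ⟨h1, h2⟩
    · rw [one_mul] at hmid
      exact mul_right_cancel₀ h0 hmid
    · rw [h1, h2]
  cases β
  cases β'
  simp only at hpath hs
  rw [hpath, hs]

end HLZeta

/-! ### Bijectivity -/

open Step

namespace HLZeta

variable {n : ℕ}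

/-- The alcove of a vertically labelled path, which is also the alcove of its image. -/
theorem exists_alcove (hn : 2 ≤ n) {π : SPath} {v : Fin n → ℤ} (h : (π, v) ∈ VertD n) :
    ∃ H, IsAdmissible n H ∧ IsStable n H ∧ Represents n H (areaD n π) (labD n π v) ∧
      IsSignedBallotPath n (zetaD n π) ∧ IsSignedPermD n (dD n π v) ∧
      Realizes n H (zetaD n π).path
        (diagSeq n (fun k => evalSP (dD n π v) k) (zetaD n π).sgn) := by
  obtain ⟨s, d, C, V⟩ := exists_encodes_of_mem_vertD hn h
  have L := C.isLabelling V hn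
  have S := C.isShi V hn
  obtain ⟨H, odd, hH⟩ := L.exists_represents
  exact ⟨H, L.isAdmissible odd hH, L.isStable S hn odd hH, hH, realizes_image hn L S odd hH⟩

theorem isLetterSeq_of_isSignedPermD {β : SPath} {w : Fin n → ℤ} (hβ : IsSignedBallotPath n β)
    (hw : IsSignedPermD n w) : IsLetterSeq n (diagSeq n (fun k => evalSP w k) β.sgn) :=
  have h := (isSignedPerm_iff w).mp hw.1
  isLetterSeq_diagSeq h.1 h.2 hβ.2.1

theorem mapsTo_zeta (hn : 2 ≤ n) :
    Set.MapsTo (fun p : SPath × (Fin n → ℤ) => (zetaD n p.1, dD n p.1 p.2))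
      (VertD n) (DiagD n) := by
  rintro ⟨π, v⟩ h
  obtain ⟨H, ad, st, -, hβ, hw, hR⟩ := exists_alcove hn h
  have hb := isLetterSeq_of_isSignedPermD hβ hw
  exact (mem_diagD_iff hn).mpr ⟨hβ, hw, fun i j => hR.lt_of_isValley hb hn ad st hβ.1,
    fun i => hR.abs_lt_of_isValley hb hn ad st hβ.1⟩

theorem injOn_zeta (hn : 2 ≤ n) :
    Set.InjOn (fun p : SPath × (Fin n → ℤ) => (zetaD n p.1, dD n p.1 p.2)) (VertD n) := by
  rintro ⟨π, v⟩ h ⟨π', v'⟩ h' heq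
  obtain ⟨s, d, C, V⟩ := exists_encodes_of_mem_vertD hn h
  obtain ⟨s', d', C', V'⟩ := exists_encodes_of_mem_vertD hn h'
  have L := C.isLabelling V hn
  have L' := C'.isLabelling V' hn
  obtain ⟨H, ad, st, hH, hβ, hw, hR⟩ := exists_alcove hn h
  obtain ⟨H', ad', st', hH', -, -, hR'⟩ := exists_alcove hn h'
  rw [Prod.mk.injEq] at heq
  dsimp only at heq
  rw [← heq.1, ← heq.2] at hR'
  have hb := isLetterSeq_of_isSignedPermD hβ hw
  have sr := hR.sameRegion hR' hb ad.odd ad'.odd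
  have hHH : Represents n H (areaD n π') (labD n π' v') := by
    intro k hk hk'
    rw [← hH' k hk hk']
    exact (ad.eq_of_sameRegion st hn ad' st' sr (L'.letter k hk hk')).symm
  have key := fun k hk hk' => L.eq_of_represents L' hn ad.odd hH hHH (k := k) hk hk'
  exact vertD_ext hn h h' (fun k hk hk' => (key k hk hk').2.symm)
    fun k hk hk' => (key k hk hk').1.symm

theorem surjOn_zeta (hn : 2 ≤ n) :
    Set.SurjOn (fun p : SPath × (Fin n → ℤ) => (zetaD n p.1, dD n p.1 p.2))
      (VertD n) (DiagD n) := by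
  rintro ⟨β, w⟩ h
  obtain ⟨hβ, hw, hv, hv'⟩ := (mem_diagD_iff hn).mp h
  have hb := isLetterSeq_of_isSignedPermD hβ hw
  obtain ⟨H₀, ad₀, hR₀⟩ := hb.exists_realizes hn hβ.1
  obtain ⟨H, ad, st, hR⟩ := hR₀.exists_stable ad₀ hb hβ.1 hn hv hv'
  obtain ⟨μ, ℓ, L, hH⟩ := ad.exists_isLabelling hn
  have S := L.isShi st hn ad.odd hH
  obtain ⟨π, v, hmem, hπ⟩ := exists_mem_vertD hn L S
  have hH' : Represents n H (areaD n π) (labD n π v) := by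
    intro k hk hk'
    rw [(hπ k hk hk').1, (hπ k hk hk').2]
    exact hH k hk hk'
  obtain ⟨hβ', hw', hR'⟩ := realizes_image hn (L.congr hπ) (S.congr hn hπ) ad.odd hH'
  exact ⟨(π, v), hmem, eq_of_realizes hn ad.odd hβ hw hβ' hw' hR hR'⟩

end HLZeta

/-- The Haglund–Loehr zeta map of type `Dₙ` is a bijection from
`Vert(Dₙ)` onto `Diag(Dₙ)`. -/
theorem HLzetaD_bijOn (n : ℕ) (hn : 2 ≤ n) :
    Set.BijOn (fun p : SPath × (Fin n → ℤ) => (zetaD n p.1, dD n p.1 p.2))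
      (VertD n) (DiagD n) := by
  exact ⟨HLZeta.mapsTo_zeta hn, HLZeta.injOn_zeta hn, HLZeta.surjOn_zeta hn⟩
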